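/- arXiv:2412.07974 — 3 statements merged into one kernel-verified Lean document; each statement's English description precedes it below -/
import Mathlib

section
/- Let n > 2k > 0 and let F be an intersecting family of k-element subsets of [n]. If the diversity satisfies γ(F) ≥ C(n−u−1, n−k−1) for some real number u with 3 ≤ u ≤ k (where C(x,m) denotes the generalized binomial coefficient for real x), then |F| ≤ C(n−1,k−1) + C(n−u−1, n−k−1) − C(n−u−1, k−1). -/
/-- The generalized binomial coefficient `C(x, m) = x(x-1)⋯(x-m+1)/m!` for real `x`. -/
noncomputable def genChoose (x : ℝ) (m : ℕ) : ℝ :=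
  (∏ i ∈ Finset.range m, (x - i)) / (Nat.factorial m)

/-- A family is intersecting if any two of its members intersect. -/
def Intersecting (F : Finset (Finset ℕ)) : Prop :=
  ∀ A ∈ F, ∀ B ∈ F, (A ∩ B).Nonempty

/-- The diversity `γ(F) = min_{i ∈ [n]} |F(ī)|`. -/
noncomputable def diversity (n : ℕ) (F : Finset (Finset ℕ)) : ℕ :=
  sInf ((fun i => (F.filter (fun A => i ∉ A)).card) '' (Set.Icc 1 n))

lemma gc_zero (x : ℝ) : genChoose x 0 = 1 := by simp [genChoose]

lemma gc_succ (x : ℝ) (m : ℕ) : genChoose x (m+1) * (m+1) = genChoose x m * (x - m) := by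
  unfold genChoose
  rw [Finset.prod_range_succ, Nat.factorial_succ]
  have : (Nat.factorial m : ℝ) ≠ 0 := by positivity
  push_cast
  field_simp

lemma gc_pred (x : ℝ) (m : ℕ) : genChoose x (m+1) * (m+1) = x * genChoose (x-1) m := by
  unfold genChoose
  rw [Finset.prod_range_succ', Nat.factorial_succ]
  have : (Nat.factorial m : ℝ) ≠ 0 := by positivity
  push_cast
  have h : ∀ i : ℕ, x - ((i:ℝ) + 1) = x - 1 - i := fun i => by ring
  simp only [h]
  field_simp
  simp
  ring

lemma gc_pos (x : ℝ) (m : ℕ) (h : (m:ℝ) - 1 < x) : 0 < genChoose x m := by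
  unfold genChoose
  apply div_pos _ (by positivity)
  apply Finset.prod_pos
  intro i hi
  have : (i:ℝ) + 1 ≤ m := by exact_mod_cast Finset.mem_range.1 hi
  linarith

lemma gc_mono (x y : ℝ) (m : ℕ) (h : (m:ℝ) - 1 ≤ x) (hxy : x ≤ y) :
    genChoose x m ≤ genChoose y m := by
  unfold genChoose
  gcongr with i hi
  intro i hi
  have : (i:ℝ) + 1 ≤ m := by exact_mod_cast Finset.mem_range.1 hi
  linarith

lemma gc_strict (x y : ℝ) (m : ℕ) (hm : 0 < m) (h : (m:ℝ) - 1 < x) (hxy : x < y) :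
    genChoose x m < genChoose y m := by
  unfold genChoose
  apply div_lt_div_of_pos_right _ (by positivity)
  apply Finset.prod_lt_prod_of_nonempty
  · intro i hi
    have : (i:ℝ) + 1 ≤ m := by exact_mod_cast Finset.mem_range.1 hi
    linarith
  · intro i hi
    linarith
  · exact ⟨0, Finset.mem_range.2 hm⟩

lemma gc_cast (N m : ℕ) : genChoose (N:ℝ) m = (N.choose m : ℝ) := by
  induction m with
  | zero => simp [gc_zero]
  | succ m ih =>
    have h := gc_succ N m
    rw [ih] at h
    have h2 : (N.choose (m+1) : ℝ) * (m+1) = N.choose m * ((N:ℝ) - m) := by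
      rcases le_or_gt m N with hm | hm
      · have := Nat.choose_succ_right_eq N m
        rw [← Nat.cast_sub hm]
        exact_mod_cast this
      · rw [Nat.choose_eq_zero_of_lt hm, Nat.choose_eq_zero_of_lt (by omega)]; simp
    have h3 : ((m:ℝ)+1) ≠ 0 := by positivity
    exact mul_right_cancel₀ h3 (h.trans h2.symm)

lemma gc_continuous (m : ℕ) : Continuous (fun x => genChoose x m) := by
  unfold genChoose
  fun_prop

lemma gc_exists (m : ℕ) (x y v : ℝ) (hxy : x ≤ y) (h1 : genChoose x m ≤ v)
    (h2 : v ≤ genChoose y m) : ∃ z, x ≤ z ∧ z ≤ y ∧ genChoose z m = v := by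
  obtain ⟨z, hz, h⟩ := intermediate_value_Icc hxy (gc_continuous m).continuousOn ⟨h1, h2⟩
  exact ⟨z, hz.1, hz.2, h⟩

/-- Clique form of the Lovász Kruskal-Katona. -/
lemma keevash (r : ℕ) : ∀ (x : ℝ) (G K : Finset (Finset ℕ)), 1 ≤ r → (r:ℝ) ≤ x →
    (∀ A ∈ G, A.card = r) → (∀ T ∈ K, T.card = r + 1) →
    (∀ T ∈ K, ∀ v ∈ T, T.erase v ∈ G) → (G.card : ℝ) ≤ genChoose x r →
    (K.card : ℝ) ≤ genChoose x (r+1) := by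
  induction r with
  | zero => intro x G K h; omega
  | succ r ih =>
    intro x G K _ hx hG hK hKG hc
    push_cast at hx
    set S : Finset ℕ := G.biUnion id ∪ K.biUnion id with hS
    have key : ∀ v ∈ S, ((K.filter (fun T => v ∈ T)).card : ℝ) * (r+1) ≤
        (x - (r+1)) * ((G.filter (fun A => v ∈ A)).card : ℝ) := by
      intro v _
      set d := (G.filter (fun A => v ∈ A)) with hd
      set Kv := (K.filter (fun T => v ∈ T)) with hKv
      -- first bound
      have b1 : Kv.card + d.card ≤ G.card := by
        have : (Kv.image (fun T => T.erase v)) ⊆ G.filter (fun A => v ∉ A) := by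
          intro A hA
          obtain ⟨T, hT, rfl⟩ := Finset.mem_image.1 hA
          have hT' := Finset.mem_filter.1 hT
          exact Finset.mem_filter.2 ⟨hKG T hT'.1 v hT'.2, Finset.notMem_erase _ _⟩
        have h2 := Finset.card_le_card this
        rw [Finset.card_image_of_injOn] at h2
        · have := Finset.card_filter_add_card_filter_not (s := G) (fun A => v ∈ A)
          rw [← hd] at this
          omega
        · intro T hT T' hT' h
          have hT := Finset.mem_filter.1 hT
          have hT' := Finset.mem_filter.1 hT'
          have h : T.erase v = T'.erase v := h
          rw [← Finset.insert_erase hT.2, ← Finset.insert_erase hT'.2, h]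
      have b1' : (Kv.card : ℝ) + d.card ≤ G.card := by exact_mod_cast b1
      rcases le_or_gt (genChoose (x-1) r) (d.card : ℝ) with hcase | hcase
      · have := gc_pred x r
        nlinarith [(Nat.cast_nonneg d.card : (0:ℝ) ≤ d.card)]
      · rcases Nat.eq_zero_or_pos d.card with hd0 | hdpos
        · have : Kv = ∅ := by
            by_contra hne
            obtain ⟨T, hT⟩ := Finset.nonempty_iff_ne_empty.2 hne
            have hT' := Finset.mem_filter.1 hT
            have hc := hK T hT'.1
            have : (T.erase v).Nonempty := by
              rw [← Finset.card_pos, Finset.card_erase_of_mem hT'.2]; omega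
            obtain ⟨w, hw⟩ := this
            have hw' := Finset.mem_erase.1 hw
            have : T.erase w ∈ d := Finset.mem_filter.2 ⟨hKG T hT'.1 w hw'.2,
              Finset.mem_erase.2 ⟨hw'.1.symm, hT'.2⟩⟩
            rw [Finset.card_eq_zero] at hd0
            rw [hd0] at this; simp at this
          rw [this, hd0]; simp
        · have hr : 1 ≤ r := by
            by_contra h
            have : r = 0 := by omega
            subst this
            rw [gc_zero] at hcase
            have : d.card < 1 := by exact_mod_cast hcase
            omega
          have h1 : genChoose (r:ℝ) r ≤ d.card := by
            rw [gc_cast]; simp only [Nat.choose_self]; exact_mod_cast hdpos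
          obtain ⟨y, hy1, hy2, hy⟩ := gc_exists r r (x-1) d.card (by linarith) h1 hcase.le
          have hinj : ∀ (H : Finset (Finset ℕ)), (H.filter (fun A => v ∈ A)).card =
              ((H.filter (fun A => v ∈ A)).image (fun A => A.erase v)).card := by
            intro H
            rw [Finset.card_image_of_injOn]
            intro T hT T' hT' h
            have hT := Finset.mem_filter.1 hT
            have hT' := Finset.mem_filter.1 hT'
            have h : T.erase v = T'.erase v := h
            rw [← Finset.insert_erase hT.2, ← Finset.insert_erase hT'.2, h]
          have := ih y (d.image (fun A => A.erase v)) (Kv.image (fun A => A.erase v)) hr hy1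
            (by
              intro A hA
              obtain ⟨T, hT, rfl⟩ := Finset.mem_image.1 hA
              have hT := Finset.mem_filter.1 hT
              rw [Finset.card_erase_of_mem hT.2, hG T hT.1]; rfl)
            (by
              intro A hA
              obtain ⟨T, hT, rfl⟩ := Finset.mem_image.1 hA
              have hT := Finset.mem_filter.1 hT
              rw [Finset.card_erase_of_mem hT.2, hK T hT.1]; rfl)
            (by
              intro A hA w hw
              obtain ⟨T, hT, rfl⟩ := Finset.mem_image.1 hA
              have hT := Finset.mem_filter.1 hT
              have hw' := Finset.mem_erase.1 hw
              refine Finset.mem_image.2 ⟨T.erase w, Finset.mem_filter.2 ⟨hKG T hT.1 w hw'.2, ?_⟩, ?_⟩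
              · exact Finset.mem_erase.2 ⟨hw'.1.symm, hT.2⟩
              · exact Finset.erase_right_comm)
            (by rw [hy, ← hinj G])
          rw [← hinj K] at this
          have h3 := gc_succ y r
          rw [hy] at h3
          have hdn : (0:ℝ) ≤ d.card := Nat.cast_nonneg _
          have h4 : (Kv.card:ℝ) * (r+1) ≤ genChoose y (r+1) * (r+1) := by
            apply mul_le_mul_of_nonneg_right this; positivity
          nlinarith
    have dc : ∀ (H : Finset (Finset ℕ)) (m : ℕ), H.biUnion id ⊆ S → (∀ A ∈ H, A.card = m) →
        ∑ v ∈ S, ((H.filter (fun A => v ∈ A)).card : ℝ) = m * H.card := by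
      intro H m hHS hm
      have : ∑ v ∈ S, (H.filter (fun A => v ∈ A)).card = m * H.card := by
        have h1 := Finset.sum_card_bipartiteAbove_eq_sum_card_bipartiteBelow (s := S) (t := H)
          (fun v A => v ∈ A)
        unfold Finset.bipartiteAbove Finset.bipartiteBelow at h1
        rw [h1, Finset.sum_congr rfl (g := fun _ => m), Finset.sum_const, smul_eq_mul, mul_comm]
        intro A hA
        rw [← hm A hA]
        congr 1
        ext v
        simp only [Finset.mem_filter, and_iff_right_iff_imp]
        intro hv
        exact hHS (Finset.mem_biUnion.2 ⟨A, hA, hv⟩)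
      exact_mod_cast this
    have s1 := dc K _ (Finset.subset_union_right) hK
    have s2 := dc G _ (Finset.subset_union_left) hG
    have s3 := Finset.sum_le_sum key
    rw [← Finset.sum_mul, ← Finset.mul_sum, s1, s2] at s3
    push_cast at s3
    have h5 := gc_succ x (r+1)
    push_cast at h5
    have hr1 : (0:ℝ) < r + 1 := by positivity
    have s4 : (K.card : ℝ) * (r + 1 + 1) ≤ (x - (r+1)) * G.card := by
      have : ((K.card : ℝ) * (r + 1 + 1)) * (r+1) ≤ ((x - (r+1)) * G.card) * (r+1) := by linarith
      exact le_of_mul_le_mul_right this hr1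
    have s5 : (x - (r+1)) * G.card ≤ (x - (r+1)) * genChoose x (r+1) :=
      mul_le_mul_of_nonneg_left hc (by linarith)
    have s6 : (K.card : ℝ) * (r + 1 + 1) ≤ genChoose x (r+1+1) * (r+1+1) := by linarith
    exact le_of_mul_le_mul_right s6 (by positivity)

/-- Sets of size `l` contained in some member. -/
def lowerShadow (l : ℕ) (H : Finset (Finset ℕ)) : Finset (Finset ℕ) :=
  H.biUnion (fun A => A.powersetCard l)

lemma mem_lowerShadow {l : ℕ} {H : Finset (Finset ℕ)} {B : Finset ℕ} :
    B ∈ lowerShadow l H ↔ ∃ A ∈ H, B ⊆ A ∧ B.card = l := by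
  simp [lowerShadow, Finset.mem_powersetCard]

lemma lovasz_one (r : ℕ) (x : ℝ) (H : Finset (Finset ℕ)) (hx : (r:ℝ) + 1 ≤ x)
    (hH : ∀ A ∈ H, A.card = r + 1) (hc : genChoose x (r+1) ≤ H.card) :
    genChoose x r ≤ (lowerShadow r H).card := by
  by_contra hcon
  push Not at hcon
  have hne : H.Nonempty := by
    rw [← Finset.card_pos]
    have := gc_pos x (r+1) (by push_cast; linarith)
    exact_mod_cast this.trans_le hc
  obtain ⟨A, hA⟩ := hne
  have hpos : 1 ≤ (lowerShadow r H).card := by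
    obtain ⟨B, hB, hBc⟩ := Finset.exists_subset_card_eq (s := A) (n := r) (by rw [hH A hA]; omega)
    exact Finset.card_pos.2 ⟨B, mem_lowerShadow.2 ⟨A, hA, hB, hBc⟩⟩
  rcases Nat.eq_zero_or_pos r with rfl | hr
  · rw [gc_zero] at hcon
    have : (lowerShadow 0 H).card < 1 := by exact_mod_cast hcon
    omega
  · obtain ⟨y, hy1, hy2, hy⟩ := gc_exists r r x (lowerShadow r H).card (by linarith)
      (by rw [gc_cast]; simp only [Nat.choose_self]; exact_mod_cast hpos) hcon.le
    have hyx : y < x := by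
      rcases hy2.lt_or_eq with h | h
      · exact h
      · subst h; linarith
    have := keevash r y (lowerShadow r H) H hr hy1
      (fun A hA => by obtain ⟨_, _, _, h⟩ := mem_lowerShadow.1 hA; exact h) hH
      (fun T hT v hv => mem_lowerShadow.2 ⟨T, hT, Finset.erase_subset _ _, by
        rw [Finset.card_erase_of_mem hv, hH T hT]; rfl⟩) hy.ge
    have h2 := gc_strict y x (r+1) (by omega) (by
      push_cast; 
      rcases hy1.lt_or_eq with h | h
      · linarith
      · exfalso
        have h3 := gc_succ y r
        rw [← h, sub_self, mul_zero] at h3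
        have h4 : genChoose (r:ℝ) (r+1) = 0 := by
          rcases mul_eq_zero.1 h3 with h | h
          · exact h
          · have : (0:ℝ) < r + 1 := by positivity
            linarith
        rw [← h, h4] at this
        have h7 := gc_pos x (r+1) (by push_cast; linarith)
        linarith) hyx
    linarith

lemma lovasz (l d : ℕ) : ∀ (x : ℝ) (H : Finset (Finset ℕ)), ((l + d : ℕ):ℝ) ≤ x →
    (∀ A ∈ H, A.card = l + d) → genChoose x (l+d) ≤ H.card →
    genChoose x l ≤ (lowerShadow l H).card := by
  induction d with
  | zero =>
    intro x H hx hH hc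
    refine hc.trans ?_
    have : H ⊆ lowerShadow l H := fun A hA =>
      mem_lowerShadow.2 ⟨A, hA, Finset.Subset.refl _, hH A hA⟩
    exact_mod_cast Finset.card_le_card this
  | succ d ih =>
    intro x H hx hH hc
    have h1 := lovasz_one (l+d) x H (by push_cast at hx ⊢; linarith) hH hc
    have h2 := ih x (lowerShadow (l+d) H) (by push_cast at hx ⊢; linarith)
      (fun A hA => by obtain ⟨_, _, _, h⟩ := mem_lowerShadow.1 hA; exact h) h1
    refine h2.trans ?_
    have : lowerShadow l (lowerShadow (l+d) H) ⊆ lowerShadow l H := by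
      intro B hB
      obtain ⟨A, hA, hBA, hBc⟩ := mem_lowerShadow.1 hB
      obtain ⟨A', hA', hAA, _⟩ := mem_lowerShadow.1 hA
      exact mem_lowerShadow.2 ⟨A', hA', hBA.trans hAA, hBc⟩
    exact_mod_cast Finset.card_le_card this

/-- Cross-intersecting families via Kruskal-Katona. -/
lemma cross (S : Finset ℕ) (p q b : ℕ) (P Q : Finset (Finset ℕ)) (hb : p + b = S.card)
    (hq : q ≤ b) (hP : P ⊆ S.powersetCard p) (hQ : Q ⊆ S.powersetCard q)
    (hPQ : ∀ A ∈ P, ∀ B ∈ Q, (A ∩ B).Nonempty) (x : ℝ) (hx : (b:ℝ) ≤ x)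
    (hc : genChoose x b ≤ P.card) :
    (Q.card : ℝ) + genChoose x q ≤ (S.card.choose q : ℝ) := by
  set H := P.image (fun A => S \ A) with hH
  have hHc : H.card = P.card := by
    apply Finset.card_image_of_injOn
    intro A hA B hB h
    have h : S \ A = S \ B := h
    have hA := (Finset.mem_powersetCard.1 (hP hA)).1
    have hB := (Finset.mem_powersetCard.1 (hP hB)).1
    rw [← Finset.sdiff_sdiff_eq_self hA, ← Finset.sdiff_sdiff_eq_self hB, h]
  obtain ⟨d, rfl⟩ := Nat.exists_eq_add_of_le hq
  have h1 := lovasz q d x H hx (by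
    intro A hA
    obtain ⟨B, hB, rfl⟩ := Finset.mem_image.1 hA
    have hB := Finset.mem_powersetCard.1 (hP hB)
    rw [Finset.card_sdiff_of_subset hB.1]; omega) (by rw [hHc]; exact hc)
  have h2 : Q.card + (lowerShadow q H).card ≤ S.card.choose q := by
    rw [← Finset.card_powersetCard, ← Finset.card_union_of_disjoint]
    · apply Finset.card_le_card
      apply Finset.union_subset hQ
      intro B hB
      obtain ⟨A, hA, hBA, hBc⟩ := mem_lowerShadow.1 hB
      obtain ⟨C, hC, rfl⟩ := Finset.mem_image.1 hA
      exact Finset.mem_powersetCard.2 ⟨hBA.trans Finset.sdiff_subset, hBc⟩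
    · rw [Finset.disjoint_left]
      intro B hB hB'
      obtain ⟨A, hA, hBA, hBc⟩ := mem_lowerShadow.1 hB'
      obtain ⟨C, hC, rfl⟩ := Finset.mem_image.1 hA
      obtain ⟨z, hz⟩ := hPQ C hC B hB
      have hz := Finset.mem_inter.1 hz
      exact (Finset.mem_sdiff.1 (hBA hz.2)).2 hz.1
  have h3 : (Q.card:ℝ) + (lowerShadow q H).card ≤ S.card.choose q := by exact_mod_cast h2
  linarith

noncomputable def ratioH (a b : ℕ) (x : ℝ) : ℝ :=
  (∏ i ∈ Finset.Ico a b, (x - i)) * (Nat.factorial a / Nat.factorial b)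

lemma gc_ratio (a b : ℕ) (hab : a ≤ b) (x : ℝ) :
    genChoose x b = genChoose x a * ratioH a b x := by
  unfold genChoose ratioH
  rw [← Finset.prod_range_mul_prod_Ico _ hab]
  have : (Nat.factorial a : ℝ) ≠ 0 := by positivity
  field_simp

lemma ratioH_one (a b : ℕ) (hab : a ≤ b) : ratioH a b ((a:ℝ) + b) = 1 := by
  have h := gc_ratio a b hab ((a:ℝ) + b)
  have h1 : genChoose ((a:ℝ) + b) b = genChoose ((a:ℝ) + b) a := by
    have e : ((a:ℝ) + b) = ((a + b : ℕ) : ℝ) := by push_cast; ring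
    rw [e, gc_cast, gc_cast, Nat.choose_symm_add]
  have h2 : 0 < genChoose ((a:ℝ) + b) a := gc_pos _ _ (by
    have : (0:ℝ) ≤ b := Nat.cast_nonneg _
    linarith)
  rw [h1] at h
  have := mul_left_cancel₀ h2.ne' ((mul_one _).trans h)
  exact this.symm

lemma ratioH_mono (a b : ℕ) (x y : ℝ) (hx : (b:ℝ) - 1 ≤ x) (hxy : x ≤ y) :
    ratioH a b x ≤ ratioH a b y := by
  unfold ratioH
  apply mul_le_mul_of_nonneg_right _ (by positivity)
  apply Finset.prod_le_prod
  · intro i hi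
    have : (i:ℝ) + 1 ≤ b := by exact_mod_cast (Finset.mem_Ico.1 hi).2
    linarith
  · intro i hi
    linarith

lemma ratioH_strict (a b : ℕ) (hab : a < b) (x y : ℝ) (hx : (b:ℝ) - 1 < x) (hxy : x < y) :
    ratioH a b x < ratioH a b y := by
  unfold ratioH
  apply mul_lt_mul_of_pos_right _ (by positivity)
  apply Finset.prod_lt_prod_of_nonempty
  · intro i hi
    have : (i:ℝ) + 1 ≤ b := by exact_mod_cast (Finset.mem_Ico.1 hi).2
    linarith
  · intro i hi
    linarith
  · exact Finset.nonempty_Ico.2 hab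

lemma gc_le_sym (a b : ℕ) (hab : a ≤ b) (x : ℝ) (hx : (b:ℝ) - 1 < x) (hx2 : x ≤ (a:ℝ) + b) :
    genChoose x b ≤ genChoose x a := by
  rw [gc_ratio a b hab]
  have h1 := ratioH_mono a b x _ hx.le hx2
  rw [ratioH_one a b hab] at h1
  have hab' : (a:ℝ) ≤ b := by exact_mod_cast hab
  have := gc_pos x a (by linarith)
  nlinarith

lemma prod_convex (c : ℝ) (T : Finset ℕ) (hT : ∀ i ∈ T, (i:ℝ) ≤ c) (d : ℝ) :
    ConvexOn ℝ (Set.Ioo c d) (fun x => ∏ i ∈ T, (x - i)) ∧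
    MonotoneOn (fun x => ∏ i ∈ T, (x - (i:ℝ))) (Set.Ioo c d) ∧
    ∀ x ∈ Set.Ioo c d, 0 ≤ ∏ i ∈ T, (x - (i:ℝ)) := by
  induction T using Finset.induction_on with
  | empty => exact ⟨by simpa using convexOn_const 1 (convex_Ioo c d), by simp [monotoneOn_const],
      by simp⟩
  | insert j T hj ih =>
    obtain ⟨h1, h2, h3⟩ := ih (fun i hi => hT i (Finset.mem_insert_of_mem hi))
    have hjc := hT j (Finset.mem_insert_self _ _)
    have m1 : MonotoneOn (fun x : ℝ => x - j) (Set.Ioo c d) := by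
      intro x _ y _ h; simpa using h
    have c1 : ConvexOn ℝ (Set.Ioo c d) (fun x : ℝ => x - j) :=
      (convexOn_id (convex_Ioo c d)).sub (concaveOn_const _ (convex_Ioo c d))
    have n1 : ∀ x ∈ Set.Ioo c d, 0 ≤ x - j := fun x hx => by linarith [hx.1]
    simp only [Finset.prod_insert hj]
    refine ⟨?_, ?_, ?_⟩
    · exact c1.mul h1 (fun x hx => n1 x hx) (fun x hx => h3 x hx) (m1.monovaryOn h2)
    · intro x hx y hy h
      exact mul_le_mul (m1 hx hy h) (h2 hx hy h) (h3 x hx) (n1 y hy)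
    · intro x hx
      exact mul_nonneg (n1 x hx) (h3 x hx)

lemma sumlog_concave (c d : ℝ) (T : Finset ℕ) (hT : ∀ i ∈ T, (i:ℝ) ≤ c) :
    ConcaveOn ℝ (Set.Ioo c d) (fun x => ∑ i ∈ T, Real.log (x - i)) := by
  induction T using Finset.induction_on with
  | empty => simpa using concaveOn_const 0 (convex_Ioo c d)
  | insert j T hj ih =>
    have h1 := ih (fun i hi => hT i (Finset.mem_insert_of_mem hi))
    have hjc := hT j (Finset.mem_insert_self _ _)
    simp only [Finset.sum_insert hj]
    refine ConcaveOn.add ?_ h1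
    refine ⟨convex_Ioo c d, ?_⟩
    intro x hx y hy s t hs ht hst
    have := strictConcaveOn_log_Ioi.concaveOn.2 (x := x - j) (y := y - j)
      (by simp; linarith [hx.1]) (by simp; linarith [hy.1]) hs ht hst
    refine this.trans_eq ?_
    congr 1
    simp only [smul_eq_mul]
    linear_combination (-(j:ℝ)) * hst

noncomputable def phiFun (a b : ℕ) (x : ℝ) : ℝ :=
  (∑ i ∈ Finset.range a, Real.log (x - i)) + Real.log (1 - ratioH a b x)

lemma ratioH_lt_one (a b : ℕ) (hab : a < b) (x : ℝ) (hx : x ∈ Set.Ioo ((b:ℝ) - 1) ((a:ℝ)+b)) :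
    ratioH a b x < 1 := by
  rw [← ratioH_one a b hab.le]
  exact ratioH_strict a b hab _ _ hx.1 hx.2

lemma phi_concave (a b : ℕ) (hab : a < b) :
    ConcaveOn ℝ (Set.Ioo ((b:ℝ) - 1) ((a:ℝ) + b)) (phiFun a b) := by
  unfold phiFun
  have hab' : (a:ℝ) + 1 ≤ b := by exact_mod_cast hab
  refine ConcaveOn.add (sumlog_concave _ _ _ ?_) ?_
  · intro i hi
    have : (i:ℝ) + 1 ≤ a := by exact_mod_cast Finset.mem_range.1 hi
    linarith
  · have hc := (prod_convex ((b:ℝ)-1) (Finset.Ico a b) (fun i hi => by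
      have : (i:ℝ) + 1 ≤ b := by exact_mod_cast (Finset.mem_Ico.1 hi).2
      linarith) ((a:ℝ)+b)).1
    refine ⟨convex_Ioo _ _, ?_⟩
    intro x hx y hy s t hs ht hst
    have l1 := ratioH_lt_one a b hab x hx
    have l2 := ratioH_lt_one a b hab y hy
    have := strictConcaveOn_log_Ioi.concaveOn.2 (x := 1 - ratioH a b x) (y := 1 - ratioH a b y)
      (by simpa using l1) (by simpa using l2) hs ht hst
    refine this.trans ?_
    have h1 : ratioH a b (s • x + t • y) ≤ s * ratioH a b x + t * ratioH a b y := by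
      have := hc.2 hx hy hs ht hst
      unfold ratioH
      simp only [smul_eq_mul] at this ⊢
      have f : (0:ℝ) ≤ (Nat.factorial a / Nat.factorial b) := by positivity
      have := mul_le_mul_of_nonneg_right this f
      linarith
    apply Real.log_le_log
    · simp only [smul_eq_mul]
      rcases hs.lt_or_eq with h | h
      · have : 0 < s * (1 - ratioH a b x) := mul_pos h (by linarith)
        have : 0 ≤ t * (1 - ratioH a b y) := mul_nonneg ht (by linarith)
        linarith
      · have : t = 1 := by linarith
        rw [← h, this]; linarith
    · simp only [smul_eq_mul] at h1 ⊢
      linarith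

lemma concave_aux (s : Set ℝ) (φ : ℝ → ℝ) (hφ : ConcaveOn ℝ s φ) (p q x y : ℝ) (hp : p ∈ s)
    (hq : q ∈ s) (hx : x ∈ s) (hy : y ∈ s) (hpq : p < q) (he : φ p = φ q) (hxy : x ≤ y)
    (hxp : x ≤ p) (hyq : y ≤ q) : φ x ≤ φ y := by
  have key : ∀ x y, x ∈ s → y ∈ s → x ≤ y → y ≤ p → φ x ≤ φ y := by
    intro x y hx hy hxy hyp
    by_contra hcon
    push Not at hcon
    have hxy' : x < y := lt_of_le_of_ne hxy (by rintro rfl; exact lt_irrefl _ hcon)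
    have neg : (φ y - φ x) / (y - x) < 0 := div_neg_of_neg_of_pos (by linarith) (by linarith)
    rcases hyp.lt_or_eq with h | h
    · have h1 := hφ.slope_anti_adjacent hx hp hxy' h
      have h2 := hφ.slope_anti_adjacent hy hq h hpq
      rw [he, sub_self, zero_div] at h2
      rw [he] at h1
      linarith
    · subst h
      have h2 := hφ.slope_anti_adjacent hx hq hxy' hpq
      rw [he, sub_self, zero_div] at h2
      rw [he] at neg
      linarith
  rcases le_total y p with h | h
  · exact key x y hx hy hxy h
  · have h1 := key x p hx hp hxp le_rfl
    have h2 := hφ.min_le_of_mem_Icc hp hq (show y ∈ Set.Icc p q from ⟨h, hyq⟩)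
    rw [← he, min_self] at h2
    linarith

lemma gc_phi (a b : ℕ) (hab : a < b) (x : ℝ) (hx : x ∈ Set.Ioo ((b:ℝ) - 1) ((a:ℝ)+b)) :
    0 < genChoose x a - genChoose x b ∧
    Real.log (genChoose x a - genChoose x b) = phiFun a b x - Real.log (Nat.factorial a) := by
  have l1 := ratioH_lt_one a b hab x hx
  have hab' : (a:ℝ) + 1 ≤ b := by exact_mod_cast hab
  have hpos := gc_pos x a (by linarith [hx.1])
  have e : genChoose x a - genChoose x b = genChoose x a * (1 - ratioH a b x) := by
    rw [gc_ratio a b hab.le]; ring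
  rw [e]
  refine ⟨mul_pos hpos (by linarith), ?_⟩
  rw [Real.log_mul hpos.ne' (by linarith)]
  unfold phiFun
  have : Real.log (genChoose x a) = (∑ i ∈ Finset.range a, Real.log (x - i)) -
      Real.log (Nat.factorial a) := by
    have hne : ∀ i ∈ Finset.range a, x - (i:ℝ) ≠ 0 := by
      intro i hi
      have : (i:ℝ) + 1 ≤ a := by exact_mod_cast Finset.mem_range.1 hi
      have := hx.1
      intro h
      linarith
    unfold genChoose
    rw [Real.log_div (Finset.prod_ne_zero_iff.2 hne) (by positivity), Real.log_prod hne]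
  rw [this]; ring

lemma gc_pq (a b : ℕ) (ha : 1 ≤ a) (hb : 1 ≤ b) :
    genChoose ((a:ℝ) + b - 2) a - genChoose ((a:ℝ) + b - 2) b =
    genChoose ((a:ℝ) + b - 1) a - genChoose ((a:ℝ) + b - 1) b := by
  obtain ⟨a, rfl⟩ := Nat.exists_eq_add_of_le' ha
  obtain ⟨b, rfl⟩ := Nat.exists_eq_add_of_le' hb
  have e1 : (((a+1:ℕ):ℝ) + ((b+1 : ℕ):ℝ) - 2) = ((a+b : ℕ):ℝ) := by push_cast; ring
  have e2 : (((a+1:ℕ):ℝ) + ((b+1 : ℕ):ℝ) - 1) = ((a+b+1 : ℕ):ℝ) := by push_cast; ring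
  rw [e1, e2]
  simp only [gc_cast]
  rw [Nat.choose_succ_succ, Nat.choose_succ_succ, Nat.choose_symm_add]
  push_cast
  ring

lemma gc_main (a b : ℕ) (hab : a < b) (x y : ℝ) (hx : (b:ℝ) ≤ x) (hxy : x ≤ y)
    (hxp : x ≤ (a:ℝ) + b - 2) (hyq : y ≤ (a:ℝ) + b - 1) :
    genChoose y b - genChoose y a ≤ genChoose x b - genChoose x a := by
  have ha : (2:ℝ) ≤ a := by linarith
  have ha' : 2 ≤ a := by exact_mod_cast ha
  have mx : x ∈ Set.Ioo ((b:ℝ) - 1) ((a:ℝ)+b) := ⟨by linarith, by linarith⟩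
  have my : y ∈ Set.Ioo ((b:ℝ) - 1) ((a:ℝ)+b) := ⟨by linarith, by linarith⟩
  have mp : (a:ℝ) + b - 2 ∈ Set.Ioo ((b:ℝ) - 1) ((a:ℝ)+b) := ⟨by linarith, by linarith⟩
  have mq : (a:ℝ) + b - 1 ∈ Set.Ioo ((b:ℝ) - 1) ((a:ℝ)+b) := ⟨by linarith, by linarith⟩
  obtain ⟨px, lx⟩ := gc_phi a b hab x mx
  obtain ⟨py, ly⟩ := gc_phi a b hab y my
  obtain ⟨pp, lp⟩ := gc_phi a b hab _ mp
  obtain ⟨pq, lq⟩ := gc_phi a b hab _ mq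
  have e := gc_pq a b (by omega) (by omega)
  rw [e, lq] at lp
  have := concave_aux _ _ (phi_concave a b hab) _ _ x y mp mq mx my (by linarith) (by linarith)
    hxy hxp hyq
  have h2 : Real.log (genChoose x a - genChoose x b) ≤ Real.log (genChoose y a - genChoose y b) := by
    linarith
  have := (Real.log_le_log_iff px py).1 h2
  linarith

lemma katona_base (S : Finset ℕ) (k l : ℕ) (D : Finset (Finset ℕ)) (hD : D ⊆ S.powersetCard k)
    (hkl : k ≤ l) (hl : l + k ≤ S.card) :
    D.card ≤ ((S.powersetCard l).filter (fun L => ∃ F ∈ D, Disjoint L F)).card := by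
  set X := ((S.powersetCard l).filter (fun L => ∃ F ∈ D, Disjoint L F)) with hX
  have hm : ∀ F ∈ D, (S.card - k).choose l ≤ (X.bipartiteAbove (fun F L => Disjoint L F) F).card := by
    intro F hF
    have hF' := Finset.mem_powersetCard.1 (hD hF)
    have : (S \ F).powersetCard l ⊆ X.bipartiteAbove (fun F L => Disjoint L F) F := by
      intro L hL
      have hL := Finset.mem_powersetCard.1 hL
      have hdis : Disjoint L F := Finset.disjoint_of_subset_left hL.1 Finset.sdiff_disjoint
      exact Finset.mem_filter.2 ⟨Finset.mem_filter.2 ⟨Finset.mem_powersetCard.2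
        ⟨hL.1.trans Finset.sdiff_subset, hL.2⟩, F, hF, hdis⟩, hdis⟩
    have := Finset.card_le_card this
    rwa [Finset.card_powersetCard, Finset.card_sdiff_of_subset hF'.1, hF'.2] at this
  have hn : ∀ L ∈ X, (D.bipartiteBelow (fun F L => Disjoint L F) L).card ≤ (S.card - l).choose k := by
    intro L hL
    have hL' := Finset.mem_powersetCard.1 (Finset.mem_filter.1 hL).1
    have : D.bipartiteBelow (fun F L => Disjoint L F) L ⊆ (S \ L).powersetCard k := by
      intro F hF
      have hF := Finset.mem_filter.1 hF
      have hF' := Finset.mem_powersetCard.1 (hD hF.1)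
      exact Finset.mem_powersetCard.2 ⟨Finset.subset_sdiff.2 ⟨hF'.1, hF.2.symm⟩, hF'.2⟩
    have := Finset.card_le_card this
    rwa [Finset.card_powersetCard, Finset.card_sdiff_of_subset hL'.1, hL'.2] at this
  have h := Finset.card_mul_le_card_mul _ hm hn
  have hle : (S.card - l).choose k ≤ (S.card - k).choose l := by
    obtain ⟨c, hc⟩ := Nat.exists_eq_add_of_le hl
    have e1 : S.card - l = k + c := by omega
    have e2 : S.card - k = l + c := by omega
    rw [e1, e2, Nat.choose_symm_add, Nat.choose_symm_add]
    exact Nat.choose_le_choose c (by omega)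
  have hpos : 0 < (S.card - k).choose l := Nat.choose_pos (by omega)
  have : D.card * (S.card - k).choose l ≤ X.card * (S.card - k).choose l :=
    h.trans (Nat.mul_le_mul_left _ hle)
  exact Nat.le_of_mul_le_mul_right this hpos

lemma katona (N : ℕ) : ∀ (p k l s : ℕ) (D : Finset (Finset ℕ)),
    D ⊆ (Finset.Ico p (p+N)).powersetCard k →
    (∀ F ∈ D, ∀ i j, p ≤ i → i < j → j ∈ F → i ∉ F → insert i (F.erase j) ∈ D) →
    (∀ F ∈ D, ∀ F' ∈ D, s ≤ (F ∩ F').card) → k ≤ l + s → l + k ≤ N →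
    D.card ≤ (((Finset.Ico p (p+N)).powersetCard l).filter (fun L => ∃ F ∈ D, Disjoint L F)).card := by
  induction N with
  | zero =>
    intro p k l s D hD _ _ h1 h2
    exact katona_base _ k l D hD (by omega) (by simpa using h2)
  | succ N ih =>
    intro p k l s D hD hsh hint h1 h2
    rcases Nat.eq_zero_or_pos s with rfl | hs
    · exact katona_base _ k l D hD (by omega) (by simpa using h2)
    rcases D.eq_empty_or_nonempty with rfl | ⟨F0, hF0⟩
    · simp
    have hks : s ≤ k := by
      have := hint F0 hF0 F0 hF0
      rwa [Finset.inter_self, (Finset.mem_powersetCard.1 (hD hF0)).2] at this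
    have hIco : Finset.Ico p (p + (N+1)) = insert p (Finset.Ico (p+1) (p+1+N)) := by
      ext z; simp only [Finset.mem_Ico, Finset.mem_insert]; omega
    set D0 := D.filter (fun F => p ∉ F) with hD0
    set D1 := (D.filter (fun F => p ∈ F)).image (fun F => F.erase p) with hD1
    have hD1c : D1.card = (D.filter (fun F => p ∈ F)).card := by
      apply Finset.card_image_of_injOn
      intro T hT T' hT' h
      have hT := Finset.mem_filter.1 hT
      have hT' := Finset.mem_filter.1 hT'
      have h : T.erase p = T'.erase p := h
      rw [← Finset.insert_erase hT.2, ← Finset.insert_erase hT'.2, h]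
    have hsum := Finset.card_filter_add_card_filter_not (s := D) (fun F => p ∈ F)
    change _ + D0.card = _ at hsum
    have hD0int : ∀ F ∈ D0, ∀ F' ∈ D0, s + 1 ≤ (F ∩ F').card := by
      intro F hF F' hF'
      have hF := Finset.mem_filter.1 hF
      have hF' := Finset.mem_filter.1 hF'
      have hi := hint F hF.1 F' hF'.1
      obtain ⟨x, hx⟩ := Finset.card_pos.1 (lt_of_lt_of_le hs hi)
      have hx' := Finset.mem_inter.1 hx
      have hxp : p ≤ x := (Finset.mem_Ico.1 ((Finset.mem_powersetCard.1 (hD hF.1)).1 hx'.1)).1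
      have hxp' : p < x := lt_of_le_of_ne hxp (fun h => hF.2 (h ▸ hx'.1))
      have h3 := hint _ (hsh F hF.1 p x le_rfl hxp' hx'.1 hF.2) F' hF'.1
      have : insert p (F.erase x) ∩ F' ⊆ (F ∩ F').erase x := by
        intro z hz
        have hz := Finset.mem_inter.1 hz
        rcases Finset.mem_insert.1 hz.1 with h | h
        · exact absurd (h ▸ hz.2) hF'.2
        · have h := Finset.mem_erase.1 h
          exact Finset.mem_erase.2 ⟨h.1, Finset.mem_inter.2 ⟨h.2, hz.2⟩⟩
      have h4 := Finset.card_le_card this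
      rw [Finset.card_erase_of_mem hx] at h4
      have : 0 < (F ∩ F').card := by omega
      omega
    have b1 := ih (p+1) (k-1) l (s-1) D1 (by
        intro A hA
        obtain ⟨T, hT, rfl⟩ := Finset.mem_image.1 hA
        have hT := Finset.mem_filter.1 hT
        have hT' := Finset.mem_powersetCard.1 (hD hT.1)
        rw [hIco] at hT'
        refine Finset.mem_powersetCard.2 ⟨?_, by rw [Finset.card_erase_of_mem hT.2, hT'.2]⟩
        exact Finset.subset_insert_iff.1 hT'.1)
      (by
        intro A hA i j hi hij hj hi'
        obtain ⟨T, hT, rfl⟩ := Finset.mem_image.1 hA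
        have hT := Finset.mem_filter.1 hT
        have hj := Finset.mem_erase.1 hj
        have hiT : i ∉ T := fun h => hi' (Finset.mem_erase.2 ⟨by omega, h⟩)
        refine Finset.mem_image.2 ⟨insert i (T.erase j), Finset.mem_filter.2
          ⟨hsh T hT.1 i j (by omega) hij hj.2 hiT, ?_⟩, ?_⟩
        · exact Finset.mem_insert_of_mem (Finset.mem_erase.2 ⟨by omega, hT.2⟩)
        · ext z; simp only [Finset.mem_erase, Finset.mem_insert]
          constructor
          · rintro ⟨h1, h | h⟩ <;> tauto
          · rintro (h | h)
            · exact ⟨by omega, Or.inl h⟩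
            · tauto)
      (by
        intro A hA A' hA'
        obtain ⟨T, hT, rfl⟩ := Finset.mem_image.1 hA
        have hT := Finset.mem_filter.1 hT
        obtain ⟨T', hT', rfl⟩ := Finset.mem_image.1 hA'
        have hT' := Finset.mem_filter.1 hT'
        have h := hint T hT.1 T' hT'.1
        have : T.erase p ∩ T'.erase p = (T ∩ T').erase p := by
          ext z; simp only [Finset.mem_erase, Finset.mem_inter]; tauto
        rw [this, Finset.card_erase_of_mem (Finset.mem_inter.2 ⟨hT.2, hT'.2⟩)]
        omega)
      (by omega) (by omega)
    set X1 := (((Finset.Ico (p+1) (p+1+N)).powersetCard l).filter (fun L => ∃ F ∈ D1, Disjoint L F))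
    set X := (((Finset.Ico p (p+(N+1))).powersetCard l).filter (fun L => ∃ F ∈ D, Disjoint L F))
    have hX1 : X1 ⊆ X.filter (fun L => p ∉ L) := by
      intro L hL
      obtain ⟨hL1, A, hA, hdis⟩ := Finset.mem_filter.1 hL
      have hL1 := Finset.mem_powersetCard.1 hL1
      obtain ⟨T, hT, rfl⟩ := Finset.mem_image.1 hA
      have hT := Finset.mem_filter.1 hT
      have hpL : p ∉ L := fun h => by have := Finset.mem_Ico.1 (hL1.1 h); omega
      refine Finset.mem_filter.2 ⟨Finset.mem_filter.2 ⟨Finset.mem_powersetCard.2 ⟨?_, hL1.2⟩,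
        T, hT.1, ?_⟩, hpL⟩
      · rw [hIco]; exact hL1.1.trans (Finset.subset_insert _ _)
      · rw [Finset.disjoint_left] at hdis ⊢
        intro z hz hzT
        exact hdis hz (Finset.mem_erase.2 ⟨fun h => hpL (h ▸ hz), hzT⟩)
    have c1 := Finset.card_le_card hX1
    have hXsum := Finset.card_filter_add_card_filter_not (s := X) (fun L => p ∈ L)
    suffices h0 : D0.card ≤ (X.filter (fun L => p ∈ L)).card by
      omega
    rcases Nat.eq_zero_or_pos l with hl | hl
    · have : D0 = ∅ := by
        by_contra hne
        obtain ⟨T, hT⟩ := Finset.nonempty_iff_ne_empty.2 hne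
        have h := hD0int T hT T hT
        have hT := Finset.mem_filter.1 hT
        rw [Finset.inter_self, (Finset.mem_powersetCard.1 (hD hT.1)).2] at h
        omega
      rw [this]; simp
    have b0 := ih (p+1) k (l-1) (s+1) D0 (by
        intro T hT
        have hT := Finset.mem_filter.1 hT
        have hT' := Finset.mem_powersetCard.1 (hD hT.1)
        rw [hIco] at hT'
        refine Finset.mem_powersetCard.2 ⟨?_, hT'.2⟩
        exact (Finset.subset_insert_iff_of_notMem hT.2).1 hT'.1)
      (by
        intro T hT i j hi hij hj hi'
        have hT := Finset.mem_filter.1 hT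
        refine Finset.mem_filter.2 ⟨hsh T hT.1 i j (by omega) hij hj hi', ?_⟩
        intro h
        rcases Finset.mem_insert.1 h with h | h
        · omega
        · exact hT.2 (Finset.mem_of_mem_erase h))
      hD0int (by omega) (by omega)
    refine b0.trans ?_
    apply Finset.card_le_card_of_injOn (fun L => insert p L)
    · intro L hL
      obtain ⟨hL1, T, hT, hdis⟩ := Finset.mem_filter.1 hL
      have hL1 := Finset.mem_powersetCard.1 hL1
      have hT := Finset.mem_filter.1 hT
      have hpL : p ∉ L := fun h => by have := Finset.mem_Ico.1 (hL1.1 h); omega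
      refine Finset.mem_coe.2 (Finset.mem_filter.2 ⟨Finset.mem_filter.2 ⟨Finset.mem_powersetCard.2 ⟨?_, ?_⟩,
        T, hT.1, ?_⟩, Finset.mem_insert_self _ _⟩)
      · rw [hIco]; exact Finset.insert_subset_insert _ hL1.1
      · rw [Finset.card_insert_of_notMem hpL, hL1.2]; omega
      · exact Finset.disjoint_insert_left.2 ⟨hT.2, hdis⟩
    · intro L hL L' hL' h
      have hL1 := Finset.mem_powersetCard.1 (Finset.mem_filter.1 hL).1
      have hL1' := Finset.mem_powersetCard.1 (Finset.mem_filter.1 hL').1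
      have hpL : p ∉ L := fun h => by have := Finset.mem_Ico.1 (hL1.1 h); omega
      have hpL' : p ∉ L' := fun h => by have := Finset.mem_Ico.1 (hL1'.1 h); omega
      have h : insert p L = insert p L' := h
      rw [← Finset.erase_insert hpL, ← Finset.erase_insert hpL', h]

/-- c0, c1, c2 Pascal expansion. -/
lemma pascal2 (N m : ℕ) : (N+2).choose (m+2) = N.choose m + 2 * N.choose (m+1) + N.choose (m+2) := by
  have h1 := Nat.choose_succ_succ (N+1) (m+1)
  have h2 := Nat.choose_succ_succ N m
  have h3 := Nat.choose_succ_succ N (m+1)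
  simp only [Nat.succ_eq_add_one, add_assoc, Nat.reduceAdd] at *
  omega

lemma sumAB0 (S : Finset ℕ) (m e : ℕ) (hS : S.card = 2*m+e+5) (A B D : Finset (Finset ℕ))
    (hA : A ⊆ S.powersetCard (m+2)) (hB : B ⊆ S.powersetCard (m+2))
    (hD : D ⊆ S.powersetCard (m+3))
    (hAB : ∀ X ∈ A, ∀ Y ∈ B, (X ∩ Y).Nonempty)
    (hDA : ∀ X ∈ D, ∀ Y ∈ A, (X ∩ Y).Nonempty)
    (hle : B.card ≤ A.card)
    (h2 : (2*m+e+4).choose (m+1) ≤ B.card + D.card) :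
    A.card + B.card ≤ 2 * (2*m+e+4).choose (m+1) := by
  have p2 := pascal2 (2*m+e+3) m
  have p1 := Nat.choose_succ_succ (2*m+e+3) m
  have p1' := Nat.choose_succ_succ (2*m+e+4) (m+1)
  simp only [Nat.succ_eq_add_one, add_assoc, Nat.reduceAdd] at p1 p2 p1'
  have hBA : ∀ X ∈ B, ∀ Y ∈ A, (X ∩ Y).Nonempty := fun X hX Y hY => by
    rw [Finset.inter_comm]; exact hAB Y hY X hX
  simp only [add_assoc] at *
  by_cases hB0 : B.card < (2*m+(e+3)).choose m
  · have hDc : (2*m+(e+3)).choose (m+1) ≤ D.card := by omega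
    have := cross S (m+3) (m+2) (m+e+2) D A (by omega) (by omega) hD hA hDA ((2*m+(e+3) : ℕ):ℝ)
      (by exact_mod_cast (by omega : m+e+2 ≤ 2*m+(e+3)))
      (by
        rw [gc_cast, Nat.choose_symm_of_eq_add (show 2*m+(e+3) = (m+e+2) + (m+1) by omega)]
        exact_mod_cast hDc)
    rw [gc_cast, hS] at this
    have : A.card + (2*m+(e+3)).choose (m+2) ≤ (2*m+(e+5)).choose (m+2) := by exact_mod_cast this
    omega
  · push Not at hB0
    by_cases hB1 : B.card ≤ (2*m+(e+4)).choose (m+1)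
    · have s0 : (2*m+(e+3)).choose (m+e+3) = (2*m+(e+3)).choose m :=
        Nat.choose_symm_of_eq_add (by omega)
      have s1 : (2*m+(e+4)).choose (m+e+3) = (2*m+(e+4)).choose (m+1) :=
        Nat.choose_symm_of_eq_add (by omega)
      obtain ⟨x, hx1, hx2, hx⟩ := gc_exists (m+e+3) ((2*m+(e+3) : ℕ):ℝ) ((2*m+(e+4) : ℕ):ℝ) B.card
        (by exact_mod_cast (by omega)) (by rw [gc_cast, s0]; exact_mod_cast hB0)
        (by rw [gc_cast, s1]; exact_mod_cast hB1)
      have hb : ((m+e+3:ℕ):ℝ) ≤ ((2*m+(e+3) : ℕ):ℝ) := by exact_mod_cast (by omega)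
      have c := cross S (m+2) (m+2) (m+e+3) B A (by omega) (by omega) hB hA hBA x (hb.trans hx1) hx.le
      have g := gc_main (m+2) (m+e+3) (by omega) ((2*m+(e+3) : ℕ):ℝ) x hb hx1
        (by push_cast; linarith) (by push_cast at hx2 ⊢; linarith)
      rw [hx, gc_cast, gc_cast, s0] at g
      rw [hS, p2] at c
      push_cast at c
      have : (A.card:ℝ) + B.card ≤ 2 * ((2*m+(e+4)).choose (m+1) : ℕ) := by
        rw [p1]; push_cast; linarith
      exact_mod_cast this
    · push Not at hB1
      have := cross S (m+2) (m+2) (m+e+3) B A (by omega) (by omega) hB hA hBA ((2*m+(e+4) : ℕ):ℝ)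
        (by exact_mod_cast (by omega : m+e+3 ≤ 2*m+(e+4)))
        (by
          rw [gc_cast, Nat.choose_symm_of_eq_add (show 2*m+(e+4) = (m+e+3) + (m+1) by omega)]
          exact_mod_cast hB1.le)
      rw [gc_cast, hS] at this
      have : A.card + (2*m+(e+4)).choose (m+2) ≤ (2*m+(e+5)).choose (m+2) := by exact_mod_cast this
      omega

lemma sumCD (S : Finset ℕ) (m e : ℕ) (hS : S.card = 2*m+e+5) (C D : Finset (Finset ℕ))
    (hC : C ⊆ S.powersetCard (m+1)) (hD : D ⊆ S.powersetCard (m+3))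
    (hDC : ∀ X ∈ D, ∀ Y ∈ C, (X ∩ Y).Nonempty)
    (hle : D.card ≤ (2*m+e+3).choose (m+1)) :
    C.card + D.card ≤ (2*m+e+5).choose (m+1) := by
  rcases Nat.eq_zero_or_pos D.card with h0 | hpos
  · rw [h0]
    have := Finset.card_le_card hC
    rw [Finset.card_powersetCard, hS] at this
    exact this
  · have s1 : (2*m+e+3).choose (m+e+2) = (2*m+e+3).choose (m+1) :=
      Nat.choose_symm_of_eq_add (by omega)
    obtain ⟨x, hx1, hx2, hx⟩ := gc_exists (m+e+2) ((m+e+2 : ℕ):ℝ) ((2*m+e+3 : ℕ):ℝ) D.card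
        (by exact_mod_cast (by omega)) (by rw [gc_cast, Nat.choose_self]; exact_mod_cast hpos)
        (by rw [gc_cast, s1]; exact_mod_cast hle)
    have c := cross S (m+3) (m+1) (m+e+2) D C (by omega) (by omega) hD hC hDC x hx1 hx.le
    have g := gc_le_sym (m+1) (m+e+2) (by omega) x (by linarith) (by push_cast at hx2 ⊢; linarith)
    rw [hS] at c
    have : (C.card:ℝ) + D.card ≤ ((2*m+e+5).choose (m+1) : ℕ) := by linarith
    exact_mod_cast this

/-- Link of `T` inside `S`. -/
def lk (F : Finset (Finset ℕ)) (S : Finset ℕ) (T : Finset ℕ) (q : ℕ) : Finset (Finset ℕ) :=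
  (S.powersetCard q).filter (fun L => T ∪ L ∈ F)

lemma lk_sub (F : Finset (Finset ℕ)) (S : Finset ℕ) (T : Finset ℕ) (q : ℕ) :
    lk F S T q ⊆ S.powersetCard q := Finset.filter_subset _ _

lemma lk_card (F : Finset (Finset ℕ)) (V R T : Finset ℕ) (k q : ℕ)
    (hF : F ⊆ V.powersetCard k) (hT : T ⊆ R) (hq : q + T.card = k) :
    (lk F (V \ R) T q).card = (F.filter (fun A => A ∩ R = T)).card := by
  have hdis : ∀ L ∈ lk F (V \ R) T q, Disjoint L R := by
    intro L hL
    have := (Finset.mem_powersetCard.1 (Finset.mem_filter.1 hL).1).1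
    exact (Finset.subset_sdiff.1 this).2
  have : F.filter (fun A => A ∩ R = T) = (lk F (V \ R) T q).image (fun L => T ∪ L) := by
    ext A
    constructor
    · intro hA
      have hA := Finset.mem_filter.1 hA
      have hA' := Finset.mem_powersetCard.1 (hF hA.1)
      have e : T ∪ A \ R = A := by
        rw [← hA.2]; ext z; simp only [Finset.mem_union, Finset.mem_inter, Finset.mem_sdiff]; tauto
      refine Finset.mem_image.2 ⟨A \ R, Finset.mem_filter.2 ⟨Finset.mem_powersetCard.2
        ⟨Finset.sdiff_subset_sdiff hA'.1 (Finset.Subset.refl _), ?_⟩, ?_⟩, e⟩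
      · have := Finset.card_sdiff_add_card_inter A R
        rw [hA.2] at this
        omega
      · rw [e]; exact hA.1
    · intro hA
      obtain ⟨L, hL, rfl⟩ := Finset.mem_image.1 hA
      have hd := hdis L hL
      refine Finset.mem_filter.2 ⟨(Finset.mem_filter.1 hL).2, ?_⟩
      rw [Finset.union_inter_distrib_right, Finset.disjoint_iff_inter_eq_empty.1 hd,
        Finset.union_empty, Finset.inter_eq_left.2 hT]
  rw [this, Finset.card_image_of_injOn]
  intro L hL L' hL' h
  have h : T ∪ L = T ∪ L' := h
  have d1 := (Finset.disjoint_of_subset_right hT (hdis L hL))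
  have d2 := (Finset.disjoint_of_subset_right hT (hdis L' hL'))
  rw [← Finset.union_sdiff_cancel_left d1.symm, ← Finset.union_sdiff_cancel_left d2.symm, h]

lemma lk_cross (F : Finset (Finset ℕ)) (hint : Intersecting F) (V R T T' : Finset ℕ) (q q' : ℕ)
    (hT : T ⊆ R) (hT' : T' ⊆ R) (hd : T ∩ T' = ∅) :
    ∀ X ∈ lk F (V \ R) T q, ∀ Y ∈ lk F (V \ R) T' q', (X ∩ Y).Nonempty := by
  intro X hX Y hY
  obtain ⟨hX1, hX2⟩ := Finset.mem_filter.1 hX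
  obtain ⟨hY1, hY2⟩ := Finset.mem_filter.1 hY
  have hX1 := (Finset.mem_powersetCard.1 hX1).1
  have hY1 := (Finset.mem_powersetCard.1 hY1).1
  obtain ⟨z, hz⟩ := hint _ hX2 _ hY2
  have hz := Finset.mem_inter.1 hz
  refine ⟨z, Finset.mem_inter.2 ?_⟩
  have hzd : ¬ (z ∈ T ∧ z ∈ T') := fun h => by
    have := Finset.mem_inter.2 h
    rw [hd] at this; simp at this
  have h1 : z ∈ X → z ∉ R := fun h => (Finset.mem_sdiff.1 (hX1 h)).2
  have h2 : z ∈ Y → z ∉ R := fun h => (Finset.mem_sdiff.1 (hY1 h)).2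
  have h3 : z ∈ T → z ∈ R := fun h => hT h
  have h4 : z ∈ T' → z ∈ R := fun h => hT' h
  simp only [Finset.mem_union] at hz
  tauto

lemma low (n m e : ℕ) (hn : n = 2*m+e+7) (F : Finset (Finset ℕ))
    (hF : F ⊆ (Finset.Icc 1 n).powersetCard (m+3)) (hint : Intersecting F)
    (i : ℕ) (hi : i ∈ Finset.Icc 1 n) (x0 : ℝ) (hx0 : ((m+e+3:ℕ):ℝ) ≤ x0)
    (hx0' : x0 ≤ ((2*m+e+3:ℕ):ℝ))
    (h1 : genChoose x0 (m+e+3) ≤ ((F.filter (fun A => i ∉ A)).card : ℝ))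
    (h2 : (F.filter (fun A => i ∉ A)).card ≤ (2*m+e+4).choose (m+1)) :
    (F.card : ℝ) ≤ ((2*m+e+6).choose (m+2) : ℕ) + genChoose x0 (m+e+3) - genChoose x0 (m+2) := by
  have hsum := Finset.card_filter_add_card_filter_not (s := F) (fun A => i ∈ A)
  have e1 : (lk F (Finset.Icc 1 n \ {i}) {i} (m+2)).card = (F.filter (fun A => i ∈ A)).card := by
    rw [lk_card F _ {i} {i} (m+3) (m+2) hF (Finset.Subset.refl _) (by simp)]
    congr 1
    apply Finset.filter_congr
    intro A _
    simp
  have e2 : (lk F (Finset.Icc 1 n \ {i}) ∅ (m+3)).card = (F.filter (fun A => i ∉ A)).card := by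
    rw [lk_card F _ {i} ∅ (m+3) (m+3) hF (Finset.empty_subset _) (by simp)]
    congr 1
    apply Finset.filter_congr
    intro A _
    rw [← Finset.disjoint_iff_inter_eq_empty, Finset.disjoint_singleton_right]
  have hS : (Finset.Icc 1 n \ {i}).card = 2*m+e+6 := by
    rw [Finset.card_sdiff_of_subset (by simpa using hi)]
    simp; omega
  have s1 : (2*m+e+4).choose (m+e+3) = (2*m+e+4).choose (m+1) :=
        Nat.choose_symm_of_eq_add (by omega)
  have hlt : ((2*m+e+3:ℕ):ℝ) ≤ ((2*m+e+4:ℕ):ℝ) := by exact_mod_cast (by omega)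
  obtain ⟨x, hx1, hx2, hx⟩ := gc_exists (m+e+3) x0 ((2*m+e+4 : ℕ):ℝ)
    (F.filter (fun A => i ∉ A)).card (hx0'.trans hlt) h1 (by rw [gc_cast, s1]; exact_mod_cast h2)
  have c := cross (Finset.Icc 1 n \ {i}) (m+3) (m+2) (m+e+3) _ _ (by omega) (by omega)
    (lk_sub F _ ∅ (m+3)) (lk_sub F _ {i} (m+2))
    (lk_cross F hint _ _ _ _ _ _ (Finset.empty_subset _) (Finset.Subset.refl _) (by simp)) x (hx0.trans hx1)
    (by rw [e2]; exact hx.le)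
  rw [e1, hS] at c
  have g := gc_main (m+2) (m+e+3) (by omega) x0 x hx0 hx1
    (by push_cast at hx0' ⊢; linarith) (by push_cast at hx2 ⊢; linarith)
  rw [hx] at g
  have hsum' : ((F.filter (fun A => i ∈ A)).card : ℝ) + (F.filter (fun A => i ∉ A)).card = F.card := by
    exact_mod_cast hsum
  linarith

lemma split (n m e : ℕ) (hn : n = 2*m+e+7) (F : Finset (Finset ℕ))
    (hF : F ⊆ (Finset.Icc 1 n).powersetCard (m+3)) (hint : Intersecting F)
    (i j : ℕ) (hi : i ∈ Finset.Icc 1 n) (hj : j ∈ Finset.Icc 1 n) (hij : i ≠ j)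
    (h1 : (2*m+e+4).choose (m+1) ≤ (F.filter (fun A => i ∉ A)).card)
    (h2 : (2*m+e+4).choose (m+1) ≤ (F.filter (fun A => j ∉ A)).card)
    (hCD : (2*m+e+3).choose (m+1) < (F.filter (fun A => i ∉ A ∧ j ∉ A)).card →
      (lk F (Finset.Icc 1 n \ {i,j}) {i,j} (m+1)).card + (lk F (Finset.Icc 1 n \ {i,j}) ∅ (m+3)).card
        ≤ (2*m+e+5).choose (m+1)) :
    F.card ≤ 2 * (2*m+e+4).choose (m+1) + (2*m+e+5).choose (m+1) := by
  have hS : (Finset.Icc 1 n \ {i,j}).card = 2*m+e+5 := by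
    rw [Finset.card_sdiff_of_subset (by
      intro z hz
      simp only [Finset.mem_insert, Finset.mem_singleton] at hz
      rcases hz with rfl | rfl <;> assumption), Finset.card_pair hij]
    simp; omega
  have si : ({i} : Finset ℕ) ⊆ {i,j} := by simp
  have sj : ({j} : Finset ℕ) ⊆ {i,j} := by simp
  have cA := lk_card F (Finset.Icc 1 n) {i,j} {i} (m+3) (m+2) hF si (by simp)
  have cB := lk_card F (Finset.Icc 1 n) {i,j} {j} (m+3) (m+2) hF sj (by simp)
  have cC := lk_card F (Finset.Icc 1 n) {i,j} {i,j} (m+3) (m+1) hF (Finset.Subset.refl _)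
    (by rw [Finset.card_pair hij])
  have cD := lk_card F (Finset.Icc 1 n) {i,j} ∅ (m+3) (m+3) hF (Finset.empty_subset _) (by simp)
  have xAB := lk_cross F hint (Finset.Icc 1 n) {i,j} {i} {j} (m+2) (m+2) si sj (by simp [hij])
  have xBA := lk_cross F hint (Finset.Icc 1 n) {i,j} {j} {i} (m+2) (m+2) sj si (by simp [hij.symm])
  have xDA := lk_cross F hint (Finset.Icc 1 n) {i,j} ∅ {i} (m+3) (m+2) (Finset.empty_subset _) si (by simp)
  have xDB := lk_cross F hint (Finset.Icc 1 n) {i,j} ∅ {j} (m+3) (m+2) (Finset.empty_subset _) sj (by simp)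
  have xDC := lk_cross F hint (Finset.Icc 1 n) {i,j} ∅ {i,j} (m+3) (m+1) (Finset.empty_subset _)
    (Finset.Subset.refl _) (by simp)
  have pA : ∀ A : Finset ℕ, A ∩ {i,j} = {i} ↔ (i ∈ A ∧ j ∉ A) := by
    intro A; constructor
    · intro h
      have a1 := Finset.ext_iff.1 h i
      have a2 := Finset.ext_iff.1 h j
      simp [hij.symm] at a1 a2
      tauto
    · rintro ⟨h1, h2⟩
      ext z; simp only [Finset.mem_inter, Finset.mem_insert, Finset.mem_singleton]
      constructor
      · rintro ⟨h, rfl | rfl⟩ <;> tauto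
      · rintro rfl; tauto
  have pB : ∀ A : Finset ℕ, A ∩ {i,j} = {j} ↔ (i ∉ A ∧ j ∈ A) := by
    intro A; constructor
    · intro h
      have a1 := Finset.ext_iff.1 h i
      have a2 := Finset.ext_iff.1 h j
      simp [hij] at a1 a2
      tauto
    · rintro ⟨h1, h2⟩
      ext z; simp only [Finset.mem_inter, Finset.mem_insert, Finset.mem_singleton]
      constructor
      · rintro ⟨h, rfl | rfl⟩ <;> tauto
      · rintro rfl; tauto
  have pC : ∀ A : Finset ℕ, A ∩ {i,j} = {i,j} ↔ (i ∈ A ∧ j ∈ A) := by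
    intro A
    rw [Finset.inter_eq_right, Finset.insert_subset_iff, Finset.singleton_subset_iff]
  have pD : ∀ A : Finset ℕ, A ∩ {i,j} = ∅ ↔ (i ∉ A ∧ j ∉ A) := by
    intro A
    rw [← Finset.disjoint_iff_inter_eq_empty, Finset.disjoint_insert_right,
      Finset.disjoint_singleton_right]
  simp only [pA] at cA
  simp only [pB] at cB
  simp only [pC] at cC
  simp only [pD] at cD
  have t0 := Finset.card_filter_add_card_filter_not (s := F) (fun A => i ∈ A)
  have t1 := Finset.card_filter_add_card_filter_not (s := F.filter (fun A => i ∈ A)) (fun A => j ∈ A)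
  have t2 := Finset.card_filter_add_card_filter_not (s := F.filter (fun A => i ∉ A)) (fun A => j ∈ A)
  have t3 := Finset.card_filter_add_card_filter_not (s := F.filter (fun A => j ∉ A)) (fun A => i ∈ A)
  simp only [Finset.filter_filter] at t1 t2 t3
  have sw1 : F.filter (fun A => j ∉ A ∧ i ∈ A) = F.filter (fun A => i ∈ A ∧ j ∉ A) :=
    Finset.filter_congr (fun A _ => and_comm)
  have sw2 : F.filter (fun A => j ∉ A ∧ i ∉ A) = F.filter (fun A => i ∉ A ∧ j ∉ A) :=
    Finset.filter_congr (fun A _ => and_comm)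
  rw [sw1, sw2] at t3
  rw [← cA, ← cD] at t3
  rw [← cB, ← cD] at t2
  rw [← cA, ← cC] at t1
  have hAB : (lk F (Finset.Icc 1 n \ {i,j}) {i} (m+2)).card +
      (lk F (Finset.Icc 1 n \ {i,j}) {j} (m+2)).card ≤ 2 * (2*m+e+4).choose (m+1) := by
    rcases le_total (lk F (Finset.Icc 1 n \ {i,j}) {j} (m+2)).card
      (lk F (Finset.Icc 1 n \ {i,j}) {i} (m+2)).card with h | h
    · exact sumAB0 _ m e hS _ _ _ (lk_sub _ _ _ _) (lk_sub _ _ _ _) (lk_sub _ _ _ _) xAB xDA h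
        (by omega)
    · rw [add_comm]
      exact sumAB0 _ m e hS _ _ _ (lk_sub _ _ _ _) (lk_sub _ _ _ _) (lk_sub _ _ _ _) xBA xDB h
        (by omega)
  have hCD' : (lk F (Finset.Icc 1 n \ {i,j}) {i,j} (m+1)).card +
      (lk F (Finset.Icc 1 n \ {i,j}) ∅ (m+3)).card ≤ (2*m+e+5).choose (m+1) := by
    rcases le_or_gt (F.filter (fun A => i ∉ A ∧ j ∉ A)).card ((2*m+e+3).choose (m+1)) with h | h
    · exact sumCD _ m e hS _ _ (lk_sub _ _ _ _) (lk_sub _ _ _ _) xDC (by rw [cD]; exact h)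
    · exact hCD h
  omega

lemma shiftedCD (n m e : ℕ) (hn : n = 2*m+e+7) (F : Finset (Finset ℕ))
    (hF : F ⊆ (Finset.Icc 1 n).powersetCard (m+3)) (hint : Intersecting F)
    (hsh : ∀ A ∈ F, ∀ i j, 1 ≤ i → i < j → j ∈ A → i ∉ A → insert i (A.erase j) ∈ F) :
    (lk F (Finset.Icc 1 n \ {1,2}) {1,2} (m+1)).card + (lk F (Finset.Icc 1 n \ {1,2}) ∅ (m+3)).card
        ≤ (2*m+e+5).choose (m+1) := by
  have hS : Finset.Icc 1 n \ {1,2} = Finset.Ico 3 (3 + (2*m+e+5)) := by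
    ext z
    simp only [Finset.mem_sdiff, Finset.mem_Icc, Finset.mem_insert, Finset.mem_singleton,
      Finset.mem_Ico]
    omega
  have xDC := lk_cross F hint (Finset.Icc 1 n) {1,2} ∅ {1,2} (m+3) (m+1) (Finset.empty_subset _)
    (Finset.Subset.refl _) (by simp)
  rw [hS] at xDC ⊢
  set D := lk F (Finset.Ico 3 (3 + (2*m+e+5))) ∅ (m+3) with hD
  set C := lk F (Finset.Ico 3 (3 + (2*m+e+5))) {1,2} (m+1) with hC
  have hDm : ∀ A, A ∈ D ↔ (A ∈ F ∧ A ⊆ Finset.Ico 3 (3 + (2*m+e+5)) ∧ A.card = m+3) := by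
    intro A
    simp only [hD, lk, Finset.mem_filter, Finset.mem_powersetCard, Finset.empty_union]
    tauto
  have k := katona (2*m+e+5) 3 (m+3) (m+1) 3 D (lk_sub _ _ _ _)
    (by
      intro A hA i j hi hij hj hiA
      obtain ⟨h1, h2, h3⟩ := (hDm A).1 hA
      refine (hDm _).2 ⟨hsh A h1 i j (by omega) hij hj hiA, ?_, ?_⟩
      · intro z hz
        rcases Finset.mem_insert.1 hz with h | h
        · have := Finset.mem_Ico.1 (h2 hj)
          exact Finset.mem_Ico.2 (by omega)
        · exact h2 (Finset.mem_of_mem_erase h)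
      · rw [Finset.card_insert_of_notMem (fun h => hiA (Finset.mem_of_mem_erase h)),
          Finset.card_erase_of_mem hj, h3]; rfl)
    (by
      intro A hA B hB
      obtain ⟨a1, a2, a3⟩ := (hDm A).1 hA
      obtain ⟨b1, b2, b3⟩ := (hDm B).1 hB
      have ge3 : ∀ z ∈ A, 3 ≤ z := fun z hz => (Finset.mem_Ico.1 (a2 hz)).1
      have ge3' : ∀ z ∈ B, 3 ≤ z := fun z hz => (Finset.mem_Ico.1 (b2 hz)).1
      obtain ⟨x, hx⟩ := hint A a1 B b1
      have hx := Finset.mem_inter.1 hx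
      have x3 := ge3 x hx.1
      have f1 := hsh A a1 1 x le_rfl (by omega) hx.1 (fun h => by have := ge3 1 h; omega)
      obtain ⟨y, hy⟩ := hint _ f1 B b1
      have hy := Finset.mem_inter.1 hy
      have y3 := ge3' y hy.2
      have hy1 : y ∈ A.erase x := Finset.mem_of_mem_insert_of_ne hy.1 (by omega)
      have hy1' := Finset.mem_erase.1 hy1
      have f2 := hsh _ f1 2 y (by omega) (by omega) hy.1 (fun h => by
        have := Finset.mem_of_mem_insert_of_ne h (by omega)
        have := ge3 2 (Finset.mem_of_mem_erase this); omega)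
      obtain ⟨z, hz⟩ := hint _ f2 B b1
      have hz := Finset.mem_inter.1 hz
      have z3 := ge3' z hz.2
      have hz1 := Finset.mem_erase.1 (Finset.mem_of_mem_insert_of_ne hz.1 (by omega))
      have hz2 := Finset.mem_erase.1 (Finset.mem_of_mem_insert_of_ne hz1.2 (by omega))
      have : ({x, y, z} : Finset ℕ) ⊆ A ∩ B := by
        intro w hw
        simp only [Finset.mem_insert, Finset.mem_singleton] at hw
        rcases hw with rfl | rfl | rfl
        · exact Finset.mem_inter.2 hx
        · exact Finset.mem_inter.2 ⟨hy1'.2, hy.2⟩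
        · exact Finset.mem_inter.2 ⟨hz2.2, hz.2⟩
      have h3 := Finset.card_le_card this
      rwa [Finset.card_eq_three.2 ⟨x, y, z, hy1'.1.symm, hz2.1.symm, hz1.1.symm, rfl⟩] at h3)
    (by omega) (by omega)
  set X := ((Finset.Ico 3 (3 + (2*m+e+5))).powersetCard (m+1)).filter (fun L => ∃ F ∈ D, Disjoint L F)
  have hdis : Disjoint C X := by
    rw [Finset.disjoint_left]
    intro L hL hLX
    obtain ⟨_, A, hA, hd⟩ := Finset.mem_filter.1 hLX
    obtain ⟨z, hz⟩ := xDC A hA L hL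
    have hz := Finset.mem_inter.1 hz
    exact Finset.disjoint_left.1 hd hz.2 hz.1
  have hsub : C ∪ X ⊆ (Finset.Ico 3 (3 + (2*m+e+5))).powersetCard (m+1) :=
    Finset.union_subset (lk_sub _ _ _ _) (Finset.filter_subset _ _)
  have := Finset.card_le_card hsub
  rw [Finset.card_union_of_disjoint hdis, Finset.card_powersetCard] at this
  simp only [Nat.card_Ico, Nat.add_sub_cancel_left] at this
  omega

/-- One-set shift. -/
def shf (F : Finset (Finset ℕ)) (i j : ℕ) (A : Finset ℕ) : Finset ℕ :=
  if j ∈ A ∧ i ∉ A ∧ insert i (A.erase j) ∉ F then insert i (A.erase j) else A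

lemma shf_inj (F : Finset (Finset ℕ)) (i j : ℕ) : Set.InjOn (shf F i j) (F : Set (Finset ℕ)) := by
  intro A hA B hB h
  unfold shf at h
  have hA : A ∈ F := hA
  have hB : B ∈ F := hB
  split_ifs at h with h1 h2 h2
  · have hA' : i ∉ A.erase j := fun h => h1.2.1 (Finset.mem_of_mem_erase h)
    have hB' : i ∉ B.erase j := fun h => h2.2.1 (Finset.mem_of_mem_erase h)
    rw [← Finset.insert_erase h1.1, ← Finset.insert_erase h2.1, ← Finset.erase_insert hA',
      ← Finset.erase_insert hB', h]
  · exact absurd (h ▸ hB) h1.2.2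
  · exact absurd (h ▸ hA) h2.2.2
  · exact h

lemma shf_intersecting (F : Finset (Finset ℕ)) (hint : Intersecting F) (i j : ℕ) (hij : i ≠ j) :
    Intersecting (F.image (shf F i j)) := by
  have key : ∀ A ∈ F, ∀ B ∈ F, (j ∈ A ∧ i ∉ A ∧ insert i (A.erase j) ∉ F) →
      ¬ (j ∈ B ∧ i ∉ B ∧ insert i (B.erase j) ∉ F) → (insert i (A.erase j) ∩ B).Nonempty := by
    intro A hA B hB h1 h2
    by_cases hiB : i ∈ B
    · exact ⟨i, Finset.mem_inter.2 ⟨Finset.mem_insert_self _ _, hiB⟩⟩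
    by_cases hjB : j ∈ B
    · have hB' : insert i (B.erase j) ∈ F := by tauto
      obtain ⟨z, hz⟩ := hint A hA _ hB'
      have hz := Finset.mem_inter.1 hz
      rcases Finset.mem_insert.1 hz.2 with h | h
      · exact absurd (h ▸ hz.1) h1.2.1
      · have h := Finset.mem_erase.1 h
        exact ⟨z, Finset.mem_inter.2 ⟨Finset.mem_insert_of_mem (Finset.mem_erase.2 ⟨h.1, hz.1⟩), h.2⟩⟩
    · obtain ⟨z, hz⟩ := hint A hA B hB
      have hz := Finset.mem_inter.1 hz
      exact ⟨z, Finset.mem_inter.2 ⟨Finset.mem_insert_of_mem (Finset.mem_erase.2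
        ⟨fun h => hjB (h ▸ hz.2), hz.1⟩), hz.2⟩⟩
  intro X hX Y hY
  obtain ⟨A, hA, rfl⟩ := Finset.mem_image.1 hX
  obtain ⟨B, hB, rfl⟩ := Finset.mem_image.1 hY
  unfold shf
  split_ifs with h1 h2 h2
  · exact ⟨i, Finset.mem_inter.2 ⟨Finset.mem_insert_self _ _, Finset.mem_insert_self _ _⟩⟩
  · exact key A hA B hB h1 h2
  · rw [Finset.inter_comm]; exact key B hB A hA h2 h1
  · exact hint A hA B hB

lemma shf_weight (F : Finset (Finset ℕ)) (i j : ℕ) (hij : i < j) (A : Finset ℕ) :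
    ∑ x ∈ shf F i j A, x ≤ ∑ x ∈ A, x ∧
    ((j ∈ A ∧ i ∉ A ∧ insert i (A.erase j) ∉ F) → ∑ x ∈ shf F i j A, x < ∑ x ∈ A, x) := by
  unfold shf
  split_ifs with h
  · have h1 : i ∉ A.erase j := fun h' => h.2.1 (Finset.mem_of_mem_erase h')
    have h2 := Finset.add_sum_erase A (fun x => x) h.1
    rw [Finset.sum_insert h1]
    constructor
    · omega
    · intro _; omega
  · exact ⟨le_rfl, fun h' => absurd h' h⟩

lemma big (n m e : ℕ) (hn : n = 2*m+e+7) (W : ℕ) : ∀ (F : Finset (Finset ℕ)),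
    (∑ A ∈ F, ∑ x ∈ A, x = W) →
    F ⊆ (Finset.Icc 1 n).powersetCard (m+3) → Intersecting F →
    (∀ i ∈ Finset.Icc 1 n, (2*m+e+3).choose m ≤ (F.filter (fun A => i ∉ A)).card) →
    F.card ≤ 2 * (2*m+e+4).choose (m+1) + (2*m+e+5).choose (m+1) := by
  induction W using Nat.strong_induction_on with
  | _ W ih =>
  intro F hW hF hint hdiv
  by_cases hlow : ∃ i ∈ Finset.Icc 1 n, (F.filter (fun A => i ∉ A)).card ≤ (2*m+e+4).choose (m+1)
  · obtain ⟨i, hi, hle⟩ := hlow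
    have s0 : (2*m+e+3).choose (m+e+3) = (2*m+e+3).choose m :=
        Nat.choose_symm_of_eq_add (by omega)
    have := low n m e hn F hF hint i hi ((2*m+e+3:ℕ):ℝ) (by exact_mod_cast (by omega)) le_rfl
      (by rw [gc_cast, s0]; exact_mod_cast hdiv i hi) hle
    rw [gc_cast, gc_cast, s0] at this
    have h2 : F.card + (2*m+e+3).choose (m+2) ≤ (2*m+e+6).choose (m+2) + (2*m+e+3).choose m := by
      have : (F.card:ℝ) + (2*m+e+3).choose (m+2) ≤ (2*m+e+6).choose (m+2) + (2*m+e+3).choose m := by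
        linarith
      exact_mod_cast this
    have q1 := Nat.choose_succ_succ (2*m+e+5) (m+1)
    have q2 := pascal2 (2*m+e+3) m
    have q3 := Nat.choose_succ_succ (2*m+e+3) m
    simp only [Nat.succ_eq_add_one, add_assoc, Nat.reduceAdd] at *
    omega
  push Not at hlow
  by_cases hsh : ∀ A ∈ F, ∀ i j, 1 ≤ i → i < j → j ∈ A → i ∉ A → insert i (A.erase j) ∈ F
  · refine split n m e hn F hF hint 1 2 (by simp; omega) (by simp; omega) (by norm_num)
      (hlow 1 (by simp; omega)).le (hlow 2 (by simp; omega)).le ?_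
    intro _
    exact shiftedCD n m e hn F hF hint hsh
  push Not at hsh
  obtain ⟨A0, hA0, i, j, hi1, hij, hj, hiA, hnot⟩ := hsh
  have hjn := Finset.mem_Icc.1 ((Finset.mem_powersetCard.1 (hF hA0)).1 hj)
  have hi : i ∈ Finset.Icc 1 n := Finset.mem_Icc.2 (by omega)
  have hinj := shf_inj F i j
  by_cases hdiv' : ∀ x ∈ Finset.Icc 1 n,
      (2*m+e+3).choose m ≤ ((F.image (shf F i j)).filter (fun A => x ∉ A)).card
  · have := ih (∑ A ∈ F.image (shf F i j), ∑ x ∈ A, x) (by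
        rw [Finset.sum_image (fun a ha b hb h => hinj ha hb h), ← hW]
        apply Finset.sum_lt_sum
        · intro A _; exact (shf_weight F i j hij A).1
        · exact ⟨A0, hA0, (shf_weight F i j hij A0).2 ⟨hj, hiA, hnot⟩⟩)
      (F.image (shf F i j)) rfl (by
        intro X hX
        obtain ⟨A, hA, rfl⟩ := Finset.mem_image.1 hX
        have hA' := Finset.mem_powersetCard.1 (hF hA)
        unfold shf
        split_ifs with h
        · refine Finset.mem_powersetCard.2 ⟨?_, ?_⟩
          · exact Finset.insert_subset hi ((Finset.erase_subset _ _).trans hA'.1)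
          · rw [Finset.card_insert_of_notMem (fun h' => h.2.1 (Finset.mem_of_mem_erase h')),
              Finset.card_erase_of_mem h.1, hA'.2]; rfl
        · exact hF hA) (shf_intersecting F hint i j hij.ne) hdiv'
    rwa [Finset.card_image_of_injOn hinj] at this
  · push Not at hdiv'
    obtain ⟨x, hx, hlt⟩ := hdiv'
    have hxi : x = i := by
      by_contra hne
      have hsub : (F.filter (fun A => x ∉ A)).image (shf F i j) ⊆
          (F.image (shf F i j)).filter (fun A => x ∉ A) := by
        intro X hX
        obtain ⟨A, hA, rfl⟩ := Finset.mem_image.1 hX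
        have hA := Finset.mem_filter.1 hA
        refine Finset.mem_filter.2 ⟨Finset.mem_image_of_mem _ hA.1, ?_⟩
        unfold shf
        split_ifs with h
        · intro h'
          rcases Finset.mem_insert.1 h' with h' | h'
          · exact hne h'
          · exact hA.2 (Finset.mem_of_mem_erase h')
        · exact hA.2
      have h3 := Finset.card_le_card hsub
      rw [Finset.card_image_of_injOn (hinj.mono (by
        intro A hA; exact (Finset.mem_filter.1 hA).1))] at h3
      have := hdiv x hx
      omega
    subst hxi
    have hsub : F.filter (fun A => x ∉ A ∧ j ∉ A) ⊆
        (F.image (shf F x j)).filter (fun A => x ∉ A) := by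
      intro A hA
      obtain ⟨h1, h2, h3⟩ := Finset.mem_filter.1 hA
      refine Finset.mem_filter.2 ⟨Finset.mem_image.2 ⟨A, h1, ?_⟩, h2⟩
      unfold shf
      rw [if_neg]
      tauto
    have h3 := Finset.card_le_card hsub
    have h4 : (2*m+e+3).choose m ≤ (2*m+e+3).choose (m+1) :=
      Nat.choose_le_succ_of_lt_half_left (by omega)
    refine split n m e hn F hF hint x j hi (Finset.mem_Icc.2 hjn) hij.ne (hlow x hi).le
      (hlow j (Finset.mem_Icc.2 hjn)).le ?_
    intro h; omega

theorem stmt0 (n k : ℕ) (hk : 0 < k) (hn : 2 * k < n)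
    (F : Finset (Finset ℕ)) (hF : F ⊆ Finset.powersetCard k (Finset.Icc 1 n))
    (hint : Intersecting F)
    (u : ℝ) (hu3 : 3 ≤ u) (huk : u ≤ (k : ℝ))
    (hdiv : genChoose ((n : ℝ) - u - 1) (n - k - 1) ≤ (diversity n F : ℝ)) :
    (F.card : ℝ) ≤ genChoose ((n : ℝ) - 1) (k - 1)
      + genChoose ((n : ℝ) - u - 1) (n - k - 1)
      - genChoose ((n : ℝ) - u - 1) (k - 1) := by
  have hk3 : 3 ≤ k := by exact_mod_cast hu3.trans huk
  obtain ⟨m, rfl⟩ := Nat.exists_eq_add_of_le' hk3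
  obtain ⟨e, he⟩ := Nat.exists_eq_add_of_lt hn
  have hn' : n = 2*m+e+7 := by omega
  have e1 : n - (m+3) - 1 = m+e+3 := by omega
  have e2 : m + 3 - 1 = m + 2 := rfl
  have hnR : (n:ℝ) = 2*m+e+7 := by rw [hn']; push_cast; ring
  rw [e1] at hdiv ⊢
  rw [e2]
  have e3 : (n:ℝ) - 1 = ((2*m+e+6 : ℕ) : ℝ) := by rw [hnR]; push_cast; ring
  rw [e3, gc_cast]
  push_cast at huk
  set x0 : ℝ := (n:ℝ) - u - 1 with hx0
  have hb : ((m+e+3:ℕ):ℝ) ≤ x0 := by rw [hx0, hnR]; push_cast; linarith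
  have ht : x0 ≤ ((2*m+e+3:ℕ):ℝ) := by rw [hx0, hnR]; push_cast; linarith
  have hdle : ∀ i ∈ Finset.Icc 1 n, diversity n F ≤ (F.filter (fun A => i ∉ A)).card := by
    intro i hi
    exact Nat.sInf_le ⟨i, by simpa using hi, rfl⟩
  by_cases hlow : ∃ i ∈ Finset.Icc 1 n, (F.filter (fun A => i ∉ A)).card ≤ (2*m+e+4).choose (m+1)
  · obtain ⟨i, hi, hle⟩ := hlow
    exact low n m e hn' F hF hint i hi x0 hb ht
      (hdiv.trans (by exact_mod_cast hdle i hi)) hle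
  · push Not at hlow
    have q3 := Nat.choose_succ_succ (2*m+e+3) m
    have hbig := big n m e hn' _ F rfl hF hint (by
      intro i hi
      have := hlow i hi
      simp only [Nat.succ_eq_add_one, add_assoc, Nat.reduceAdd] at *
      omega)
    have s0 : (2*m+e+3).choose (m+e+3) = (2*m+e+3).choose m :=
        Nat.choose_symm_of_eq_add (by omega)
    have g := gc_main (m+2) (m+e+3) (by omega) x0 ((2*m+e+3:ℕ):ℝ) hb ht
      (by push_cast at ht ⊢; linarith) (by push_cast; linarith)
    rw [gc_cast, gc_cast, s0] at g
    have h2 : F.card + (2*m+e+3).choose (m+2) ≤ (2*m+e+6).choose (m+2) + (2*m+e+3).choose m := by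
      have q1 := Nat.choose_succ_succ (2*m+e+5) (m+1)
      have q2 := pascal2 (2*m+e+3) m
      clear g s0 hlow
      simp only [Nat.succ_eq_add_one, add_assoc, Nat.reduceAdd] at *
      omega
    have h3 : (F.card:ℝ) + (2*m+e+3).choose (m+2) ≤ (2*m+e+6).choose (m+2) + (2*m+e+3).choose m := by
      exact_mod_cast h2
    linarith
end

section
/- Let n > 2k and k ≥ 4. Then any intersecting family F of k-element subsets of [n] with diversity γ(F) ≥ 2 satisfies |F| ≤ C(n−1,k−1) − C(n−k−1,k−1) − C(n−k−2,k−2) + 2. -/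
/-- Members of `A` avoiding `m`. -/
def delF (m : ℕ) (A : Finset (Finset ℕ)) : Finset (Finset ℕ) := A.filter (fun s => m ∉ s)

/-- Link of `m` in `A`. -/
def lnkF (m : ℕ) (A : Finset (Finset ℕ)) : Finset (Finset ℕ) :=
  (A.filter (fun s => m ∈ s)).image (fun s => s.erase m)

/-- Cross-intersecting families. -/
def CrossF (A B : Finset (Finset ℕ)) : Prop := ∀ s ∈ A, ∀ t ∈ B, (s ∩ t).Nonempty

/-- Stability under replacing `m` by any other element. -/
def StableF (S : Finset ℕ) (m : ℕ) (A : Finset (Finset ℕ)) : Prop :=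
  ∀ s ∈ A, m ∈ s → ∀ x ∈ S, x ∉ s → insert x (s.erase m) ∈ A

theorem mem_delF {m : ℕ} {A : Finset (Finset ℕ)} {s : Finset ℕ} :
    s ∈ delF m A ↔ s ∈ A ∧ m ∉ s := by simp [delF]

theorem mem_lnkF {m : ℕ} {A : Finset (Finset ℕ)} {s : Finset ℕ} :
    s ∈ lnkF m A ↔ m ∉ s ∧ insert m s ∈ A := by
  simp only [lnkF, Finset.mem_image, Finset.mem_filter]
  constructor
  · rintro ⟨t, ⟨ht, hm⟩, rfl⟩
    exact ⟨by simp, by rwa [Finset.insert_erase hm]⟩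
  · rintro ⟨hm, hs⟩
    exact ⟨insert m s, ⟨hs, by simp⟩, Finset.erase_insert hm⟩

theorem card_split (m : ℕ) (A : Finset (Finset ℕ)) :
    A.card = (delF m A).card + (lnkF m A).card := by
  have h : (lnkF m A).card = (A.filter (fun s => m ∈ s)).card := by
    apply Finset.card_image_of_injOn
    intro s hs t ht hst
    simp only [Finset.coe_filter, Set.mem_ofPred_eq] at hs ht
    have := congrArg (insert m) hst
    simpa [Finset.insert_erase hs.2, Finset.insert_erase ht.2] using this
  rw [h, delF, add_comm]
  exact (Finset.card_filter_add_card_filter_not _).symm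

theorem delF_sized {S : Finset ℕ} {K m : ℕ} {A : Finset (Finset ℕ)}
    (hA : A ⊆ Finset.powersetCard K S) : delF m A ⊆ Finset.powersetCard K (S.erase m) := by
  intro s hs
  rw [mem_delF] at hs
  have := hA hs.1
  rw [Finset.mem_powersetCard] at this ⊢
  exact ⟨Finset.subset_erase.2 ⟨this.1, hs.2⟩, this.2⟩

theorem lnkF_sized {S : Finset ℕ} {K m : ℕ} {A : Finset (Finset ℕ)}
    (hA : A ⊆ Finset.powersetCard K S) : lnkF m A ⊆ Finset.powersetCard (K - 1) (S.erase m) := by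
  intro s hs
  rw [mem_lnkF] at hs
  have := hA hs.2
  rw [Finset.mem_powersetCard, Finset.card_insert_of_notMem hs.1] at this
  rw [Finset.mem_powersetCard]
  refine ⟨Finset.subset_erase.2 ⟨fun y hy => this.1 (by simp [hy]), hs.1⟩, by omega⟩

/-- Shift `m → x`. -/
def shF (m x : ℕ) (A : Finset (Finset ℕ)) : Finset (Finset ℕ) :=
  A.image (fun s => if m ∈ s ∧ x ∉ s ∧ insert x (s.erase m) ∉ A then insert x (s.erase m) else s)

theorem mem_shF {m x : ℕ} {A : Finset (Finset ℕ)} {t : Finset ℕ} (h : t ∈ shF m x A) :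
    (t ∈ A ∧ (m ∈ t → x ∉ t → insert x (t.erase m) ∈ A)) ∨
      ∃ s ∈ A, m ∈ s ∧ x ∉ s ∧ insert x (s.erase m) ∉ A ∧ t = insert x (s.erase m) := by
  simp only [shF, Finset.mem_image] at h
  obtain ⟨s, hs, rfl⟩ := h
  split_ifs with hc
  · right; exact ⟨s, hs, hc.1, hc.2.1, hc.2.2, rfl⟩
  · left; refine ⟨hs, fun h1 h2 => ?_⟩
    by_contra h3
    exact hc ⟨h1, h2, h3⟩

theorem card_shF (m x : ℕ) (A : Finset (Finset ℕ)) : (shF m x A).card = A.card := by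
  apply Finset.card_image_of_injOn
  intro s hs t ht hst
  have key : ∀ s t : Finset ℕ, m ∈ s → x ∉ s → m ∈ t → x ∉ t →
      insert x (s.erase m) = insert x (t.erase m) → s = t := by
    intro s t h1 h2 h3 h4 h5
    have h6 := congrArg (fun u => insert m (u.erase x)) h5
    have h7 : x ∉ s.erase m := fun h => h2 (Finset.mem_of_mem_erase h)
    have h8 : x ∉ t.erase m := fun h => h4 (Finset.mem_of_mem_erase h)
    simpa [Finset.erase_insert h7, Finset.erase_insert h8, Finset.insert_erase h1,
      Finset.insert_erase h3] using h6
  simp only at hst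
  split_ifs at hst with h1 h2 h2
  · exact key s t h1.1 h1.2.1 h2.1 h2.2.1 hst
  · exact absurd (hst ▸ ht) h1.2.2
  · exact absurd (hst ▸ hs) h2.2.2
  · exact hst

theorem shF_sized {S : Finset ℕ} {K m x : ℕ} {A : Finset (Finset ℕ)} (hx : x ∈ S)
    (hA : A ⊆ Finset.powersetCard K S) : shF m x A ⊆ Finset.powersetCard K S := by
  intro t ht
  rcases mem_shF ht with h | ⟨s, hs, hm, hxs, -, rfl⟩
  · exact hA h.1
  · have := hA hs
    rw [Finset.mem_powersetCard] at this ⊢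
    have h7 : x ∉ s.erase m := fun h => hxs (Finset.mem_of_mem_erase h)
    refine ⟨?_, ?_⟩
    · intro y hy
      rcases Finset.mem_insert.1 hy with rfl | hy
      · exact hx
      · exact this.1 (Finset.mem_of_mem_erase hy)
    · rw [Finset.card_insert_of_notMem h7, Finset.card_erase_of_mem hm]
      have := Finset.card_pos.2 ⟨m, hm⟩
      omega

theorem shF_cross_aux {m x : ℕ} {s t : Finset ℕ}
    (hst : (s ∩ t).Nonempty) (hx : x ∉ s)
    (h1 : m ∈ t → x ∉ t → (s ∩ insert x (t.erase m)).Nonempty) :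
    (insert x (s.erase m) ∩ t).Nonempty := by
  by_cases hxt : x ∈ t
  · exact ⟨x, by simp [hxt]⟩
  by_cases hmt : m ∈ t
  · obtain ⟨y, hy⟩ := h1 hmt hxt
    refine ⟨y, ?_⟩
    simp only [Finset.mem_inter, Finset.mem_insert, Finset.mem_erase] at hy ⊢
    grind
  · obtain ⟨y, hy⟩ := hst
    refine ⟨y, ?_⟩
    simp only [Finset.mem_inter, Finset.mem_insert, Finset.mem_erase] at hy ⊢
    grind

theorem shF_cross {m x : ℕ} {A B : Finset (Finset ℕ)} (h : CrossF A B) :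
    CrossF (shF m x A) (shF m x B) := by
  intro s hs t ht
  rcases mem_shF hs with ⟨hs1, hs2⟩ | ⟨s', hs1, hs2, hs3, hs4, rfl⟩ <;>
  rcases mem_shF ht with ⟨ht1, ht2⟩ | ⟨t', ht1, ht2, ht3, ht4, rfl⟩
  · exact h s hs1 t ht1
  · rw [Finset.inter_comm]
    apply shF_cross_aux _ ht3
    · intro a b
      rw [Finset.inter_comm]
      exact h _ (hs2 a b) _ ht1
    · rw [Finset.inter_comm]
      exact h _ hs1 _ ht1
  · apply shF_cross_aux _ hs3
    · intro a b
      exact h _ hs1 _ (ht2 a b)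
    · exact h _ hs1 _ ht1
  · exact ⟨x, by simp⟩

theorem delF_shF (m x : ℕ) (A : Finset (Finset ℕ)) : delF m A ⊆ delF m (shF m x A) := by
  intro s hs
  rw [mem_delF] at hs ⊢
  refine ⟨?_, hs.2⟩
  simp only [shF, Finset.mem_image]
  exact ⟨s, hs.1, by simp [hs.2]⟩

theorem delF_shF_lt {m x : ℕ} {A : Finset (Finset ℕ)} {s : Finset ℕ} (hs : s ∈ A) (hm : m ∈ s)
    (hx : x ∉ s) (hn : insert x (s.erase m) ∉ A) :
    (delF m A).card < (delF m (shF m x A)).card := by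
  apply Finset.card_lt_card
  refine Finset.ssubset_iff_subset_ne.2 ⟨delF_shF m x A, fun he => ?_⟩
  have h1 : insert x (s.erase m) ∈ delF m (shF m x A) := by
    rw [mem_delF]
    refine ⟨?_, ?_⟩
    · simp only [shF, Finset.mem_image]
      exact ⟨s, hs, by simp [hm, hx, hn]⟩
    · have : m ≠ x := by rintro rfl; exact hx hm
      simp [this]
  rw [← he, mem_delF] at h1
  exact hn h1.1

theorem stabilize (S : Finset ℕ) (K m : ℕ) : ∀ (r : ℕ) (A B : Finset (Finset ℕ)),
    A.card + B.card ≤ r + ((delF m A).card + (delF m B).card) →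
    A ⊆ Finset.powersetCard K S → B ⊆ Finset.powersetCard K S → CrossF A B →
    ∃ A' B' : Finset (Finset ℕ), A' ⊆ Finset.powersetCard K S ∧ B' ⊆ Finset.powersetCard K S ∧
      CrossF A' B' ∧ A'.card = A.card ∧ B'.card = B.card ∧ delF m A ⊆ delF m A' ∧
      delF m B ⊆ delF m B' ∧ StableF S m A' ∧ StableF S m B' ∧ (A = B → A' = B') := by
  intro r
  induction r with
  | zero =>
    intro A B h hA hB hc
    have hle : ∀ X : Finset (Finset ℕ), (delF m X).card ≤ X.card := fun X =>
      Finset.card_filter_le _ _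
    have hst : ∀ X : Finset (Finset ℕ), X.card ≤ (delF m X).card → StableF S m X := by
      intro X hX s hs hm
      have : delF m X = X := Finset.eq_of_subset_of_card_le (Finset.filter_subset _ _) hX
      have hs : s ∈ delF m X := by rw [this]; exact hs
      rw [mem_delF] at hs
      exact absurd hm hs.2
    have h1 := hle A
    have h2 := hle B
    exact ⟨A, B, hA, hB, hc, rfl, rfl, subset_rfl, subset_rfl, hst A (by omega), hst B (by omega),
      id⟩
  | succ r ih =>
    intro A B h hA hB hc
    by_cases hs : StableF S m A ∧ StableF S m B
    · exact ⟨A, B, hA, hB, hc, rfl, rfl, subset_rfl, subset_rfl, hs.1, hs.2, id⟩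
    have : ∃ x ∈ S, (delF m A).card + (delF m B).card <
        (delF m (shF m x A)).card + (delF m (shF m x B)).card := by
      rw [not_and_or] at hs
      rcases hs with hs | hs <;>
      · unfold StableF at hs
        push Not at hs
        obtain ⟨s, hs, hm, x, hx, hxs, hn⟩ := hs
        refine ⟨x, hx, ?_⟩
        have h1 := delF_shF_lt hs hm hxs hn
        have h2 := Finset.card_le_card (delF_shF m x A)
        have h3 := Finset.card_le_card (delF_shF m x B)
        omega
    obtain ⟨x, hx, hlt⟩ := this
    obtain ⟨A', B', h1, h2, h3, h4, h5, h6, h7, h8, h9, h10⟩ := ih (shF m x A) (shF m x B)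
      (by rw [card_shF, card_shF]; omega) (shF_sized hx hA) (shF_sized hx hB) (shF_cross hc)
    exact ⟨A', B', h1, h2, h3, by rw [h4, card_shF], by rw [h5, card_shF],
      (delF_shF m x A).trans h6, (delF_shF m x B).trans h7, h8, h9, fun h => h10 (by rw [h])⟩

theorem lnkF_cross {S : Finset ℕ} {K m : ℕ} {A B : Finset (Finset ℕ)}
    (hA : A ⊆ Finset.powersetCard K S) (hB : B ⊆ Finset.powersetCard K S) (hc : CrossF A B)
    (hst : StableF S m A) (hS : 2 * K ≤ S.card) : CrossF (lnkF m A) (lnkF m B) := by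
  intro s hs t ht
  rw [mem_lnkF] at hs ht
  have h1 := (Finset.mem_powersetCard.1 (hA hs.2)).2
  have h2 := (Finset.mem_powersetCard.1 (hB ht.2)).2
  rw [Finset.card_insert_of_notMem hs.1] at h1
  rw [Finset.card_insert_of_notMem ht.1] at h2
  have h3 : (insert m (s ∪ t)).card < S.card := by
    have := Finset.card_insert_le m (s ∪ t)
    have := Finset.card_union_le s t
    omega
  obtain ⟨x, hx, hxn⟩ := Finset.exists_mem_notMem_of_card_lt_card h3
  simp only [Finset.mem_insert, Finset.mem_union, not_or] at hxn
  have h4 := hst _ hs.2 (by simp) x hx (by simp [hxn])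
  rw [Finset.erase_insert hs.1] at h4
  obtain ⟨y, hy⟩ := hc _ h4 _ ht.2
  refine ⟨y, ?_⟩
  simp only [Finset.mem_inter, Finset.mem_insert] at hy ⊢
  grind

theorem delF_cross {m : ℕ} {A B : Finset (Finset ℕ)} (hc : CrossF A B) :
    CrossF (delF m A) (delF m B) := fun s hs t ht =>
  hc s (mem_delF.1 hs).1 t (mem_delF.1 ht).1

theorem delF_nonempty {S : Finset ℕ} {K m : ℕ} {A : Finset (Finset ℕ)}
    (hA : A ⊆ Finset.powersetCard K S) (hst : StableF S m A) (hS : K < S.card)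
    (hne : A.Nonempty) : (delF m A).Nonempty := by
  obtain ⟨s, hs⟩ := hne
  by_cases hm : m ∈ s
  · have h1 := (Finset.mem_powersetCard.1 (hA hs)).2
    obtain ⟨x, hx, hxn⟩ := Finset.exists_mem_notMem_of_card_lt_card (h1 ▸ hS)
    have hmx : m ≠ x := by rintro rfl; exact hxn hm
    exact ⟨_, mem_delF.2 ⟨hst s hs hm x hx hxn, by simp [hmx]⟩⟩
  · exact ⟨s, mem_delF.2 ⟨hs, hm⟩⟩

theorem delF_two {S : Finset ℕ} {K m : ℕ} {A : Finset (Finset ℕ)}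
    (hA : A ⊆ Finset.powersetCard K S) (hst : StableF S m A) (hS : K + 2 ≤ S.card)
    (hne : 2 ≤ A.card) : 2 ≤ (delF m A).card := by
  by_cases h : ∃ s ∈ A, m ∈ s
  · obtain ⟨s, hs, hm⟩ := h
    have h1 := (Finset.mem_powersetCard.1 (hA hs))
    have h2 : 1 < (S \ s).card := by
      rw [Finset.card_sdiff_of_subset h1.1]; omega
    obtain ⟨x, hx, y, hy, hxy⟩ := Finset.one_lt_card.1 h2
    simp only [Finset.mem_sdiff] at hx hy
    have hmx : m ≠ x := by rintro rfl; exact hx.2 hm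
    have hmy : m ≠ y := by rintro rfl; exact hy.2 hm
    refine Finset.one_lt_card.2 ⟨_, mem_delF.2 ⟨hst s hs hm x hx.1 hx.2, by simp [hmx]⟩,
      _, mem_delF.2 ⟨hst s hs hm y hy.1 hy.2, by simp [hmy]⟩, fun he => ?_⟩
    have : x ∈ insert y (s.erase m) := he ▸ Finset.mem_insert_self _ _
    simp only [Finset.mem_insert, Finset.mem_erase] at this
    grind
  · push Not at h
    rwa [delF, Finset.filter_true_of_mem h]

theorem count1 {T G : Finset ℕ} {r : ℕ} {H : Finset (Finset ℕ)}
    (hH : H ⊆ Finset.powersetCard r T) (hG : G ⊆ T) (h : ∀ s ∈ H, (s ∩ G).Nonempty) :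
    H.card + (T.card - G.card).choose r ≤ T.card.choose r := by
  have hd : Disjoint H (Finset.powersetCard r (T \ G)) := by
    rw [Finset.disjoint_left]
    intro s hs hs2
    obtain ⟨y, hy⟩ := h s hs
    rw [Finset.mem_powersetCard] at hs2
    have := hs2.1 (Finset.mem_inter.1 hy).1
    simp only [Finset.mem_inter, Finset.mem_sdiff] at hy this
    tauto
  have := Finset.card_le_card (Finset.union_subset hH
    (Finset.powersetCard_mono (n := r) (Finset.sdiff_subset : T \ G ⊆ T)))
  rwa [Finset.card_union_of_disjoint hd, Finset.card_powersetCard, Finset.card_powersetCard,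
    Finset.card_sdiff_of_subset hG] at this

theorem count2 {T G G' : Finset ℕ} {r K : ℕ} {H : Finset (Finset ℕ)}
    (hH : H ⊆ Finset.powersetCard (r + 1) T) (hG : G ⊆ T) (hG' : G' ⊆ T) (hc : G.card = K)
    (hc' : G'.card = K) (hne : G ≠ G')
    (h : ∀ s ∈ H, (s ∩ G).Nonempty) (h' : ∀ s ∈ H, (s ∩ G').Nonempty) :
    H.card + (T.card - K).choose (r + 1) + (T.card - K - 1).choose r ≤ T.card.choose (r + 1) := by
  obtain ⟨y, hyG, hyG'⟩ : ∃ y ∈ G, y ∉ G' := by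
    by_contra hcon
    push Not at hcon
    exact hne (Finset.eq_of_subset_of_card_le hcon (by omega))
  set Q := (Finset.powersetCard r ((T \ G').erase y)).image (insert y) with hQ
  have hQc : Q.card = (T.card - K - 1).choose r := by
    rw [hQ, Finset.card_image_of_injOn, Finset.card_powersetCard, Finset.card_erase_of_mem,
      Finset.card_sdiff_of_subset hG', hc']
    · simp [hyG', hG hyG]
    · intro s hs t ht hst
      have hs : s ∈ Finset.powersetCard r ((T \ G').erase y) := hs
      have ht : t ∈ Finset.powersetCard r ((T \ G').erase y) := ht
      rw [Finset.mem_powersetCard] at hs ht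
      have h1 : y ∉ s := fun h => by simpa using hs.1 h
      have h2 : y ∉ t := fun h => by simpa using ht.1 h
      have h3 : insert y s = insert y t := hst
      have := congrArg (fun u => u.erase y) h3
      simpa [Finset.erase_insert h1, Finset.erase_insert h2] using this
  have hQT : Q ⊆ Finset.powersetCard (r + 1) T := by
    intro s hs
    rw [hQ, Finset.mem_image] at hs
    obtain ⟨t, ht, rfl⟩ := hs
    rw [Finset.mem_powersetCard] at ht ⊢
    have h2 : y ∉ t := fun h => by simpa using ht.1 h
    refine ⟨?_, by rw [Finset.card_insert_of_notMem h2, ht.2]⟩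
    intro z hz
    rcases Finset.mem_insert.1 hz with rfl | hz
    · exact hG hyG
    · have := ht.1 hz
      simp only [Finset.mem_erase, Finset.mem_sdiff] at this
      exact this.2.1
  have hdQ : Disjoint (H ∪ Q) (Finset.powersetCard (r + 1) (T \ G)) := by
    rw [Finset.disjoint_left]
    intro s hs hs2
    rw [Finset.mem_powersetCard] at hs2
    rcases Finset.mem_union.1 hs with hs | hs
    · obtain ⟨z, hz⟩ := h s hs
      have := hs2.1 (Finset.mem_inter.1 hz).1
      simp only [Finset.mem_inter, Finset.mem_sdiff] at hz this
      tauto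
    · rw [hQ, Finset.mem_image] at hs
      obtain ⟨t, ht, rfl⟩ := hs
      have := hs2.1 (Finset.mem_insert_self _ _)
      simp only [Finset.mem_sdiff] at this
      tauto
  have hd : Disjoint H Q := by
    rw [Finset.disjoint_left]
    intro s hs hs2
    rw [hQ, Finset.mem_image] at hs2
    obtain ⟨t, ht, rfl⟩ := hs2
    rw [Finset.mem_powersetCard] at ht
    obtain ⟨z, hz⟩ := h' _ hs
    simp only [Finset.mem_inter, Finset.mem_insert] at hz
    rcases hz.1 with h1 | h1
    · exact hyG' (h1 ▸ hz.2)
    · have := ht.1 h1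
      simp only [Finset.mem_erase, Finset.mem_sdiff] at this
      tauto
  have := Finset.card_le_card (Finset.union_subset (Finset.union_subset hH hQT)
    (Finset.powersetCard_mono (n := r + 1) (Finset.sdiff_subset : T \ G ⊆ T)))
  rw [Finset.card_union_of_disjoint hdQ, Finset.card_union_of_disjoint hd,
    Finset.card_powersetCard, Finset.card_powersetCard,
    Finset.card_sdiff_of_subset hG, hQc, hc] at this
  omega

theorem cross_base {S : Finset ℕ} {K : ℕ} {A B : Finset (Finset ℕ)}
    (hA : A ⊆ Finset.powersetCard K S) (hB : B ⊆ Finset.powersetCard K S) (hc : CrossF A B)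
    (hS : S.card = 2 * K) : A.card + B.card ≤ S.card.choose K := by
  set C := B.image (fun s => S \ s) with hC
  have hCc : C.card = B.card := by
    apply Finset.card_image_of_injOn
    intro s hs t ht hst
    have h1 := (Finset.mem_powersetCard.1 (hB hs)).1
    have h2 := (Finset.mem_powersetCard.1 (hB ht)).1
    have h3 : S \ s = S \ t := hst
    rw [← Finset.sdiff_sdiff_eq_self h1, h3, Finset.sdiff_sdiff_eq_self h2]
  have hCS : C ⊆ Finset.powersetCard K S := by
    intro s hs
    rw [hC, Finset.mem_image] at hs
    obtain ⟨t, ht, rfl⟩ := hs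
    have h1 := (Finset.mem_powersetCard.1 (hB ht))
    rw [Finset.mem_powersetCard, Finset.card_sdiff_of_subset h1.1]
    exact ⟨Finset.sdiff_subset, by omega⟩
  have hd : Disjoint A C := by
    rw [Finset.disjoint_left]
    intro s hs hs2
    rw [hC, Finset.mem_image] at hs2
    obtain ⟨t, ht, rfl⟩ := hs2
    obtain ⟨z, hz⟩ := hc _ hs _ ht
    simp only [Finset.mem_inter, Finset.mem_sdiff] at hz
    tauto
  have := Finset.card_le_card (Finset.union_subset hA hCS)
  rwa [Finset.card_union_of_disjoint hd, hCc, Finset.card_powersetCard] at this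

theorem pas (n k : ℕ) (hn : 1 ≤ n) (hk : 1 ≤ k) :
    n.choose k = (n - 1).choose (k - 1) + (n - 1).choose k := by
  obtain ⟨n, rfl⟩ := Nat.exists_eq_add_of_le' hn
  obtain ⟨k, rfl⟩ := Nat.exists_eq_add_of_le' hk
  exact Nat.choose_succ_succ' n k

theorem CrossF.symm' {A B : Finset (Finset ℕ)} (h : CrossF A B) : CrossF B A := by
  intro s hs t ht
  rw [Finset.inter_comm]
  exact h t ht s hs

theorem lnk_del_meet {m : ℕ} {A B : Finset (Finset ℕ)} (h : CrossF A B) {G t : Finset ℕ}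
    (hG : G ∈ delF m A) (ht : t ∈ lnkF m B) : (t ∩ G).Nonempty := by
  rw [mem_delF] at hG
  rw [mem_lnkF] at ht
  obtain ⟨y, hy⟩ := h _ hG.1 _ ht.2
  refine ⟨y, ?_⟩
  simp only [Finset.mem_inter, Finset.mem_insert] at hy ⊢
  grind

theorem cross_pos {S : Finset ℕ} {K : ℕ} {A B : Finset (Finset ℕ)}
    (hA : A ⊆ Finset.powersetCard K S) (hc : CrossF A B)
    (hAn : A.Nonempty) (hBn : B.Nonempty) : 1 ≤ K := by
  obtain ⟨s, hs⟩ := hAn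
  obtain ⟨t, ht⟩ := hBn
  have := (Finset.mem_powersetCard.1 (hA hs)).2
  have h := Finset.card_pos.2 (hc s hs t ht)
  have := Finset.card_le_card (Finset.inter_subset_left : s ∩ t ⊆ s)
  omega

/-- Nonempty cross-intersecting families. -/
theorem crossHM : ∀ (N K : ℕ) (S : Finset ℕ) (A B : Finset (Finset ℕ)), S.card = N → 2 * K ≤ N →
    A ⊆ Finset.powersetCard K S → B ⊆ Finset.powersetCard K S → CrossF A B →
    A.Nonempty → B.Nonempty →
    A.card + B.card + (N - K).choose K ≤ N.choose K + 1 := by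
  intro N
  induction N with
  | zero =>
    intro K S A B hS hN hA hB hc hAn hBn
    have := cross_pos hA hc hAn hBn
    omega
  | succ N ih =>
    intro K S A₀ B₀ hS hN hA₀ hB₀ hc₀ hAn₀ hBn₀
    have hK := cross_pos hA₀ hc₀ hAn₀ hBn₀
    rcases Nat.eq_or_lt_of_le hN with hN | hN
    · have := cross_base hA₀ hB₀ hc₀ (by omega)
      rw [hS] at this
      have e : N + 1 - K = K := by omega
      rw [e, Nat.choose_self]
      omega
    obtain ⟨m, hm⟩ : S.Nonempty := Finset.card_pos.1 (by omega)
    obtain ⟨A, B, hA, hB, hc, hAc, hBc, -, -, hAs, hBs, -⟩ :=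
      stabilize S K m (A₀.card + B₀.card) A₀ B₀ (by omega) hA₀ hB₀ hc₀
    have hAn : A.Nonempty := Finset.card_pos.1 (by have := Finset.card_pos.2 hAn₀; omega)
    have hBn : B.Nonempty := Finset.card_pos.1 (by have := Finset.card_pos.2 hBn₀; omega)
    have hT : (S.erase m).card = N := by rw [Finset.card_erase_of_mem hm]; omega
    have hdA := delF_nonempty hA hAs (by omega) hAn
    have hdB := delF_nonempty hB hBs (by omega) hBn
    have D := ih K _ _ _ hT (by omega) (delF_sized (m := m) hA) (delF_sized hB) (delF_cross hc)
      hdA hdB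
    have lc := lnkF_cross hA hB hc hAs (by omega)
    have L : (lnkF m A).card + (lnkF m B).card + (N - K).choose (K - 1) ≤ N.choose (K - 1) := by
      rcases (lnkF m A).eq_empty_or_nonempty with hlA | hlA
      · obtain ⟨G, hG⟩ := hdA
        have hG' := Finset.mem_powersetCard.1 (delF_sized hA hG)
        have := count1 (lnkF_sized (m := m) hB) hG'.1 (fun s hs => lnk_del_meet hc hG hs)
        rw [hT, hG'.2] at this
        rw [hlA, Finset.card_empty]
        omega
      rcases (lnkF m B).eq_empty_or_nonempty with hlB | hlB
      · obtain ⟨G, hG⟩ := hdB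
        have hG' := Finset.mem_powersetCard.1 (delF_sized hB hG)
        have := count1 (lnkF_sized (m := m) hA) hG'.1 (fun s hs => lnk_del_meet hc.symm' hG hs)
        rw [hT, hG'.2] at this
        rw [hlB, Finset.card_empty]
        omega
      have hK2 := cross_pos (lnkF_sized hA) lc hlA hlB
      have := ih (K - 1) _ _ _ hT (by omega) (lnkF_sized (m := m) hA) (lnkF_sized hB) lc hlA hlB
      rw [pas (N - (K - 1)) (K - 1) (by omega) (by omega),
        show N - (K - 1) - 1 = N - K by omega] at this
      have h1 : 0 < (N - K).choose (K - 1 - 1) := Nat.choose_pos (by omega)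
      omega
    have e1 := card_split m A
    have e2 := card_split m B
    rw [pas (N + 1 - K) K (by omega) (by omega), pas (N + 1) K (by omega) (by omega),
      show N + 1 - K - 1 = N - K by omega, show N + 1 - 1 = N by omega]
    omega

/-- Cross-intersecting families with at least two members each. -/
theorem crossTwo : ∀ (N K : ℕ) (S : Finset ℕ) (A B : Finset (Finset ℕ)), S.card = N → 2 * K ≤ N →
    3 ≤ K →
    A ⊆ Finset.powersetCard K S → B ⊆ Finset.powersetCard K S → CrossF A B →
    2 ≤ A.card → 2 ≤ B.card →
    A.card + B.card + (N - K).choose K + (N - K - 1).choose (K - 1) ≤ N.choose K + 2 := by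
  intro N
  induction N with
  | zero =>
    intro K S A B hS hN hK
    omega
  | succ N ih =>
    intro K S A₀ B₀ hS hN hK hA₀ hB₀ hc₀ hAn₀ hBn₀
    rcases Nat.eq_or_lt_of_le hN with hN | hN
    · have := cross_base hA₀ hB₀ hc₀ (by omega)
      rw [hS] at this
      have e : N + 1 - K = K := by omega
      rw [e, Nat.choose_self, Nat.choose_self]
      omega
    obtain ⟨m, hm⟩ : S.Nonempty := Finset.card_pos.1 (by omega)
    obtain ⟨A, B, hA, hB, hc, hAc, hBc, -, -, hAs, hBs, -⟩ :=
      stabilize S K m (A₀.card + B₀.card) A₀ B₀ (by omega) hA₀ hB₀ hc₀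
    have hT : (S.erase m).card = N := by rw [Finset.card_erase_of_mem hm]; omega
    have hdA := delF_two hA hAs (by omega) (by omega)
    have hdB := delF_two hB hBs (by omega) (by omega)
    have D := ih K _ _ _ hT (by omega) hK (delF_sized (m := m) hA) (delF_sized hB) (delF_cross hc)
      hdA hdB
    have lc := lnkF_cross hA hB hc hAs (by omega)
    have L : (lnkF m A).card + (lnkF m B).card + (N - K).choose (K - 1)
        + (N - K - 1).choose (K - 2) ≤ N.choose (K - 1) := by
      have eK : K - 1 = K - 2 + 1 := by omega
      rcases (lnkF m A).eq_empty_or_nonempty with hlA | hlA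
      · obtain ⟨G, hG, G', hG', hne⟩ := Finset.one_lt_card.1 hdA
        have hG1 := Finset.mem_powersetCard.1 (delF_sized hA hG)
        have hG1' := Finset.mem_powersetCard.1 (delF_sized hA hG')
        have := count2 (eK ▸ lnkF_sized (m := m) hB) hG1.1 hG1'.1 hG1.2 hG1'.2 hne
          (fun s hs => lnk_del_meet hc hG hs) (fun s hs => lnk_del_meet hc hG' hs)
        rw [hT, ← eK] at this
        rw [hlA, Finset.card_empty]
        omega
      rcases (lnkF m B).eq_empty_or_nonempty with hlB | hlB
      · obtain ⟨G, hG, G', hG', hne⟩ := Finset.one_lt_card.1 hdB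
        have hG1 := Finset.mem_powersetCard.1 (delF_sized hB hG)
        have hG1' := Finset.mem_powersetCard.1 (delF_sized hB hG')
        have := count2 (eK ▸ lnkF_sized (m := m) hA) hG1.1 hG1'.1 hG1.2 hG1'.2 hne
          (fun s hs => lnk_del_meet hc.symm' hG hs) (fun s hs => lnk_del_meet hc.symm' hG' hs)
        rw [hT, ← eK] at this
        rw [hlB, Finset.card_empty]
        omega
      have := crossHM N (K - 1) _ _ _ hT (by omega) (lnkF_sized (m := m) hA) (lnkF_sized hB) lc
        hlA hlB
      rw [pas (N - (K - 1)) (K - 1) (by omega) (by omega),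
        show N - (K - 1) - 1 = N - K by omega, show K - 1 - 1 = K - 2 by omega,
        pas (N - K) (K - 2) (by omega) (by omega)] at this
      have h1 : 0 < (N - K - 1).choose (K - 2 - 1) := Nat.choose_pos (by omega)
      omega
    have e1 := card_split m A
    have e2 := card_split m B
    rw [pas (N + 1 - K) K (by omega) (by omega), pas (N + 1) K (by omega) (by omega),
      show N + 1 - K - 1 = N - K by omega, show N + 1 - 1 = N by omega,
      pas (N - K) (K - 1) (by omega) (by omega), show K - 1 - 1 = K - 2 by omega]
    rw [pas (N - K) (K - 1) (by omega) (by omega), show K - 1 - 1 = K - 2 by omega] at L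
    omega

theorem del_comm (m x : ℕ) (F : Finset (Finset ℕ)) : delF m (delF x F) = delF x (delF m F) := by
  ext s
  simp only [mem_delF]
  tauto

theorem lnk_del_comm {m x : ℕ} (h : x ≠ m) (F : Finset (Finset ℕ)) :
    lnkF m (delF x F) = delF x (lnkF m F) := by
  ext s
  simp only [mem_delF, mem_lnkF, Finset.mem_insert]
  tauto

theorem two_cross {m x : ℕ} (hxm : x ≠ m) {F : Finset (Finset ℕ)} (hc : CrossF F F) :
    CrossF (lnkF x (delF m F)) (delF x (lnkF m F)) := by
  intro s hs t ht
  simp only [mem_delF, mem_lnkF, Finset.mem_insert, not_or] at hs ht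
  obtain ⟨y, hy⟩ := hc _ hs.2.1 _ ht.1.2
  refine ⟨y, ?_⟩
  simp only [Finset.mem_inter, Finset.mem_insert] at hy ⊢
  grind

theorem choose_half {k : ℕ} (hk : 1 ≤ k) : (2 * k).choose k = 2 * (2 * k - 1).choose (k - 1) := by
  rw [pas (2 * k) k (by omega) hk]
  have : (2 * k - 1).choose k = (2 * k - 1).choose (k - 1) := by
    rw [← Nat.choose_symm (show k ≤ 2 * k - 1 by omega)]
    congr 1
    omega
  omega

theorem inter_pos {S : Finset ℕ} {k : ℕ} {F : Finset (Finset ℕ)}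
    (hF : F ⊆ Finset.powersetCard k S) (hc : CrossF F F) (hne : F.Nonempty)
    (hd : ∀ x ∈ S, (delF x F).Nonempty) : 2 ≤ k := by
  obtain ⟨s, hs⟩ := hne
  have hs1 := Finset.mem_powersetCard.1 (hF hs)
  obtain ⟨x, hx⟩ := hc s hs s hs
  rw [Finset.inter_self] at hx
  obtain ⟨t, ht⟩ := hd x (hs1.1 hx)
  rw [mem_delF] at ht
  obtain ⟨y, hy⟩ := hc s hs t ht.1
  rw [Finset.mem_inter] at hy
  have hxy : x ≠ y := by rintro rfl; exact ht.2 hy.2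
  have : 1 < s.card := Finset.one_lt_card.2 ⟨x, hx, y, hy.1, hxy⟩
  omega

/-- Hilton-Milner. -/
theorem hiltonMilner : ∀ (N k : ℕ) (S : Finset ℕ) (F : Finset (Finset ℕ)), S.card = N → 2 * k ≤ N →
    1 ≤ k → F ⊆ Finset.powersetCard k S → CrossF F F → (∀ x ∈ S, (delF x F).Nonempty) →
    F.card + (N - k - 1).choose (k - 1) ≤ (N - 1).choose (k - 1) + 1 := by
  intro N
  induction N with
  | zero =>
    intro k S F hS hN hk
    omega
  | succ N ih =>
    intro k S F₀ hS hN hk hF₀ hc₀ hd₀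
    rcases Nat.eq_or_lt_of_le hN with hN | hN
    · have := cross_base hF₀ hF₀ hc₀ (by omega)
      rw [hS, ← hN, choose_half hk] at this
      rw [show N + 1 - k - 1 = k - 1 by omega, Nat.choose_self, ← hN]
      omega
    obtain ⟨m, hm⟩ : S.Nonempty := Finset.card_pos.1 (by omega)
    have hT : (S.erase m).card = N := by rw [Finset.card_erase_of_mem hm]; omega
    have hFn : F₀.Nonempty := (hd₀ m hm).mono (Finset.filter_subset _ _)
    have hk2 := inter_pos hF₀ hc₀ hFn hd₀
    by_cases hbad : ∃ x ∈ S.erase m, delF x (delF m F₀) = ∅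
    · obtain ⟨x, hx, he⟩ := hbad
      have hxm := Finset.ne_of_mem_erase hx
      have hT2 : ((S.erase m).erase x).card = N - 1 := by rw [Finset.card_erase_of_mem hx, hT]
      have e1 := card_split m F₀
      have e2 := card_split x (delF m F₀)
      have e3 := card_split x (lnkF m F₀)
      have e4 := card_split m (delF x F₀)
      rw [del_comm, lnk_del_comm hxm, he, Finset.card_empty] at e4
      rw [he, Finset.card_empty] at e2
      have c1 := Finset.card_pos.2 (hd₀ m hm)
      have c2 := Finset.card_pos.2 (hd₀ x (Finset.mem_of_mem_erase hx))
      have h1 := crossHM (N - 1) (k - 1) _ _ _ hT2 (by omega)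
        (lnkF_sized (m := x) (delF_sized (m := m) hF₀))
        (delF_sized (m := x) (lnkF_sized (m := m) hF₀)) (two_cross hxm hc₀)
        (Finset.card_pos.1 (by omega)) (Finset.card_pos.1 (by omega))
      have h2 := Finset.card_le_card (lnkF_sized (m := x) (lnkF_sized (m := m) hF₀))
      rw [Finset.card_powersetCard, hT2] at h2
      rw [show N - 1 - (k - 1) = N - k by omega] at h1
      rw [show N + 1 - k - 1 = N - k by omega, show N + 1 - 1 = N by omega,
        pas N (k - 1) (by omega) (by omega)]
      omega
    push Not at hbad
    obtain ⟨F, F', hF, -, hc, hFc, -, hsub, -, hst, -, hFF⟩ :=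
      stabilize S k m (F₀.card + F₀.card) F₀ F₀ (by omega) hF₀ hF₀ hc₀
    obtain rfl := hFF rfl
    have hdd : ∀ x ∈ S.erase m, (delF x (delF m F)).Nonempty := by
      intro x hx
      obtain ⟨s, hs⟩ := hbad x hx
      rw [mem_delF] at hs
      exact ⟨s, mem_delF.2 ⟨hsub hs.1, hs.2⟩⟩
    have D := ih k _ _ hT (by omega) hk (delF_sized (m := m) hF) (delF_cross hc) hdd
    have lc := lnkF_cross hF hF hc hst (by omega)
    have L : (lnkF m F).card + (N - k - 1).choose (k - 2) ≤ (N - 1).choose (k - 2) := by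
      by_cases hstar : ∃ x ∈ S.erase m, delF x (lnkF m F) = ∅
      · obtain ⟨x, hx, he⟩ := hstar
        have hT2 : ((S.erase m).erase x).card = N - 1 := by rw [Finset.card_erase_of_mem hx, hT]
        have e3 := card_split x (lnkF m F)
        rw [he, Finset.card_empty] at e3
        obtain ⟨G, hG⟩ := hdd x hx
        have hG' := Finset.mem_powersetCard.1 (delF_sized (delF_sized hF) hG)
        have hcr : CrossF (delF m F) (lnkF m F) := fun s hs t ht => by
          rw [Finset.inter_comm]; exact lnk_del_meet hc hs ht
        have := count1 (lnkF_sized (m := x) (lnkF_sized (m := m) hF)) hG'.1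
          (fun s hs => lnk_del_meet hcr hG hs)
        rw [hT2, hG'.2, show k - 1 - 1 = k - 2 by omega, show N - 1 - k = N - k - 1 by omega] at this
        omega
      · push Not at hstar
        rcases (lnkF m F).eq_empty_or_nonempty with hl | hl
        · rw [hl, Finset.card_empty, zero_add]
          exact Nat.choose_le_choose _ (by omega)
        have hk3 := inter_pos (lnkF_sized (m := m) hF) lc hl hstar
        have := ih (k - 1) _ _ hT (by omega) (by omega) (lnkF_sized (m := m) hF) lc hstar
        rw [show k - 1 - 1 = k - 2 by omega, pas (N - (k - 1) - 1) (k - 2) (by omega) (by omega),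
          show N - (k - 1) - 1 - 1 = N - k - 1 by omega] at this
        have h1 : 0 < (N - k - 1).choose (k - 2 - 1) := Nat.choose_pos (by omega)
        omega
    have e1 := card_split m F
    rw [show N + 1 - k - 1 = N - k by omega, show N + 1 - 1 = N by omega,
      pas N (k - 1) (by omega) (by omega), pas (N - k) (k - 1) (by omega) (by omega),
      show k - 1 - 1 = k - 2 by omega]
    omega

theorem mainBound : ∀ (N k : ℕ) (S : Finset ℕ) (F : Finset (Finset ℕ)), S.card = N → 2 * k ≤ N →
    4 ≤ k → F ⊆ Finset.powersetCard k S → CrossF F F → (∀ x ∈ S, 2 ≤ (delF x F).card) →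
    F.card + (N - k - 1).choose (k - 1) + (N - k - 2).choose (k - 2)
      ≤ (N - 1).choose (k - 1) + 2 := by
  intro N
  induction N with
  | zero =>
    intro k S F hS hN hk
    omega
  | succ N ih =>
    intro k S F₀ hS hN hk hF₀ hc₀ hd₀
    rcases Nat.eq_or_lt_of_le hN with hN | hN
    · have := cross_base hF₀ hF₀ hc₀ (by omega)
      rw [hS, ← hN, choose_half (by omega)] at this
      rw [show N + 1 - k - 1 = k - 1 by omega, show N + 1 - k - 2 = k - 2 by omega,
        Nat.choose_self, Nat.choose_self, ← hN]
      omega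
    obtain ⟨m, hm⟩ : S.Nonempty := Finset.card_pos.1 (by omega)
    have hT : (S.erase m).card = N := by rw [Finset.card_erase_of_mem hm]; omega
    by_cases hbad : ∃ x ∈ S.erase m, (delF x (delF m F₀)).card ≤ 1
    · obtain ⟨x, hx, he⟩ := hbad
      have hxm := Finset.ne_of_mem_erase hx
      have hT2 : ((S.erase m).erase x).card = N - 1 := by rw [Finset.card_erase_of_mem hx, hT]
      have e1 := card_split m F₀
      have e2 := card_split x (delF m F₀)
      have e3 := card_split x (lnkF m F₀)
      have e4 := card_split m (delF x F₀)
      rw [del_comm, lnk_del_comm hxm] at e4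
      have c1 := hd₀ m hm
      have c2 := hd₀ x (Finset.mem_of_mem_erase hx)
      have s1 := lnkF_sized (m := x) (delF_sized (m := m) hF₀)
      have s2 := delF_sized (m := x) (lnkF_sized (m := m) hF₀)
      rw [show N + 1 - k - 1 = N - k by omega, show N + 1 - 1 = N by omega,
        show N + 1 - k - 2 = N - k - 1 by omega,
        pas N (k - 1) (by omega) (by omega), show k - 1 - 1 = k - 2 by omega]
      rcases Nat.eq_zero_or_pos (delF x (delF m F₀)).card with h0 | h0
      · have h1 := crossTwo (N - 1) (k - 1) _ _ _ hT2 (by omega) (by omega) s1 s2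
          (two_cross hxm hc₀) (by omega) (by omega)
        have h2 := Finset.card_le_card (lnkF_sized (m := x) (lnkF_sized (m := m) hF₀))
        rw [Finset.card_powersetCard, hT2, show k - 1 - 1 = k - 2 by omega] at h2
        rw [show N - 1 - (k - 1) = N - k by omega, show k - 1 - 1 = k - 2 by omega] at h1
        omega
      · have h1 := crossHM (N - 1) (k - 1) _ _ _ hT2 (by omega) s1 s2
          (two_cross hxm hc₀) (Finset.card_pos.1 (by omega)) (Finset.card_pos.1 (by omega))
        obtain ⟨G, hG⟩ := Finset.card_pos.1 h0
        have hG' := Finset.mem_powersetCard.1 (delF_sized (delF_sized hF₀) hG)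
        have hcr : CrossF (delF m F₀) (lnkF m F₀) := fun s hs t ht => by
          rw [Finset.inter_comm]; exact lnk_del_meet hc₀ hs ht
        have h2 := count1 (lnkF_sized (m := x) (lnkF_sized (m := m) hF₀)) hG'.1
          (fun s hs => lnk_del_meet hcr hG hs)
        rw [hT2, hG'.2, show k - 1 - 1 = k - 2 by omega, show N - 1 - k = N - k - 1 by omega] at h2
        rw [show N - 1 - (k - 1) = N - k by omega] at h1
        omega
    push Not at hbad
    obtain ⟨F, F', hF, -, hc, hFc, -, hsub, -, hst, -, hFF⟩ :=
      stabilize S k m (F₀.card + F₀.card) F₀ F₀ (by omega) hF₀ hF₀ hc₀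
    obtain rfl := hFF rfl
    have hdd : ∀ x ∈ S.erase m, 2 ≤ (delF x (delF m F)).card := by
      intro x hx
      have h1 := hbad x hx
      have h2 := Finset.card_le_card (Finset.filter_subset_filter (fun s => x ∉ s) hsub)
      exact le_trans h1 h2
    have D := ih k _ _ hT (by omega) hk (delF_sized (m := m) hF) (delF_cross hc) hdd
    have lc := lnkF_cross hF hF hc hst (by omega)
    have L : (lnkF m F).card + (N - k - 1).choose (k - 2) + (N - k - 2).choose (k - 3)
        ≤ (N - 1).choose (k - 2) := by
      by_cases hstar : ∃ x ∈ S.erase m, delF x (lnkF m F) = ∅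
      · obtain ⟨x, hx, he⟩ := hstar
        have hT2 : ((S.erase m).erase x).card = N - 1 := by rw [Finset.card_erase_of_mem hx, hT]
        have e3 := card_split x (lnkF m F)
        rw [he, Finset.card_empty] at e3
        obtain ⟨G, hG, G', hG', hne⟩ := Finset.one_lt_card.1 (hdd x hx)
        have hG1 := Finset.mem_powersetCard.1 (delF_sized (delF_sized hF) hG)
        have hG1' := Finset.mem_powersetCard.1 (delF_sized (delF_sized hF) hG')
        have hcr : CrossF (delF m F) (lnkF m F) := fun s hs t ht => by
          rw [Finset.inter_comm]; exact lnk_del_meet hc hs ht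
        have eK : k - 1 - 1 = k - 3 + 1 := by omega
        have := count2 (eK ▸ lnkF_sized (m := x) (lnkF_sized (m := m) hF)) hG1.1 hG1'.1 hG1.2
          hG1'.2 hne (fun s hs => lnk_del_meet hcr hG hs) (fun s hs => lnk_del_meet hcr hG' hs)
        rw [hT2, show k - 3 + 1 = k - 2 by omega, show N - 1 - k = N - k - 1 by omega,
          show N - k - 1 - 1 = N - k - 2 by omega] at this
        omega
      · push Not at hstar
        have := hiltonMilner N (k - 1) _ _ hT (by omega) (by omega) (lnkF_sized (m := m) hF) lc
          hstar
        rw [show k - 1 - 1 = k - 2 by omega, pas (N - (k - 1) - 1) (k - 2) (by omega) (by omega),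
          show N - (k - 1) - 1 - 1 = N - k - 1 by omega, show k - 2 - 1 = k - 3 by omega,
          pas (N - k - 1) (k - 3) (by omega) (by omega),
          show N - k - 1 - 1 = N - k - 2 by omega] at this
        have h1 : 0 < (N - k - 2).choose (k - 3 - 1) := Nat.choose_pos (by omega)
        omega
    have e1 := card_split m F
    rw [show N + 1 - k - 1 = N - k by omega, show N + 1 - 1 = N by omega,
      show N + 1 - k - 2 = N - k - 1 by omega,
      pas N (k - 1) (by omega) (by omega), pas (N - k) (k - 1) (by omega) (by omega),
      show k - 1 - 1 = k - 2 by omega]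
    have e2 := pas (N - k - 1) (k - 2) (by omega) (by omega)
    rw [show N - k - 1 - 1 = N - k - 2 by omega, show k - 2 - 1 = k - 3 by omega] at e2
    omega

theorem stmt1 (n k : ℕ) (hk : 4 ≤ k) (hn : 2 * k < n)
    (F : Finset (Finset ℕ)) (hF : F ⊆ Finset.powersetCard k (Finset.Icc 1 n))
    (hint : Intersecting F) (hdiv : 2 ≤ diversity n F) :
    (F.card : ℤ) ≤ ((n - 1).choose (k - 1) : ℤ) - ((n - k - 1).choose (k - 1) : ℤ)
      - ((n - k - 2).choose (k - 2) : ℤ) + 2 := by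
  have h := mainBound n k (Finset.Icc 1 n) F (by simp) (by omega) hk hF hint (by
    intro x hx
    refine le_trans hdiv (Nat.sInf_le ⟨x, ?_, rfl⟩)
    simpa using hx)
  have h' : (F.card : ℤ) + ((n - k - 1).choose (k - 1) : ℤ) + ((n - k - 2).choose (k - 2) : ℤ)
      ≤ ((n - 1).choose (k - 1) : ℤ) + 2 := by exact_mod_cast h
  linarith
end

section
/- Let n > 2k and k ≥ 5. If F is an intersecting family of k-element subsets of [n] with diversity γ(F) ≥ 2 and |F| = C(n−1,k−1) − C(n−k−1,k−1) − C(n−k−2,k−2) + 2, then F is isomorphic to J_2, i.e., some permutation of [n] maps F onto J_2. -/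
/-- `I_i = [i+1, k+i]`. -/
def Iset (k i : ℕ) : Finset ℕ := Finset.Icc (i + 1) (k + i)

/-- The family `J_i = {I_1, I_i} ∪ {F ∈ C([n],k) : 1 ∈ F, F ∩ I_1 ≠ ∅, F ∩ I_i ≠ ∅}`. -/
def Jfam (n k i : ℕ) : Finset (Finset ℕ) :=
  {Iset k 1, Iset k i} ∪
    (Finset.powersetCard k (Finset.Icc 1 n)).filter
      (fun A => 1 ∈ A ∧ (A ∩ Iset k 1).Nonempty ∧ (A ∩ Iset k i).Nonempty)

/-- Two families are isomorphic if some permutation of `[n]` maps one onto the other. -/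
def Isomorphic (n : ℕ) (F G : Finset (Finset ℕ)) : Prop :=
  ∃ σ : Equiv.Perm ℕ, (∀ x ∈ Finset.Icc 1 n, σ x ∈ Finset.Icc 1 n) ∧
    F.image (fun A => A.image σ) = G

section Helpers

open Finset

/-- all `s`-subsets of members of a family -/
def sh {α : Type*} [DecidableEq α] (s : ℕ) (C : Finset (Finset α)) : Finset (Finset α) :=
  C.biUnion (fun A => A.powersetCard s)

theorem mem_sh {α : Type*} [DecidableEq α] {s : ℕ} {C : Finset (Finset α)} {T : Finset α} :
    T ∈ sh s C ↔ ∃ A ∈ C, T ⊆ A ∧ T.card = s := by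
  simp [sh, mem_powersetCard]

theorem sh_mono {α : Type*} [DecidableEq α] {s : ℕ} {C D : Finset (Finset α)} (h : C ⊆ D) :
    sh s C ⊆ sh s D := by
  intro T hT
  rw [mem_sh] at *
  obtain ⟨A, hA, h1⟩ := hT
  exact ⟨A, h hA, h1⟩

theorem sh_eq_shadow {α : Type*} [DecidableEq α] {r s : ℕ} (hs : s ≤ r) (C : Finset (Finset α))
    (hC : ∀ A ∈ C, A.card = r) : sh s C = Finset.shadow^[r - s] C := by
  ext T
  rw [mem_sh, mem_shadow_iterate_iff_exists_mem_card_add]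
  constructor
  · rintro ⟨A, hA, h1, h2⟩
    exact ⟨A, hA, h1, by rw [hC A hA]; omega⟩
  · rintro ⟨A, hA, h1, h2⟩
    exact ⟨A, hA, h1, by rw [hC A hA] at h2; omega⟩

theorem exists_initSeg_card (N r : ℕ) : ∀ b : ℕ, b ≤ N.choose r →
    ∃ C : Finset (Finset (Fin N)), Colex.IsInitSeg C r ∧ C.card = b := by
  intro b
  induction b with
  | zero => intro _; exact ⟨∅, by simp, by simp⟩
  | succ b ih =>
    intro hb
    obtain ⟨C, hC, hCb⟩ := ih (by omega)
    have hsub : C ⊆ powersetCard r univ := by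
      intro A hA
      rw [mem_powersetCard]
      exact ⟨subset_univ _, hC.1 hA⟩
    have hne : (powersetCard r (univ : Finset (Fin N)) \ C).Nonempty := by
      rw [← card_pos, card_sdiff_of_subset hsub, card_powersetCard, card_univ, Fintype.card_fin]
      omega
    obtain ⟨S, hS, hmin⟩ := exists_min_image _ (fun A => toColex A) hne
    rw [mem_sdiff, mem_powersetCard] at hS
    refine ⟨insert S C, ⟨?_, ?_⟩, by rw [card_insert_of_notMem hS.2, hCb]⟩
    · intro A hA
      rw [mem_coe, mem_insert] at hA
      rcases hA with rfl | hA
      · exact hS.1.2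
      · exact hC.1 hA
    · intro A T hA hT
      rw [mem_insert] at hA ⊢
      right
      rcases hA with rfl | hA
      · by_contra hTC
        exact absurd (hmin T (by rw [mem_sdiff, mem_powersetCard]; exact ⟨⟨subset_univ _, hT.2⟩, hTC⟩))
          (not_le.2 hT.1)
      · exact hC.2 hA hT

theorem isInitSeg_lt (N r y : ℕ) :
    Colex.IsInitSeg (powersetCard r (univ.filter (fun i : Fin N => (i : ℕ) < y))) r := by
  refine ⟨Set.sized_powersetCard _ _, ?_⟩
  intro A T hA hT
  rw [mem_powersetCard] at hA ⊢
  refine ⟨?_, hT.2⟩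
  intro t ht
  rw [mem_filter]
  refine ⟨mem_univ _, ?_⟩
  rcases Nat.lt_or_ge (t : ℕ) y with h | h
  · exact h
  · exfalso
    have hN : y < N := lt_of_le_of_lt h t.2
    have := Colex.forall_lt_mono (a := (⟨y, hN⟩ : Fin N)) hT.1.le (fun b hb => by
      have := hA.1 hb
      rw [mem_filter] at this
      exact this.2) t ht
    exact absurd (Fin.lt_def.1 this) (by simp; omega)

theorem sh_map {α β : Type*} [DecidableEq α] [DecidableEq β] (f : α ↪ β) (s : ℕ)
    (C : Finset (Finset α)) :
    (sh s (C.map (mapEmbedding f).toEmbedding)).card = (sh s C).card := by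
  rw [← card_map (mapEmbedding f).toEmbedding (s := sh s C)]
  congr 1
  ext T
  simp only [mem_sh, mem_map, RelEmbedding.coe_toEmbedding, mapEmbedding_apply]
  constructor
  · rintro ⟨A, ⟨A', hA', rfl⟩, h1, h2⟩
    obtain ⟨u, hu, rfl⟩ := subset_map_iff.1 h1
    exact ⟨u, ⟨A', hA', hu, by simpa using h2⟩, rfl⟩
  · rintro ⟨u, ⟨A', hA', hu, h2⟩, rfl⟩
    exact ⟨A'.map f, ⟨A', hA', rfl⟩, map_subset_map.2 hu, by simpa using h2⟩

theorem card_filter_lt {N y : ℕ} (h : y ≤ N) :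
    (univ.filter (fun i : Fin N => (i : ℕ) < y)).card = y := by
  have : (univ.filter (fun i : Fin N => (i : ℕ) < y)).map Fin.valEmbedding = range y := by
    ext a
    simp only [mem_map, mem_filter, mem_univ, true_and, Fin.valEmbedding_apply, mem_range]
    constructor
    · rintro ⟨b, hb, rfl⟩; exact hb
    · intro ha; exact ⟨⟨a, by omega⟩, ha, rfl⟩
  rw [← card_map Fin.valEmbedding, this, card_range]

theorem map_filter_lt {N y : ℕ} (h : y ≤ N) :
    (univ.filter (fun i : Fin N => (i : ℕ) < y)).map Fin.valEmbedding = range y := by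
  ext a
  simp only [mem_map, mem_filter, mem_univ, true_and, Fin.valEmbedding_apply, mem_range]
  constructor
  · rintro ⟨b, hb, rfl⟩; exact hb
  · intro ha; exact ⟨⟨a, by omega⟩, ha, rfl⟩

/-- Kruskal–Katona in the form used here. -/
theorem kk_basic {r s : ℕ} (hs : s ≤ r) (y : ℕ) (C : Finset (Finset ℕ))
    (hC : ∀ A ∈ C, A.card = r) :
    ∃ C' : Finset (Finset ℕ), (∀ A ∈ C', A.card = r) ∧ C'.card = C.card ∧
      (sh s C').card ≤ (sh s C).card ∧
      (C.card ≤ y.choose r → C' ⊆ powersetCard r (range y)) ∧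
      (y.choose r ≤ C.card → powersetCard r (range y) ⊆ C') ∧
      (C.card ≤ (y+1).choose r → C' ⊆ powersetCard r (range (y+1))) := by
  obtain ⟨N, hyN, hN⟩ : ∃ N, y + 1 ≤ N ∧ ∀ A ∈ C, A ⊆ range N := by
    refine ⟨max (y+1) ((C.biUnion id).sup id + 1), le_max_left _ _, ?_⟩
    intro A hA a ha
    rw [mem_range]
    have : a ≤ (C.biUnion id).sup id :=
      le_sup (f := id) (mem_biUnion.2 ⟨A, hA, ha⟩)
    exact lt_of_lt_of_le (Nat.lt_succ_of_le this) (le_max_right _ _)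
  let e := (mapEmbedding (Fin.valEmbedding (n := N))).toEmbedding
  obtain ⟨A, hA⟩ : ∃ A : Finset (Finset (Fin N)), A.map e = C := by
    have : C ⊆ (univ : Finset (Finset (Fin N))).map e := by
      intro B hB
      have h1 := hN B hB
      rw [← map_filter_lt (le_refl N)] at h1
      obtain ⟨u, hu, rfl⟩ := subset_map_iff.1 h1
      exact mem_map.2 ⟨u, mem_univ _, rfl⟩
    obtain ⟨u, hu, h⟩ := subset_map_iff.1 this
    exact ⟨u, h.symm⟩
  have hAr : ∀ B ∈ A, B.card = r := by
    intro B hB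
    have := hC (e B) (by rw [← hA]; exact mem_map_of_mem _ hB)
    simpa [e] using this
  have hcard : C.card = A.card := by rw [← hA, card_map]
  have hle : C.card ≤ N.choose r := by
    rw [hcard]
    calc A.card ≤ (powersetCard r (univ : Finset (Fin N))).card :=
          card_le_card (fun B hB => mem_powersetCard.2 ⟨subset_univ _, hAr B hB⟩)
      _ = _ := by simp
  obtain ⟨I, hI, hIc⟩ := exists_initSeg_card N r C.card hle
  have key : ∀ z, z ≤ N → (powersetCard r (univ.filter (fun i : Fin N => (i : ℕ) < z))).map e
      = powersetCard r (range z) := by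
    intro z hz
    rw [← map_filter_lt hz, powersetCard_map]
  have up : ∀ z, z ≤ N → C.card ≤ z.choose r → I.map e ⊆ powersetCard r (range z) := by
    intro z hz hc
    rw [← key z hz, map_subset_map]
    rcases hI.total (isInitSeg_lt N r z) with h | h
    · exact h
    · rw [eq_of_subset_of_card_le h (by rw [hIc, card_powersetCard, card_filter_lt hz]; exact hc)]
  refine ⟨I.map e, ?_, by rw [card_map, hIc], ?_, up y (by omega), ?_, up (y+1) hyN⟩
  · intro B hB
    obtain ⟨B', hB', rfl⟩ := mem_map.1 hB
    have := hI.1 hB'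
    simpa [e] using this
  · rw [sh_map, ← hA, sh_map, sh_eq_shadow hs I (fun B hB => hI.1 hB), sh_eq_shadow hs A hAr]
    exact iterated_kk (r := r) (fun B hB => hAr B hB) (by rw [hIc, hcard]) hI
  · intro hc
    rw [← key y (by omega), map_subset_map]
    rcases hI.total (isInitSeg_lt N r y) with h | h
    · rw [eq_of_subset_of_card_le h (by
        rw [hIc, card_powersetCard, card_filter_lt (by omega)]; exact hc)]
    · exact h

/-- local LYM -/
theorem lym {r s y : ℕ} (hs : s ≤ r) (hr : r ≤ y) (C : Finset (Finset ℕ))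
    (hC : C ⊆ powersetCard r (range y)) :
    C.card * y.choose s ≤ (sh s C).card * y.choose r := by
  have h := card_mul_le_card_mul (s := C) (t := sh s C) (fun A T => T ⊆ A)
    (m := r.choose s) (n := (y - s).choose (r - s)) ?_ ?_
  · have e := Nat.choose_mul (n := y) (k := r) (s := s) hs
    have hpos : 0 < r.choose s := Nat.choose_pos hs
    have hpos2 : 0 < (y - s).choose (r - s) := Nat.choose_pos (by omega)
    apply Nat.le_of_mul_le_mul_right _ hpos2
    calc C.card * y.choose s * (y-s).choose (r-s) = C.card * (y.choose s * (y-s).choose (r-s)) := by ring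
      _ = (C.card * r.choose s) * y.choose r := by rw [← e]; ring
      _ ≤ ((sh s C).card * (y-s).choose (r-s)) * y.choose r := Nat.mul_le_mul_right _ h
      _ = _ := by ring
  · intro A hA
    have : (powersetCard s A) ⊆ bipartiteAbove (fun A T => T ⊆ A) (sh s C) A := by
      intro T hT
      rw [mem_powersetCard] at hT
      rw [mem_bipartiteAbove, mem_sh]
      exact ⟨⟨A, hA, hT⟩, hT.1⟩
    have h2 := card_le_card this
    rwa [card_powersetCard, (mem_powersetCard.1 (hC hA)).2] at h2
  · intro T hT
    obtain ⟨A, hA, hTA, hTs⟩ := mem_sh.1 hT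
    have hTy : T ⊆ range y := hTA.trans (mem_powersetCard.1 (hC hA)).1
    have : (bipartiteBelow (fun A T => T ⊆ A) C T).card ≤ (powersetCard (r - s) (range y \ T)).card := by
      apply card_le_card_of_injOn (fun A => A \ T)
      · intro B hB
        rw [mem_coe, mem_bipartiteBelow] at hB
        have := mem_powersetCard.1 (hC hB.1)
        rw [mem_coe, mem_powersetCard]
        exact ⟨sdiff_subset_sdiff this.1 (le_refl _), by rw [card_sdiff_of_subset hB.2, this.2, hTs]⟩
      · intro B hB B' hB' h
        rw [mem_coe, mem_bipartiteBelow] at hB hB'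
        simp only at h
        rw [← sdiff_union_of_subset hB.2, h, sdiff_union_of_subset hB'.2]
    rwa [card_powersetCard, card_sdiff_of_subset hTy, card_range, hTs] at this

/-- normalized matching form of KK -/
theorem kk_nm {r s y : ℕ} (hs : s ≤ r) (hr : r ≤ y) (C : Finset (Finset ℕ))
    (hC : ∀ A ∈ C, A.card = r) (hc : C.card ≤ y.choose r) :
    C.card * y.choose s ≤ (sh s C).card * y.choose r := by
  obtain ⟨C', h1, h2, h3, h4, -⟩ := kk_basic hs y C hC
  have := lym hs hr C' (h4 hc)
  rw [h2] at this
  exact this.trans (Nat.mul_le_mul_right _ h3)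

/-- recursive form of KK -/
theorem kk_step {r s y c : ℕ} (hs : s ≤ r) (hy : r + 1 ≤ y) (C : Finset (Finset ℕ))
    (hC : ∀ A ∈ C, A.card = r + 1) (hc : C.card = y.choose (r+1) + c) (hcy : c ≤ y.choose r) :
    ∃ C' : Finset (Finset ℕ), (∀ A ∈ C', A.card = r) ∧ C'.card = c ∧
      y.choose (s+1) + (sh s C').card ≤ (sh (s+1) C).card := by
  obtain ⟨I, h1, h2, h3, -, h5, h6⟩ := kk_basic (s := s + 1) (by omega) y C hC
  have h5 := h5 (by omega)
  have h6 := h6 (by have := Nat.choose_succ_succ' y r; omega)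
  have hmem : ∀ A ∈ I \ powersetCard (r+1) (range y), y ∈ A := by
    intro A hA
    rw [mem_sdiff] at hA
    by_contra hy
    apply hA.2
    have := mem_powersetCard.1 (h6 hA.1)
    rw [mem_powersetCard]
    refine ⟨?_, this.2⟩
    intro a ha
    have h7 := this.1 ha
    rw [mem_range] at *
    have : a ≠ y := fun h => hy (h ▸ ha)
    omega
  refine ⟨(I \ powersetCard (r+1) (range y)).image (fun A => A.erase y), ?_, ?_, ?_⟩
  · intro B hB
    obtain ⟨A, hA, rfl⟩ := mem_image.1 hB
    rw [card_erase_of_mem (hmem A hA), h1 A (mem_sdiff.1 hA).1]; rfl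
  · rw [card_image_of_injOn, card_sdiff_of_subset h5, h2, hc, card_powersetCard, card_range]
    · omega
    · intro A hA B hB h
      simp only at h
      rw [← insert_erase (hmem A hA), h, insert_erase (hmem B hB)]
  · set C' := (I \ powersetCard (r+1) (range y)).image (fun A => A.erase y) with hC'
    have hnot : ∀ T ∈ sh s C', y ∉ T := by
      intro T hT hy
      obtain ⟨B, hB, hTB, -⟩ := mem_sh.1 hT
      obtain ⟨A, hA, rfl⟩ := mem_image.1 hB
      exact absurd (hTB hy) (by simp)
    refine le_trans ?_ h3
    have hsub : powersetCard (s+1) (range y) ∪ (sh s C').image (insert y) ⊆ sh (s+1) I := by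
      intro T hT
      rw [mem_union] at hT
      rw [mem_sh]
      rcases hT with hT | hT
      · rw [mem_powersetCard] at hT
        obtain ⟨A, hA1, hA2, hA3⟩ :=
          exists_subsuperset_card_eq hT.1 (n := r + 1) (by omega) (by simpa using hy)
        exact ⟨A, h5 (mem_powersetCard.2 ⟨hA2, hA3⟩), hA1, hT.2⟩
      · obtain ⟨S, hS, rfl⟩ := mem_image.1 hT
        have hyS := hnot S hS
        obtain ⟨B, hB, hTB, h8⟩ := mem_sh.1 hS
        obtain ⟨A, hA, rfl⟩ := mem_image.1 hB
        refine ⟨A, (mem_sdiff.1 hA).1, ?_, by rw [card_insert_of_notMem hyS, h8]⟩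
        rw [insert_subset_iff]
        exact ⟨hmem A hA, hTB.trans (erase_subset _ _)⟩
    refine le_trans (le_of_eq ?_) (card_le_card hsub)
    rw [card_union_of_disjoint, card_powersetCard, card_range, card_image_of_injOn]
    · intro A hA B hB h
      rw [← erase_insert (hnot A hA), h, erase_insert (hnot B hB)]
    · rw [disjoint_left]
      intro T hT hT2
      obtain ⟨S, hS, rfl⟩ := mem_image.1 hT2
      have := (mem_powersetCard.1 hT).1 (mem_insert_self y S)
      simp at this

theorem choose_le_aux {y a b : ℕ} (hab : a ≤ b) (h : a + b ≤ y) : y.choose a ≤ y.choose b := by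
  have key : ∀ c, a ≤ c → 2 * c ≤ y → y.choose a ≤ y.choose c := by
    intro c hc
    induction c, hc using Nat.le_induction with
    | base => intro _; exact le_refl _
    | succ c hc ih =>
      intro h2
      exact (ih (by omega)).trans (Nat.choose_le_succ_of_lt_half_left (by omega))
  rcases Nat.le_total (2 * b) y with h1 | h1
  · exact key b hab h1
  · rw [← Nat.choose_symm (show b ≤ y by omega)]
    exact key (y - b) (by omega) (by omega)

theorem piece_three {R S : ℕ} (hS : S ≤ R) (h3 : 3 ≤ S) (C : Finset (Finset ℕ))
    (hC : ∀ A ∈ C, A.card = R + 1) (hc : C.card = 3) :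
    (R+1).choose (S+1) + R.choose S + (R-1).choose (S-1) ≤ (sh (S+1) C).card := by
  obtain ⟨R, rfl⟩ : ∃ R', R = R' + 3 := ⟨R - 3, by omega⟩
  obtain ⟨S, rfl⟩ : ∃ S', S = S' + 3 := ⟨S - 3, by omega⟩
  obtain ⟨C1, h1, h2, h3⟩ := kk_step (y := R + 4) (c := 2) hS le_rfl C hC (by simp [hc]) (by simp)
  obtain ⟨C2, h4, h5, h6⟩ := kk_step (r := R + 2) (s := S + 2) (y := R + 3) (c := 1) (by omega) le_rfl
    C1 h1 (by simp [h2]) (by simp)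
  obtain ⟨C3, h7, h8, h9⟩ := kk_step (r := R + 1) (s := S + 1) (y := R + 2) (c := 0) (by omega) le_rfl
    C2 h4 (by simp [h5]) (by simp)
  simp only [show R + 3 - 1 = R + 2 by omega, show S + 3 - 1 = S + 2 by omega,
    Nat.add_assoc, Nat.reduceAdd] at *
  omega

theorem piece_four {R S : ℕ} (hS : S ≤ R) (h3 : 3 ≤ S) (C : Finset (Finset ℕ))
    (hC : ∀ A ∈ C, A.card = R + 1) (hc : 4 ≤ C.card) :
    (R+1).choose (S+1) + R.choose S + (R-1).choose (S-1) + (R-2).choose (S-2)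
      ≤ (sh (S+1) C).card := by
  obtain ⟨C0, hsub, hc0⟩ := exists_subset_card_eq hc
  refine le_trans ?_ (card_le_card (sh_mono hsub))
  obtain ⟨R, rfl⟩ : ∃ R', R = R' + 3 := ⟨R - 3, by omega⟩
  obtain ⟨S, rfl⟩ : ∃ S', S = S' + 3 := ⟨S - 3, by omega⟩
  obtain ⟨C1, h1, h2, h3⟩ := kk_step (y := R + 4) (c := 3) hS le_rfl C0
    (fun A hA => hC A (hsub hA)) (by simp [hc0]) (by simp)
  obtain ⟨C2, h4, h5, h6⟩ := kk_step (r := R + 2) (s := S + 2) (y := R + 3) (c := 2) (by omega) le_rfl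
    C1 h1 (by simp [h2]) (by simp)
  obtain ⟨C3, h7, h8, h9⟩ := kk_step (r := R + 1) (s := S + 1) (y := R + 2) (c := 1) (by omega) le_rfl
    C2 h4 (by simp [h5]) (by simp)
  obtain ⟨C4, h10, h11, h12⟩ := kk_step (r := R) (s := S) (y := R + 1) (c := 0) (by omega) le_rfl
    C3 h7 (by simp [h8]) (by simp)
  simp only [show R + 3 - 1 = R + 2 by omega, show S + 3 - 1 = S + 2 by omega,
    show R + 3 - 2 = R + 1 by omega, show S + 3 - 2 = S + 1 by omega, Nat.add_assoc, Nat.reduceAdd] at *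
  omega

/-- one interval of the cascade -/
theorem piece_mid {R S i : ℕ} (hS : S ≤ R) (hi : i + 1 ≤ S) (C : Finset (Finset ℕ))
    (hC : ∀ A ∈ C, A.card = R + 1) (h1 : (R+1+i).choose (R+1) ≤ C.card)
    (h2 : C.card ≤ (R+1+i+1).choose (R+1)) :
    C.card + (R+1+i).choose (S+1) ≤ (sh (S+1) C).card + (R+1+i).choose (R+1) := by
  obtain ⟨c, hc⟩ := Nat.exists_eq_add_of_le h1
  have hcy : c ≤ (R+1+i).choose R := by
    have := Nat.choose_succ_succ' (R+1+i) R
    omega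
  obtain ⟨C1, h3, h4, h5⟩ := kk_step hS (by omega) C hC hc hcy
  have h6 := kk_nm (y := R+1+i) hS (by omega) C1 h3 (by omega)
  have h7 : (R+1+i).choose R ≤ (R+1+i).choose S := by
    rw [← Nat.choose_symm (show R ≤ R+1+i by omega)]
    exact choose_le_aux (by omega) (by omega)
  have hpos : 0 < (R+1+i).choose R := Nat.choose_pos (by omega)
  have h8 : c ≤ (sh S C1).card := by
    apply Nat.le_of_mul_le_mul_right _ hpos
    rw [h4] at h6
    exact (Nat.mul_le_mul_left _ h7).trans h6
  omega

theorem g_mono {R S : ℕ} (hS : S ≤ R) : ∀ i, 1 ≤ i → i ≤ S →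
    (R+2).choose (S+1) + (R+1+i).choose (R+1) ≤ (R+1+i).choose (S+1) + (R+2) := by
  intro i hi
  induction i, hi using Nat.le_induction with
  | base =>
    intro _
    have : (R+1+1).choose (R+1) = R + 2 := by
      rw [Nat.choose_succ_self_right]
    rw [this]
  | succ i hi ih =>
    intro h
    have h1 := ih (by omega)
    have h2 := Nat.choose_succ_succ' (R+1+i) R
    have h3 := Nat.choose_succ_succ' (R+1+i) S
    have h7 : (R+1+i).choose R ≤ (R+1+i).choose S := by
      rw [← Nat.choose_symm (show R ≤ R+1+i by omega)]
      exact choose_le_aux (by omega) (by omega)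
    rw [← add_assoc]
    omega

theorem piece_B {R S : ℕ} (hS : S ≤ R) (h2S : 2 ≤ S) (C : Finset (Finset ℕ))
    (hC : ∀ A ∈ C, A.card = R + 1) (hb : R + 2 ≤ C.card) : ∀ i, 1 ≤ i → i ≤ S →
    C.card ≤ (R+1+i).choose (R+1) →
    C.card + (R+2).choose (S+1) ≤ (sh (S+1) C).card + (R + 2) := by
  intro i hi
  induction i, hi using Nat.le_induction with
  | base =>
    intro _ h
    have e : (R+1+1).choose (R+1) = R + 2 := by
      rw [Nat.choose_succ_self_right]
    have := piece_mid hS (i := 1) (by omega) C hC (by omega)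
      (h.trans (Nat.choose_le_choose _ (by omega)))
    simp only [show R + 1 + 1 = R + 2 by omega] at *
    omega
  | succ i hi ih =>
    intro h h1
    rcases Nat.le_total C.card ((R+1+i).choose (R+1)) with h2 | h2
    · exact ih (by omega) h2
    · have := piece_mid hS (i := i) (by omega) C hC h2 h1
      have := g_mono hS i hi (by omega)
      omega

theorem piece_C {R S : ℕ} (hS : S ≤ R) (h2S : 2 ≤ S) (C : Finset (Finset ℕ))
    (hC : ∀ A ∈ C, A.card = R + 1) (h1 : (R+1+S).choose (R+1) ≤ C.card)
    (h2 : C.card ≤ (R+1+S).choose (R+1) + (R+S).choose R) :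
    C.card + (R+2).choose (S+1) ≤ (sh (S+1) C).card + (R + 2) := by
  obtain ⟨c, hc⟩ := Nat.exists_eq_add_of_le h1
  have hle : (R+S).choose R ≤ (R+1+S).choose R := Nat.choose_le_choose _ (by omega)
  obtain ⟨C1, h3, h4, h5⟩ := kk_step hS (by omega) C hC hc (by omega)
  have h6 := kk_nm (y := R+S) hS (by omega) C1 h3 (by omega)
  have h7 : (R+S).choose R = (R+S).choose S := by
    rw [← Nat.choose_symm (show R ≤ R+S by omega)]
    congr 1; omega
  have hpos : 0 < (R+S).choose R := Nat.choose_pos (by omega)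
  have h8 : c ≤ (sh S C1).card := by
    apply Nat.le_of_mul_le_mul_right _ hpos
    rw [h4, ← h7] at h6
    exact h6
  have := g_mono hS S (by omega) le_rfl
  omega

/-- the numerical inequality, `k = t+5`, `n-1 = u+2t+10`. -/
theorem numeric (u t : ℕ) :
    ((((u+t+5).choose (t+4) + (u+t+4).choose (t+3) : ℕ) : ℚ)) *
      ((u+2*t+7).choose (t+4) + (u+2*t+7).choose (t+2)) ≤
    (((u+2*t+7).choose (t+4) : ℚ) - (u+2*t+7).choose (t+2)) *
     (((u+2*t+7).choose (t+4) : ℚ) + (u+2*t+7).choose (t+3)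
      - (u+2*t+7).choose (t+2) - (u+2*t+7).choose (t+1)) := by
  have a1 : ((u+2*t+7).choose (t+4) : ℚ) * (t+4) = (u+2*t+7).choose (t+3) * (u+t+4) := by
    have := Nat.choose_succ_right_eq (u+2*t+7) (t+3)
    rw [show u+2*t+7-(t+3) = u+t+4 by omega] at this
    exact_mod_cast this
  have a2 : ((u+2*t+7).choose (t+3) : ℚ) * (t+3) = (u+2*t+7).choose (t+2) * (u+t+5) := by
    have := Nat.choose_succ_right_eq (u+2*t+7) (t+2)
    rw [show u+2*t+7-(t+2) = u+t+5 by omega] at this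
    exact_mod_cast this
  have a3 : ((u+2*t+7).choose (t+2) : ℚ) * (t+2) = (u+2*t+7).choose (t+1) * (u+t+6) := by
    have := Nat.choose_succ_right_eq (u+2*t+7) (t+1)
    rw [show u+2*t+7-(t+1) = u+t+6 by omega] at this
    exact_mod_cast this
  have a4 : ((u+t+5).choose (t+4) : ℚ) * (t+4) = (u+t+5) * (u+t+4).choose (t+3) := by
    have := Nat.add_one_mul_choose_eq (u+t+4) (t+3)
    have h : (u+t+5) * (u+t+4).choose (t+3) = (u+t+5).choose (t+4) * (t+4) := this
    exact_mod_cast h.symm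
  have a5 : ((u+2*t+8).choose (t+3) : ℚ) * (u+t+5) = (u+2*t+7).choose (t+3) * (u+2*t+8) := by
    have := Nat.choose_mul_succ_eq (u+2*t+7) (t+3)
    rw [show u+2*t+7+1-(t+3) = u+t+5 by omega] at this
    exact_mod_cast this.symm
  have a6 : ∀ N : ℕ, t ≤ N → ((N+3).choose (t+3) : ℚ) * ((t+3)*(t+2)*(t+1)) =
      (N+3).choose t * ((N+3-t)*(N+2-t)*(N+1-t)) := by
    intro N hN
    have h1 := Nat.choose_succ_right_eq (N+3) (t+2)
    have h2 := Nat.choose_succ_right_eq (N+3) (t+1)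
    have h3 := Nat.choose_succ_right_eq (N+3) (t)
    obtain ⟨d, rfl⟩ := Nat.exists_eq_add_of_le hN
    rw [show t+d+3-(t+2) = d+1 by omega] at h1
    rw [show t+d+3-(t+1) = d+2 by omega] at h2
    rw [show t+d+3-t = d+3 by omega] at h3
    have h1' : ((t+d+3).choose (t+3) : ℚ) * (t+3) = (t+d+3).choose (t+2) * (d+1) := by
      exact_mod_cast h1
    have h2' : ((t+d+3).choose (t+2) : ℚ) * (t+2) = (t+d+3).choose (t+1) * (d+2) := by
      exact_mod_cast h2
    have h3' : ((t+d+3).choose (t+1) : ℚ) * (t+1) = (t+d+3).choose t * (d+3) := by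
      exact_mod_cast h3
    push_cast
    linear_combination (t+2:ℚ)*(t+1)*h1' + (d+1:ℚ)*(t+1) * h2' + (d+1:ℚ)*(d+2)*h3'
  have a7 : ((u+t+6:ℚ)*(u+t+7)*(u+t+8)) * (u+t+4).choose (t+3) ≤
      (u+2*t+8).choose (t+3) * ((u+2)*(u+3)*(u+4)) := by
    have b1 := a6 (u+t+1) (by omega)
    have b2 := a6 (u+2*t+5) (by omega)
    have b3 : ((u+t+4).choose t : ℚ) ≤ (u+2*t+8).choose t := by
      exact_mod_cast Nat.choose_le_choose t (by omega)
    push_cast at b1 b2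
    rw [show u+t+1+3 = u+t+4 by ring] at b1
    rw [show u+2*t+5+3 = u+2*t+8 by ring] at b2
    have hp : (0:ℚ) < (t+3)*(t+2)*(t+1) := by positivity
    refine le_of_mul_le_mul_right ?_ hp
    calc ((u+t+6:ℚ)*(u+t+7)*(u+t+8)) * (u+t+4).choose (t+3) * ((t+3)*(t+2)*(t+1))
        = ((u+t+6:ℚ)*(u+t+7)*(u+t+8)) * ((u+2)*(u+3)*(u+4)) * (u+t+4).choose t := by
          linear_combination ((u+t+6:ℚ)*(u+t+7)*(u+t+8)) * b1
      _ ≤ ((u+t+6:ℚ)*(u+t+7)*(u+t+8)) * ((u+2)*(u+3)*(u+4)) * (u+2*t+8).choose t := by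
          gcongr
      _ = _ := by linear_combination (-((u+2)*(u+3)*(u+4):ℚ)) * b2
  push_cast
  generalize ((u+2*t+7).choose (t+4) : ℚ) = P at *
  generalize ((u+2*t+7).choose (t+2) : ℚ) = Q at *
  generalize ((u+2*t+7).choose (t+1) : ℚ) = S at *
  have hR : (0:ℚ) ≤ (u+2*t+7).choose (t+3) := by positivity
  generalize ((u+2*t+7).choose (t+3) : ℚ) = R at *
  generalize ((u+2*t+8).choose (t+3) : ℚ) = E at *
  generalize ((u+t+5).choose (t+4) : ℚ) = W1 at *
  generalize ((u+t+4).choose (t+3) : ℚ) = w at *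
  clear a6
  have hu : (0:ℚ) ≤ u := by positivity
  have ht : (0:ℚ) ≤ t := by positivity
  generalize (u:ℚ) = u at *
  generalize (t:ℚ) = t at *
  obtain ⟨l, hl, rfl⟩ : ∃ l : ℚ, 0 ≤ l ∧ R = l * ((t+4)*(u+t+5)*(u+t+6)) :=
    ⟨R / ((t+4)*(u+t+5)*(u+t+6)), by positivity, by field_simp⟩
  have hP : P = l * ((u+t+4)*(u+t+5)*(u+t+6)) := by
    have : (t+4) ≠ 0 := by positivity
    apply mul_right_cancel₀ this; linear_combination a1
  have hQ : Q = l * ((t+4)*(t+3)*(u+t+6)) := by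
    have : (u+t+5) ≠ 0 := by positivity
    apply mul_right_cancel₀ this; linear_combination -a2
  subst hQ hP
  have hS : S = l * ((t+4)*(t+3)*(t+2)) := by
    have : (u+t+6) ≠ 0 := by positivity
    apply mul_right_cancel₀ this; linear_combination -a3
  have hE : E = l * ((t+4)*(u+t+6)*(u+2*t+8)) := by
    have : (u+t+5) ≠ 0 := by positivity
    apply mul_right_cancel₀ this; linear_combination a5
  subst hS hE
  have hW : (W1 + w) * ((u+t+7)*(u+t+8)) ≤ l * ((u+2*t+9)*(u+2*t+8)*(u+2)*(u+3)*(u+4)) := by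
    have : 0 < (t+4)*(u+t+6) := by positivity
    refine le_of_mul_le_mul_right ?_ this
    have h2 := mul_le_mul_of_nonneg_left a7 (show 0 ≤ u+2*t+9 by positivity)
    calc (W1 + w) * ((u+t+7)*(u+t+8)) * ((t+4)*(u+t+6))
        = (u+2*t+9) * ((u+t+6)*(u+t+7)*(u+t+8)*w) := by
          linear_combination ((u+t+7)*(u+t+8)*(u+t+6)) * a4
      _ ≤ _ := h2
      _ = _ := by ring
  have hp : 0 < (u+t+7)*(u+t+8) := by positivity
  refine le_of_mul_le_mul_right ?_ hp
  have key : (u+3)*(u+4)*((u+t+5)*(u+t+4)+(t+4)*(t+3)) ≤ (u+1)*(u+2*t+8)*(u+t+7)*(u+t+8) := by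
    rw [← sub_nonneg]
    ring_nf
    positivity
  have hX : 0 ≤ (u+t+6)*((u+t+5)*(u+t+4)+(t+4)*(t+3)) := by positivity
  calc _ = ((W1 + w) * ((u+t+7)*(u+t+8))) * (l * ((u+t+6)*((u+t+5)*(u+t+4)+(t+4)*(t+3)))) := by ring
    _ ≤ (l * ((u+2*t+9)*(u+2*t+8)*(u+2)*(u+3)*(u+4))) *
        (l * ((u+t+6)*((u+t+5)*(u+t+4)+(t+4)*(t+3)))) := by gcongr
    _ = (l*l*(u+2*t+9)*(u+2*t+8)*(u+2)*(u+t+6)) *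
         ((u+3)*(u+4)*((u+t+5)*(u+t+4)+(t+4)*(t+3))) := by ring
    _ ≤ (l*l*(u+2*t+9)*(u+2*t+8)*(u+2)*(u+t+6)) *
         ((u+1)*(u+2*t+8)*(u+t+7)*(u+t+8)) := by gcongr
    _ = _ := by ring

theorem q_contra (P Q R S W c D : ℚ) (g1 : P + D + 2 ≤ Q + c + W)
    (g2 : 2 * c + W + R ≤ P + Q + S + 4) (g3 : c * Q ≤ D * P) (g4 : 0 < Q) (g5 : Q ≤ P)
    (num : W * (P + Q) ≤ (P - Q) * (P + R - Q - S)) : False := by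
  have g6 : 0 < P := lt_of_lt_of_le g4 g5
  have m1 := mul_le_mul_of_nonneg_right g1 g6.le
  have k2 : (P - Q) * (P + R - Q - S + (W - 4)) ≤ (P - Q) * (2 * (P - c)) :=
    mul_le_mul_of_nonneg_left (by linarith) (by linarith)
  linarith

theorem piece_D (u t : ℕ) (C : Finset (Finset ℕ))
    (hC : ∀ A ∈ C, A.card = u + t + 5)
    (h1 : (u+2*t+8).choose (t+3) + (u+2*t+7).choose (t+3) ≤ C.card)
    (h2 : 2 * C.card + ((u+t+5).choose (t+4) + (u+t+4).choose (t+3)) ≤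
      (u+2*t+10).choose (t+4) + 4) :
    C.card + ((u+t+5).choose (t+4) + (u+t+4).choose (t+3)) < (sh (t+4) C).card + 2 := by
  have e1 : (u+2*t+8).choose (u+t+5) = (u+2*t+8).choose (t+3) := by
    rw [← Nat.choose_symm (show u+t+5 ≤ u+2*t+8 by omega)]; congr 1; omega
  have e2 : (u+2*t+7).choose (u+t+4) = (u+2*t+7).choose (t+3) := by
    rw [← Nat.choose_symm (show u+t+4 ≤ u+2*t+7 by omega)]; congr 1; omega
  have e3 : (u+2*t+8).choose (u+t+4) = (u+2*t+8).choose (t+4) := by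
    rw [← Nat.choose_symm (show u+t+4 ≤ u+2*t+8 by omega)]; congr 1; omega
  have e4 : (u+2*t+7).choose (u+t+3) = (u+2*t+7).choose (t+4) := by
    rw [← Nat.choose_symm (show u+t+3 ≤ u+2*t+7 by omega)]; congr 1; omega
  have p1 : (u+2*t+8).choose (t+4) = (u+2*t+7).choose (t+3) + (u+2*t+7).choose (t+4) := rfl
  have p2 : (u+2*t+8).choose (t+3) = (u+2*t+7).choose (t+2) + (u+2*t+7).choose (t+3) := rfl
  have p3 : (u+2*t+8).choose (t+2) = (u+2*t+7).choose (t+1) + (u+2*t+7).choose (t+2) := rfl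
  have p4 : (u+2*t+9).choose (t+4) = (u+2*t+8).choose (t+3) + (u+2*t+8).choose (t+4) := rfl
  have p5 : (u+2*t+9).choose (t+3) = (u+2*t+8).choose (t+2) + (u+2*t+8).choose (t+3) := rfl
  have p6 : (u+2*t+10).choose (t+4) = (u+2*t+9).choose (t+3) + (u+2*t+9).choose (t+4) := rfl
  obtain ⟨c, hc⟩ := Nat.exists_eq_add_of_le h1
  have hW : 2 ≤ (u+t+5).choose (t+4) := by
    have h3 : (u+t+5).choose 1 ≤ (u+t+5).choose (t+4) := choose_le_aux (by omega) (by omega)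
    rw [Nat.choose_one_right] at h3
    omega
  have hW2 : 2 ≤ (u+t+4).choose (t+3) := by
    have h3 : (u+t+4).choose 1 ≤ (u+t+4).choose (t+3) := choose_le_aux (by omega) (by omega)
    rw [Nat.choose_one_right] at h3
    omega
  have hRP : (u+2*t+7).choose (t+3) ≤ (u+2*t+7).choose (t+4) := by
    by_cases hu : u = 0
    · subst hu
      rw [← Nat.choose_symm (show t+4 ≤ 0+2*t+7 by omega)]
      apply le_of_eq; congr 1; omega
    · exact choose_le_aux (by omega) (by omega)
  have hQR : (u+2*t+7).choose (t+2) ≤ (u+2*t+7).choose (t+3) := choose_le_aux (by omega) (by omega)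
  have hSQ : (u+2*t+7).choose (t+1) ≤ (u+2*t+7).choose (t+2) := choose_le_aux (by omega) (by omega)
  have hcP : c ≤ (u+2*t+7).choose (t+4) := by omega
  obtain ⟨C1, h3, h4, h5⟩ := kk_step (r := u+t+4) (s := t+3) (y := u+2*t+8)
    (c := (u+2*t+7).choose (t+3) + c) (by omega) (by omega) C hC (by rw [e1]; omega) (by rw [e3]; omega)
  obtain ⟨C2, h6, h7, h8⟩ := kk_step (r := u+t+3) (s := t+2) (y := u+2*t+7)
    (c := c) (by omega) (by omega) C1 h3 (by rw [e2]; omega) (by rw [e4]; omega)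
  have h9 := kk_nm (r := u+t+3) (s := t+2) (y := u+2*t+7) (by omega) (by omega) C2 h6
    (by rw [e4]; omega)
  rw [e4, h7] at h9
  have num := numeric u t
  have hQ : 0 < (u+2*t+7).choose (t+2) := Nat.choose_pos (by omega)
  by_contra hcon
  push Not at hcon
  have hh : (u+2*t+8).choose (t+4) + ((u+2*t+7).choose (t+3) + (sh (t+2) C2).card) ≤ (sh (t+4) C).card := by
    refine le_trans ?_ h5
    exact Nat.add_le_add_left h8 _
  generalize (sh (t+2) C2).card = D' at *
  generalize (sh (t+4) C).card = D at *
  generalize hb : C.card = b at *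
  rw [p6, p4, p5, p1, p2, p3] at h2
  rw [p2] at hc
  rw [p1] at hh
  generalize (u+t+5).choose (t+4) + (u+t+4).choose (t+3) = W at *
  generalize (u+2*t+7).choose (t+4) = P at *
  generalize (u+2*t+7).choose (t+3) = R at *
  generalize (u+2*t+7).choose (t+2) = Q at *
  generalize (u+2*t+7).choose (t+1) = S at *
  have f1 : P + D' + 2 ≤ Q + c + W := by omega
  have f2 : 2 * c + W + R ≤ P + Q + S + 4 := by omega
  have f3 : Q ≤ P := hQR.trans hRP
  exact q_contra P Q R S W c D' (by exact_mod_cast f1) (by exact_mod_cast f2)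
    (by exact_mod_cast h9) (by exact_mod_cast hQ) (by exact_mod_cast f3) num

theorem kk_main (u t : ℕ) (C : Finset (Finset ℕ))
    (hC : ∀ A ∈ C, A.card = u + t + 5) (h3 : 3 ≤ C.card)
    (h2 : 2 * C.card + ((u+t+5).choose (t+4) + (u+t+4).choose (t+3)) ≤
      (u+2*t+10).choose (t+4) + 4) :
    C.card + ((u+t+5).choose (t+4) + (u+t+4).choose (t+3)) < (sh (t+4) C).card + 2 := by
  have b1 : u+t+3 ≤ (u+t+3).choose (t+2) := by
    have h3 : (u+t+3).choose 1 ≤ (u+t+3).choose (t+2) := choose_le_aux (by omega) (by omega)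
    rwa [Nat.choose_one_right] at h3
  have b2 : u+t+2 ≤ (u+t+2).choose (t+1) := by
    have h3 : (u+t+2).choose 1 ≤ (u+t+2).choose (t+1) := choose_le_aux (by omega) (by omega)
    rwa [Nat.choose_one_right] at h3
  by_cases h4 : C.card = 3
  · have := piece_three (R := u+t+4) (S := t+3) (by omega) (by omega) C hC h4
    have h5 : (u+t+5).choose (t+4) + (u+t+4).choose (t+3) + (u+t+3).choose (t+2) ≤ (sh (t+4) C).card := this
    omega
  by_cases h5 : C.card ≤ u + t + 6
  · have := piece_four (R := u+t+4) (S := t+3) (by omega) (by omega) C hC (by omega)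
    have h5 : (u+t+5).choose (t+4) + (u+t+4).choose (t+3) + (u+t+3).choose (t+2) + (u+t+2).choose (t+1) ≤ (sh (t+4) C).card := this
    omega
  have fin : C.card + (u+t+6).choose (t+4) ≤ (sh (t+4) C).card + (u+t+6) → 
      C.card + ((u+t+5).choose (t+4) + (u+t+4).choose (t+3)) < (sh (t+4) C).card + 2 := by
    intro h
    have q1 : (u+t+6).choose (t+4) = (u+t+5).choose (t+3) + (u+t+5).choose (t+4) := rfl
    have q2 : (u+t+5).choose (t+3) = (u+t+4).choose (t+2) + (u+t+4).choose (t+3) := rfl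
    have q3 : (u+t+4).choose 2 ≤ (u+t+4).choose (t+2) := choose_le_aux (by omega) (by omega)
    have q4 : u + t + 5 ≤ (u+t+4).choose 2 := by
      rw [Nat.choose_two_right, Nat.le_div_iff_mul_le (by omega)]
      rw [show u+t+4-1 = u+t+3 by omega]
      nlinarith
    omega
  have e1 : (u+2*t+8).choose (u+t+5) = (u+2*t+8).choose (t+3) := by
    rw [← Nat.choose_symm (show u+t+5 ≤ u+2*t+8 by omega)]; congr 1; omega
  have e2 : (u+2*t+7).choose (u+t+4) = (u+2*t+7).choose (t+3) := by
    rw [← Nat.choose_symm (show u+t+4 ≤ u+2*t+7 by omega)]; congr 1; omega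
  have i1 : u+t+4+1+(t+3) = u+2*t+8 := by ring
  have i2 : u+t+4+(t+3) = u+2*t+7 := by ring
  rcases Nat.le_total C.card ((u+2*t+8).choose (u+t+5)) with h6 | h6
  · apply fin
    exact piece_B (R := u+t+4) (S := t+3) (by omega) (by omega) C hC (by omega) (t+3) (by omega) le_rfl
      (by rw [i1]; exact h6)
  rcases Nat.le_total C.card ((u+2*t+8).choose (u+t+5) + (u+2*t+7).choose (u+t+4)) with h7 | h7
  · apply fin
    exact piece_C (R := u+t+4) (S := t+3) (by omega) (by omega) C hC
      (by rw [i1]; exact h6) (by rw [i1, i2]; exact h7)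
  · exact piece_D u t C hC (by rw [← e1, ← e2]; exact h7) h2

/-! ### The Katona shadow inequality for intersecting families -/

theorem katona_s2 {k : ℕ} (hk : 1 ≤ k) (B : Finset (Finset ℕ)) (hB : ∀ S ∈ B, S.card = k)
    (hint : Intersecting B) : B.card ≤ (sh (k-1) B).card := by
  classical
  let x : Finset ℕ → (↥B → ℚ) := fun T X => if T ⊆ X.1 then 1 else 0
  let E : Finset ℕ := B.sup id
  have hE : ∀ S ∈ B, S ⊆ E := fun S hS => Finset.le_sup (f := id) hS
  let W : Submodule ℚ (↥B → ℚ) := Submodule.span ℚ (((sh (k-1) B).image x : Finset (↥B → ℚ)) : Set (↥B → ℚ))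
  have key : ∀ j, ∀ T : Finset ℕ, T.card + j + 1 = k → x T ∈ W := by
    intro j
    induction j with
    | zero =>
      intro T hT
      by_cases h : T ∈ sh (k-1) B
      · apply Submodule.subset_span
        exact Finset.mem_coe.2 (Finset.mem_image_of_mem _ h)
      · have : x T = 0 := by
          funext X
          have hx : ¬ T ⊆ X.1 := fun h' => h (mem_sh.2 ⟨X.1, X.2, h', by omega⟩)
          simp [x, hx]
        rw [this]; exact W.zero_mem
    | succ j ih =>
      intro T hT
      have hsum : ((j + 2 : ℕ) : ℚ) • x T = ∑ y ∈ E \ T, x (insert y T) := by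
        funext X
        rw [Finset.sum_apply]
        simp only [Pi.smul_apply, smul_eq_mul, x, Finset.insert_subset_iff]
        by_cases h : T ⊆ X.1
        · simp only [h, and_true, if_true, mul_one]
          rw [Finset.sum_boole]
          congr 1
          have e : (E \ T).filter (fun y => y ∈ X.1) = X.1 \ T := by
            ext y
            simp only [Finset.mem_filter, Finset.mem_sdiff]
            constructor
            · rintro ⟨⟨_, h2⟩, h3⟩; exact ⟨h3, h2⟩
            · rintro ⟨h1, h2⟩; exact ⟨⟨hE _ X.2 h1, h2⟩, h1⟩
          rw [e, Finset.card_sdiff_of_subset h, hB _ X.2]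
          omega
        · simp [h]
      have hne : ((j + 2 : ℕ) : ℚ) ≠ 0 := by positivity
      have : x T = ((j + 2 : ℕ) : ℚ)⁻¹ • ∑ y ∈ E \ T, x (insert y T) := by
        rw [← hsum, smul_smul, inv_mul_cancel₀ hne, one_smul]
      rw [this]
      apply W.smul_mem
      apply W.sum_mem
      intro y hy
      apply ih
      rw [Finset.card_insert_of_notMem (Finset.mem_sdiff.1 hy).2]
      omega
  have hfull : ∀ S ∈ B, x S ∈ W := by
    intro S hS
    have h0 : ∑ T ∈ S.powerset, ((-1 : ℚ) ^ T.card) • x T = 0 := by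
      funext X
      rw [Finset.sum_apply]
      simp only [Pi.smul_apply, smul_eq_mul, x, mul_ite, mul_one, mul_zero, Pi.zero_apply]
      rw [← Finset.sum_filter]
      have e : S.powerset.filter (fun T => T ⊆ X.1) = (S ∩ X.1).powerset := by
        ext T
        simp only [Finset.mem_filter, Finset.mem_powerset, Finset.subset_inter_iff]
      rw [e]
      have := Finset.sum_powerset_neg_one_pow_card_of_nonempty (hint S hS X.1 X.2)
      exact_mod_cast this
    rw [← Finset.sum_erase_add _ _ (Finset.mem_powerset_self S)] at h0
    have h1 : ((-1 : ℚ) ^ S.card) • x S ∈ W := by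
      rw [eq_neg_of_add_eq_zero_right h0]
      apply W.neg_mem
      apply W.sum_mem
      intro T hT
      apply W.smul_mem
      rw [Finset.mem_erase, Finset.mem_powerset] at hT
      have : T.card < S.card := Finset.card_lt_card (Finset.ssubset_iff_subset_ne.2 ⟨hT.2, hT.1⟩)
      rw [hB S hS] at this
      exact key (k - 1 - T.card) T (by omega)
    have h2 := W.smul_mem ((-1 : ℚ) ^ S.card) h1
    rwa [smul_smul, ← mul_pow, neg_one_mul, neg_neg, one_pow, one_smul] at h2
  have htop : W = ⊤ := by
    rw [eq_top_iff]
    intro f _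
    have : f = ∑ X : ↥B, f X • x X.1 := by
      funext Y
      rw [Finset.sum_apply, Finset.sum_eq_single Y]
      · simp [x]
      · intro X _ hXY
        have : ¬ X.1 ⊆ Y.1 := by
          intro h
          apply hXY
          apply Subtype.ext
          exact Finset.eq_of_subset_of_card_le h (by rw [hB _ X.2, hB _ Y.2])
        simp only [Pi.smul_apply, smul_eq_mul, x, if_neg this, mul_zero]
      · intro h; exact absurd (Finset.mem_univ _) h
    rw [this]
    apply W.sum_mem
    intro X _
    exact W.smul_mem _ (hfull _ X.2)
  have h1 : Module.finrank ℚ W ≤ ((sh (k-1) B).image x).card := finrank_span_finset_le_card _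
  rw [htop, finrank_top, Module.finrank_fintype_fun_eq_card, Fintype.card_coe] at h1
  exact h1.trans Finset.card_image_le

/-! ### Shifting -/

/-- One step of the shift replacing `j` by `1`. -/
def shiftMap (j : ℕ) (F : Finset (Finset ℕ)) (S : Finset ℕ) : Finset ℕ :=
  if j ∈ S ∧ 1 ∉ S ∧ insert 1 (S.erase j) ∉ F then insert 1 (S.erase j) else S

theorem shift_inj (j : ℕ) (hj : j ≠ 1) (F : Finset (Finset ℕ)) :
    Set.InjOn (shiftMap j F) (F : Set (Finset ℕ)) := by
  intro S hS T hT h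
  have hS' : S ∈ F := hS
  have hT' : T ∈ F := hT
  unfold shiftMap at h
  split_ifs at h with h1 h2 h2
  · have e : ∀ A : Finset ℕ, j ∈ A → 1 ∉ A → insert j ((insert 1 (A.erase j)).erase 1) = A := by
      intro A ha h1
      rw [Finset.erase_insert (by simp [h1]), Finset.insert_erase ha]
    rw [← e S h1.1 h1.2.1, h, e T h2.1 h2.2.1]
  · exact absurd (h ▸ hT') h1.2.2
  · exact absurd (h ▸ hS') h2.2.2
  · exact h

theorem shift_intersecting (j : ℕ) (hj : j ≠ 1) (F : Finset (Finset ℕ)) (hint : Intersecting F) :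
    Intersecting (F.image (shiftMap j F)) := by
  have main : ∀ S ∈ F, ∀ T ∈ F, (j ∈ S ∧ 1 ∉ S ∧ insert 1 (S.erase j) ∉ F) →
      ¬ (j ∈ T ∧ 1 ∉ T ∧ insert 1 (T.erase j) ∉ F) → (insert 1 (S.erase j) ∩ T).Nonempty := by
    intro S hS T hT h1 h2
    by_cases h1T : 1 ∈ T
    · exact ⟨1, by simp [h1T]⟩
    by_cases hy : ∃ y ∈ S ∩ T, y ≠ j
    · obtain ⟨y, hy, hyj⟩ := hy
      rw [Finset.mem_inter] at hy
      exact ⟨y, by simp [hy.1, hy.2, hyj]⟩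
    push Not at hy
    obtain ⟨z, hz⟩ := hint S hS T hT
    have hzj := hy z hz
    subst hzj
    have hzT := (Finset.mem_inter.1 hz).2
    have h3 : insert 1 (T.erase z) ∈ F := by
      by_contra h3
      exact h2 ⟨hzT, h1T, h3⟩
    obtain ⟨w, hw⟩ := hint S hS _ h3
    rw [Finset.mem_inter, Finset.mem_insert, Finset.mem_erase] at hw
    rcases hw with ⟨hwS, rfl | ⟨hwz, hwT⟩⟩
    · exact absurd hwS h1.2.1
    · exact absurd (hy w (Finset.mem_inter.2 ⟨hwS, hwT⟩)) hwz
  intro A hA B hB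
  rw [Finset.mem_image] at hA hB
  obtain ⟨S, hS, rfl⟩ := hA
  obtain ⟨T, hT, rfl⟩ := hB
  unfold shiftMap
  split_ifs with h1 h2 h2
  · exact ⟨1, by simp⟩
  · exact main S hS T hT h1 h2
  · rw [Finset.inter_comm]; exact main T hT S hS h2 h1
  · exact hint S hS T hT

theorem mem_shiftMap_other {j x : ℕ} {F : Finset (Finset ℕ)} {S : Finset ℕ} (hx : x ≠ 1)
    (h : x ∈ shiftMap j F S) : x ∈ S := by
  unfold shiftMap at h
  split_ifs at h with h1
  · simp [hx] at h; exact h.2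
  · exact h

theorem mem_shiftMap_one {j : ℕ} {F : Finset (Finset ℕ)} {S : Finset ℕ}
    (h : 1 ∈ shiftMap j F S) : 1 ∈ S ∨ j ∈ S := by
  unfold shiftMap at h
  split_ifs at h with h1
  · exact Or.inr h1.1
  · exact Or.inl h

/-- degree -/
def dg (x : ℕ) (F : Finset (Finset ℕ)) : ℕ := (F.filter (fun A => x ∈ A)).card

theorem dg_shift_other {j x : ℕ} {F : Finset (Finset ℕ)} (hx : x ≠ 1) :
    dg x (F.image (shiftMap j F)) ≤ dg x F := by
  unfold dg
  refine le_trans (Finset.card_le_card ?_) (Finset.card_image_le (f := shiftMap j F))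
  intro A hA
  rw [Finset.mem_filter, Finset.mem_image] at hA
  obtain ⟨⟨S, hS, rfl⟩, h⟩ := hA
  exact Finset.mem_image_of_mem _ (Finset.mem_filter.2 ⟨hS, mem_shiftMap_other hx h⟩)

theorem dg_shift_one {j : ℕ} {F : Finset (Finset ℕ)} :
    dg 1 (F.image (shiftMap j F)) ≤ dg 1 F + dg j F := by
  unfold dg
  refine le_trans ?_ (Finset.card_union_le _ _)
  refine le_trans (Finset.card_le_card ?_) (Finset.card_image_le (f := shiftMap j F))
  intro A hA
  rw [Finset.mem_filter, Finset.mem_image] at hA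
  obtain ⟨⟨S, hS, rfl⟩, h⟩ := hA
  apply Finset.mem_image_of_mem
  rw [Finset.mem_union, Finset.mem_filter, Finset.mem_filter]
  rcases mem_shiftMap_one h with h | h
  · exact Or.inl ⟨hS, h⟩
  · exact Or.inr ⟨hS, h⟩

theorem dg_shift_lt {j : ℕ} {F : Finset (Finset ℕ)} {S : Finset ℕ} (hS : S ∈ F)
    (h1 : j ∈ S ∧ 1 ∉ S ∧ insert 1 (S.erase j) ∉ F) :
    dg 1 F < dg 1 (F.image (shiftMap j F)) := by
  unfold dg
  apply Finset.card_lt_card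
  rw [Finset.ssubset_iff_of_subset]
  · refine ⟨insert 1 (S.erase j), ?_, ?_⟩
    · rw [Finset.mem_filter, Finset.mem_image]
      refine ⟨⟨S, hS, ?_⟩, by simp⟩
      unfold shiftMap
      rw [if_pos h1]
    · intro h; exact h1.2.2 (Finset.mem_filter.1 h).1
  · intro A hA
    rw [Finset.mem_filter] at hA
    rw [Finset.mem_filter, Finset.mem_image]
    refine ⟨⟨A, hA.1, ?_⟩, hA.2⟩
    unfold shiftMap
    rw [if_neg]
    intro h; exact h.2.1 hA.2

theorem shift_sub {n k j : ℕ} (hj : j ≠ 1) (hn : 1 ≤ n) {F : Finset (Finset ℕ)}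
    (hF : F ⊆ powersetCard k (Icc 1 n)) :
    F.image (shiftMap j F) ⊆ powersetCard k (Icc 1 n) := by
  intro A hA
  rw [Finset.mem_image] at hA
  obtain ⟨S, hS, rfl⟩ := hA
  have h := hF hS
  unfold shiftMap
  split_ifs with h1
  · rw [mem_powersetCard] at h ⊢
    constructor
    · intro y hy
      rw [Finset.mem_insert] at hy
      rcases hy with rfl | hy
      · simp [hn]
      · exact h.1 (Finset.mem_of_mem_erase hy)
    · rw [Finset.card_insert_of_notMem (by simp [h1.2.1]), Finset.card_erase_add_one h1.1]
      exact h.2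
  · exact h

theorem dg_add (x : ℕ) (F : Finset (Finset ℕ)) :
    dg x F + (F.filter (fun A => x ∉ A)).card = F.card :=
  Finset.card_filter_add_card_filter_not _

/-! ### Complement families -/

theorem dg_eq_erase (x : ℕ) (F : Finset (Finset ℕ)) :
    ((F.filter (fun A => x ∈ A)).image (fun A => A.erase x)).card = dg x F := by
  apply Finset.card_image_of_injOn
  intro A hA B hB h
  have ha : x ∈ A := (Finset.mem_filter.1 hA).2
  have hb : x ∈ B := (Finset.mem_filter.1 hB).2
  rw [← Finset.insert_erase ha, ← Finset.insert_erase hb]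
  exact congrArg (insert x) h

theorem dichotomy (u t : ℕ) (G : Finset (Finset ℕ)) (v : ℕ) (hv : v ∈ Icc 1 (u+2*t+11))
    (hG : G ⊆ powersetCard (t+5) (Icc 1 (u+2*t+11))) (hint : Intersecting G)
    (hM : G.card + ((u+t+5).choose (t+4) + (u+t+4).choose (t+3)) = (u+2*t+10).choose (t+4) + 2)
    (hb : 3 ≤ (G.filter (fun A => v ∉ A)).card) :
    2 * dg v G + 3 ≤ G.card := by
  by_contra hcon
  have hadd := dg_add v G
  set N := (Icc 1 (u+2*t+11)).erase v with hN
  have hNc : N.card = u+2*t+10 := by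
    rw [hN, Finset.card_erase_of_mem hv, Nat.card_Icc]; omega
  have hBN : ∀ B ∈ G.filter (fun A => v ∉ A), B ⊆ N ∧ B.card = t+5 := by
    intro B hB
    rw [Finset.mem_filter] at hB
    have := mem_powersetCard.1 (hG hB.1)
    exact ⟨Finset.subset_erase.2 ⟨this.1, hB.2⟩, this.2⟩
  set C := (G.filter (fun A => v ∉ A)).image (fun B => N \ B) with hC
  have hCc : C.card = (G.filter (fun A => v ∉ A)).card := by
    apply Finset.card_image_of_injOn
    intro A hA B hB h
    have h' : N \ A = N \ B := h
    rw [← Finset.sdiff_sdiff_eq_self (hBN A hA).1, h', Finset.sdiff_sdiff_eq_self (hBN B hB).1]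
  have hCu : ∀ A ∈ C, A.card = u + t + 5 := by
    intro A hA
    rw [hC, Finset.mem_image] at hA
    obtain ⟨B, hB, rfl⟩ := hA
    rw [Finset.card_sdiff_of_subset (hBN B hB).1, hNc, (hBN B hB).2]
    omega
  have hkk := kk_main u t C hCu (by omega) (by omega)
  have hsub : (G.filter (fun A => v ∈ A)).image (fun A => A.erase v) ∪ sh (t+4) C ⊆
      powersetCard (t+4) N := by
    intro T hT
    rw [Finset.mem_union] at hT
    rw [mem_powersetCard]
    rcases hT with hT | hT
    · rw [Finset.mem_image] at hT
      obtain ⟨A, hA, rfl⟩ := hT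
      rw [Finset.mem_filter] at hA
      have := mem_powersetCard.1 (hG hA.1)
      refine ⟨Finset.erase_subset_erase _ this.1, ?_⟩
      rw [Finset.card_erase_of_mem hA.2, this.2]
      omega
    · obtain ⟨A, hA, hTA, hTc⟩ := mem_sh.1 hT
      rw [hC, Finset.mem_image] at hA
      obtain ⟨B, hB, rfl⟩ := hA
      exact ⟨hTA.trans Finset.sdiff_subset, hTc⟩
  have hdisj : Disjoint ((G.filter (fun A => v ∈ A)).image (fun A => A.erase v)) (sh (t+4) C) := by
    rw [Finset.disjoint_left]
    intro T hT hT'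
    rw [Finset.mem_image] at hT
    obtain ⟨A, hA, rfl⟩ := hT
    obtain ⟨A', hA', hTA, hTc⟩ := mem_sh.1 hT'
    rw [hC, Finset.mem_image] at hA'
    obtain ⟨B, hB, rfl⟩ := hA'
    rw [Finset.mem_filter] at hA hB
    obtain ⟨y, hy⟩ := hint A hA.1 B hB.1
    rw [Finset.mem_inter] at hy
    have hyv : y ≠ v := by rintro rfl; exact hB.2 hy.2
    have := hTA (Finset.mem_erase.2 ⟨hyv, hy.1⟩)
    exact (Finset.mem_sdiff.1 this).2 hy.2
  have hle := Finset.card_le_card hsub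
  rw [Finset.card_union_of_disjoint hdisj, dg_eq_erase, card_powersetCard, hNc] at hle
  omega

/-! ### All degrees low is impossible -/

theorem no_low (u t : ℕ) : ∀ N : ℕ, ∀ G : Finset (Finset ℕ), G.card ≤ dg 1 G + N →
    G ⊆ powersetCard (t+5) (Icc 1 (u+2*t+11)) → Intersecting G →
    G.card + ((u+t+5).choose (t+4) + (u+t+4).choose (t+3)) = (u+2*t+10).choose (t+4) + 2 →
    (∀ v ∈ Icc 1 (u+2*t+11), 2 * dg v G + 3 ≤ G.card) → False := by
  intro N
  induction N with
  | zero =>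
    intro G h0 hG hint hM hlow
    have h1 := hlow 1 (by simp)
    omega
  | succ N ih =>
    intro G h0 hG hint hM hlow
    have low1 := hlow 1 (by simp)
    have hadd := dg_add 1 G
    by_cases hst : ∃ S ∈ G, ∃ j, j ∈ S ∧ 1 ∉ S ∧ insert 1 (S.erase j) ∉ G
    · obtain ⟨S, hS, j, hj⟩ := hst
      have hj1 : j ≠ 1 := by rintro rfl; exact hj.2.1 hj.1
      have hjn : j ∈ Icc 1 (u+2*t+11) := (mem_powersetCard.1 (hG hS)).1 hj.1
      have hc : (G.image (shiftMap j G)).card = G.card :=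
        Finset.card_image_of_injOn (shift_inj j hj1 G)
      have hlt := dg_shift_lt hS hj
      have hd1 := dg_shift_one (j := j) (F := G)
      have hlj := hlow j hjn
      refine ih (G.image (shiftMap j G)) (by omega) (shift_sub hj1 (by omega) hG)
        (shift_intersecting j hj1 G hint) (by rw [hc]; exact hM) ?_
      intro v hv
      by_cases hv1 : v = 1
      · subst hv1
        refine dichotomy u t _ 1 hv (shift_sub hj1 (by omega) hG)
          (shift_intersecting j hj1 G hint) (by rw [hc]; exact hM) ?_
        have := dg_add 1 (G.image (shiftMap j G))
        omega
      · have := dg_shift_other (j := j) (F := G) hv1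
        have := hlow v hv
        omega
    · push Not at hst
      have hkat := katona_s2 (k := t+5) (by omega) (G.filter (fun A => 1 ∉ A))
        (fun S hS => (mem_powersetCard.1 (hG (Finset.mem_filter.1 hS).1)).2)
        (fun A hA B hB => hint A (Finset.mem_filter.1 hA).1 B (Finset.mem_filter.1 hB).1)
      have hle : (sh (t+5-1) (G.filter (fun A => 1 ∉ A))).card ≤ dg 1 G := by
        rw [← dg_eq_erase]
        apply Finset.card_le_card
        intro T hT
        obtain ⟨A, hA, hTA, hTc⟩ := mem_sh.1 hT
        rw [Finset.mem_filter] at hA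
        have hAc := (mem_powersetCard.1 (hG hA.1)).2
        have hd : (A \ T).card = 1 := by
          rw [Finset.card_sdiff_of_subset hTA]; omega
        obtain ⟨j, hj⟩ := Finset.card_eq_one.1 hd
        have hjA : j ∈ A := (Finset.mem_sdiff.1 (hj ▸ Finset.mem_singleton_self j)).1
        have hT' : T = A.erase j := by
          rw [← Finset.sdiff_singleton_eq_erase, ← hj, Finset.sdiff_sdiff_eq_self hTA]
        rw [Finset.mem_image]
        refine ⟨insert 1 (A.erase j), ?_, ?_⟩
        · rw [Finset.mem_filter]
          exact ⟨hst A hA.1 j hjA hA.2, by simp⟩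
        · rw [Finset.erase_insert (by simp [hA.2]), hT']
      omega

/-! ### The case of exactly two sets missing a point -/

theorem two_struct (u t : ℕ) (G : Finset (Finset ℕ)) (v : ℕ) (hv : v ∈ Icc 1 (u+2*t+11))
    (hG : G ⊆ powersetCard (t+5) (Icc 1 (u+2*t+11))) (hint : Intersecting G)
    (hM : G.card + ((u+t+5).choose (t+4) + (u+t+4).choose (t+3)) = (u+2*t+10).choose (t+4) + 2)
    (hb : (G.filter (fun A => v ∉ A)).card = 2) :
    ∃ B1 B2 : Finset ℕ, v ∉ B1 ∧ v ∉ B2 ∧ B1 ∈ powersetCard (t+5) (Icc 1 (u+2*t+11)) ∧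
      B2 ∈ powersetCard (t+5) (Icc 1 (u+2*t+11)) ∧ (B1 ∩ B2).card = t+4 ∧
      G = {B1, B2} ∪ (powersetCard (t+5) (Icc 1 (u+2*t+11))).filter
        (fun A => v ∈ A ∧ (A ∩ B1).Nonempty ∧ (A ∩ B2).Nonempty) := by
  have hadd := dg_add v G
  obtain ⟨B1, B2, hne, hBB⟩ := Finset.card_eq_two.1 hb
  have hB1 : B1 ∈ G.filter (fun A => v ∉ A) := by rw [hBB]; simp
  have hB2 : B2 ∈ G.filter (fun A => v ∉ A) := by rw [hBB]; simp
  rw [Finset.mem_filter] at hB1 hB2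
  set N := (Icc 1 (u+2*t+11)).erase v with hN
  have hNc : N.card = u+2*t+10 := by
    rw [hN, Finset.card_erase_of_mem hv, Nat.card_Icc]; omega
  have c1 := (mem_powersetCard.1 (hG hB1.1))
  have c2 := (mem_powersetCard.1 (hG hB2.1))
  have s1 : B1 ⊆ N := Finset.subset_erase.2 ⟨c1.1, hB1.2⟩
  have s2 : B2 ⊆ N := Finset.subset_erase.2 ⟨c2.1, hB2.2⟩
  set A' := (G.filter (fun A => v ∈ A)).image (fun A => A.erase v) with hA'
  set X1 := powersetCard (t+4) (N \ B1) with hX1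
  set X2 := powersetCard (t+4) (N \ B2) with hX2
  have hX1c : X1.card = (u+t+5).choose (t+4) := by
    rw [hX1, card_powersetCard, Finset.card_sdiff_of_subset s1, hNc, c1.2]
    congr 1; omega
  have hX2c : X2.card = (u+t+5).choose (t+4) := by
    rw [hX2, card_powersetCard, Finset.card_sdiff_of_subset s2, hNc, c2.2]
    congr 1; omega
  have hX12 : X1 ∩ X2 = powersetCard (t+4) (N \ (B1 ∪ B2)) := by
    ext T
    simp only [hX1, hX2, Finset.mem_inter, mem_powersetCard, Finset.sdiff_union_distrib,
      Finset.subset_inter_iff]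
    tauto
  have hie := Finset.card_union_add_card_inter X1 X2
  rw [hX12, card_powersetCard, hX1c, hX2c,
    Finset.card_sdiff_of_subset (Finset.union_subset s1 s2), hNc] at hie
  have hun := Finset.card_union_add_card_inter B1 B2
  rw [c1.2, c2.2] at hun
  have hlt : (B1 ∩ B2).card < t + 5 := by
    rw [← c1.2]
    apply Finset.card_lt_card
    rw [Finset.ssubset_iff_subset_ne]
    refine ⟨Finset.inter_subset_left, fun h => hne ?_⟩
    exact Finset.eq_of_subset_of_card_le (Finset.inter_eq_left.1 h) (by omega)
  have hA'N : A' ⊆ powersetCard (t+4) N := by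
    intro T hT
    rw [hA', Finset.mem_image] at hT
    rw [mem_powersetCard]
    obtain ⟨A, hA, rfl⟩ := hT
    rw [Finset.mem_filter] at hA
    have := mem_powersetCard.1 (hG hA.1)
    refine ⟨Finset.erase_subset_erase _ this.1, ?_⟩
    rw [Finset.card_erase_of_mem hA.2, this.2]
    omega
  have hsub : A' ∪ (X1 ∪ X2) ⊆ powersetCard (t+4) N := by
    apply Finset.union_subset hA'N
    apply Finset.union_subset
    · exact powersetCard_mono Finset.sdiff_subset
    · exact powersetCard_mono Finset.sdiff_subset
  have hd : ∀ B ∈ G, v ∉ B → ∀ T ∈ A', T ∉ powersetCard (t+4) (N \ B) := by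
    intro B hB hvB T hT hT'
    rw [hA', Finset.mem_image] at hT
    obtain ⟨A, hA, rfl⟩ := hT
    rw [Finset.mem_filter] at hA
    obtain ⟨y, hy⟩ := hint A hA.1 B hB
    rw [Finset.mem_inter] at hy
    have hyv : y ≠ v := by rintro rfl; exact hvB hy.2
    have := (mem_powersetCard.1 hT').1 (Finset.mem_erase.2 ⟨hyv, hy.1⟩)
    exact (Finset.mem_sdiff.1 this).2 hy.2
  have hdisj : Disjoint A' (X1 ∪ X2) := by
    rw [Finset.disjoint_left]
    intro T hT hT'
    rcases Finset.mem_union.1 hT' with h | h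
    · exact hd B1 hB1.1 hB1.2 T hT h
    · exact hd B2 hB2.1 hB2.2 T hT h
  have hle := Finset.card_le_card hsub
  rw [Finset.card_union_of_disjoint hdisj, hA', dg_eq_erase, card_powersetCard, hNc] at hle
  have p1 : (u+t+5).choose (t+4) = (u+t+4).choose (t+3) + (u+t+4).choose (t+4) := rfl
  have p2 : (u+t+4).choose (t+4) = (u+t+3).choose (t+3) + (u+t+3).choose (t+4) := rfl
  have p3 : 0 < (u+t+3).choose (t+3) := Nat.choose_pos (by omega)
  have hint4 : (B1 ∩ B2).card = t + 4 := by
    by_contra hcon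
    have hm : (u+2*t+10 - (B1 ∪ B2).card).choose (t+4) ≤ (u+t+3).choose (t+4) :=
      Nat.choose_le_choose _ (by omega)
    omega
  have hq : (u+2*t+10 - (B1 ∪ B2).card) = u+t+4 := by omega
  rw [hq] at hie
  have heq : A' ∪ (X1 ∪ X2) = powersetCard (t+4) N := by
    apply Finset.eq_of_subset_of_card_le hsub
    rw [Finset.card_union_of_disjoint hdisj, hA', dg_eq_erase, card_powersetCard, hNc]
    omega
  refine ⟨B1, B2, hB1.2, hB2.2, hG hB1.1, hG hB2.1, hint4, ?_⟩
  ext A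
  rw [Finset.mem_union, Finset.mem_filter]
  constructor
  · intro hA
    by_cases hvA : v ∈ A
    · exact Or.inr ⟨hG hA, hvA, hint A hA B1 hB1.1, hint A hA B2 hB2.1⟩
    · left; rw [← hBB]; exact Finset.mem_filter.2 ⟨hA, hvA⟩
  · rintro (h | ⟨hA, hvA, ⟨y, hy⟩, ⟨z, hz⟩⟩)
    · rw [← hBB] at h; exact (Finset.mem_filter.1 h).1
    · rw [mem_powersetCard] at hA
      rw [Finset.mem_inter] at hy hz
      have hyv : y ≠ v := by rintro rfl; exact hB1.2 hy.2
      have hzv : z ≠ v := by rintro rfl; exact hB2.2 hz.2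
      have hT : A.erase v ∈ A' ∪ (X1 ∪ X2) := by
        rw [heq, mem_powersetCard]
        refine ⟨Finset.erase_subset_erase _ hA.1, ?_⟩
        rw [Finset.card_erase_of_mem hvA, hA.2]; omega
      rw [Finset.mem_union, Finset.mem_union] at hT
      rcases hT with hT | hT | hT
      · rw [hA', Finset.mem_image] at hT
        obtain ⟨A2, hA2, he⟩ := hT
        rw [Finset.mem_filter] at hA2
        have : A2 = A := by
          rw [← Finset.insert_erase hvA, ← Finset.insert_erase hA2.2]
          exact congrArg (insert v) he
        exact this ▸ hA2.1
      · rw [hX1, mem_powersetCard] at hT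
        exact absurd hy.2 (Finset.mem_sdiff.1 (hT.1 (Finset.mem_erase.2 ⟨hyv, hy.1⟩))).2
      · rw [hX2, mem_powersetCard] at hT
        exact absurd hz.2 (Finset.mem_sdiff.1 (hT.1 (Finset.mem_erase.2 ⟨hzv, hz.1⟩))).2

/-! ### The permutation -/

theorem relabel (I : Finset ℕ) (f g : ℕ → ℕ)
    (h : ∀ c, (I.filter (fun x => f x = c)).card = (I.filter (fun x => g x = c)).card) :
    ∃ σ : Equiv.Perm ℕ, ∀ x ∈ I, σ x ∈ I ∧ g (σ x) = f x := by
  classical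
  have hc : ∀ f : ℕ → ℕ, ∀ c, Fintype.card {x : ↥I // f x.1 = c} = (I.filter (fun x => f x = c)).card := by
    intro f c
    rw [Fintype.card_subtype, ← Finset.card_map (Function.Embedding.subtype _)]
    congr 1
    ext x
    simp [and_comm]
  have e : ∀ c, Nonempty ({x : ↥I // f x.1 = c} ≃ {x : ↥I // g x.1 = c}) := by
    intro c
    rw [← Fintype.card_eq, hc, hc, h]
  let ee : ∀ c, {x : ↥I // f x.1 = c} ≃ {x : ↥I // g x.1 = c} := fun c => (e c).some
  let τ : Equiv.Perm ↥I := (Equiv.sigmaFiberEquiv (fun x : ↥I => f x.1)).symm.trans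
    ((Equiv.sigmaCongrRight ee).trans (Equiv.sigmaFiberEquiv (fun x : ↥I => g x.1)))
  have hτ : ∀ x : ↥I, g (τ x).1 = f x.1 := by
    intro x
    exact (ee (f x.1) ⟨x, rfl⟩).2
  refine ⟨Equiv.Perm.ofSubtype τ, fun x hx => ?_⟩
  have : Equiv.Perm.ofSubtype τ x = (τ ⟨x, hx⟩ : ℕ) := Equiv.Perm.ofSubtype_apply_of_mem τ hx
  rw [this]
  exact ⟨(τ ⟨x, hx⟩).2, hτ ⟨x, hx⟩⟩

/-- Label of a point relative to the configuration `(v, B1, B2)`. -/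
def lab (v : ℕ) (B1 B2 : Finset ℕ) (x : ℕ) : ℕ :=
  if x = v then 0 else if x ∈ B1 then (if x ∈ B2 then 2 else 1) else (if x ∈ B2 then 3 else 4)

theorem lab_count (I : Finset ℕ) (s v : ℕ) (B1 B2 : Finset ℕ) (hv : v ∈ I) (h1 : v ∉ B1) (h2 : v ∉ B2)
    (hB1 : B1 ∈ powersetCard (s+1) I) (hB2 : B2 ∈ powersetCard (s+1) I) (h12 : (B1 ∩ B2).card = s)
    (c : ℕ) : (I.filter (fun x => lab v B1 B2 x = c)).card =
      if c = 0 then 1 else if c = 1 then 1 else if c = 2 then s else if c = 3 then 1 else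
      if c = 4 then I.card - (s + 3) else 0 := by
  rw [mem_powersetCard] at hB1 hB2
  have e0 : I.filter (fun x => lab v B1 B2 x = 0) = {v} := by
    ext x
    simp only [Finset.mem_filter, Finset.mem_singleton]
    unfold lab
    constructor
    · rintro ⟨_, h⟩; split_ifs at h <;> simp_all
    · rintro rfl; simp [hv]
  have e1 : I.filter (fun x => lab v B1 B2 x = 1) = B1 \ B2 := by
    ext x
    simp only [Finset.mem_filter, Finset.mem_sdiff]
    unfold lab
    constructor
    · rintro ⟨_, h⟩; split_ifs at h <;> simp_all
    · rintro ⟨ha, hb⟩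
      have : x ≠ v := by rintro rfl; exact h1 ha
      simp [this, ha, hb, hB1.1 ha]
  have e2 : I.filter (fun x => lab v B1 B2 x = 2) = B1 ∩ B2 := by
    ext x
    simp only [Finset.mem_filter, Finset.mem_inter]
    unfold lab
    constructor
    · rintro ⟨_, h⟩; split_ifs at h <;> simp_all
    · rintro ⟨ha, hb⟩
      have : x ≠ v := by rintro rfl; exact h1 ha
      simp [this, ha, hb, hB1.1 ha]
  have e3 : I.filter (fun x => lab v B1 B2 x = 3) = B2 \ B1 := by
    ext x
    simp only [Finset.mem_filter, Finset.mem_sdiff]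
    unfold lab
    constructor
    · rintro ⟨_, h⟩; split_ifs at h <;> simp_all
    · rintro ⟨ha, hb⟩
      have : x ≠ v := by rintro rfl; exact h2 ha
      simp [this, ha, hb, hB2.1 ha]
  have e4 : I.filter (fun x => lab v B1 B2 x = 4) = I \ (insert v (B1 ∪ B2)) := by
    ext x
    simp only [Finset.mem_filter, Finset.mem_sdiff, Finset.mem_insert, Finset.mem_union]
    unfold lab
    constructor
    · rintro ⟨hx, h⟩; split_ifs at h <;> simp_all
    · rintro ⟨ha, hb⟩
      push Not at hb
      simp [ha, hb]
  have hun := Finset.card_union_add_card_inter B1 B2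
  have k1 := Finset.card_sdiff_add_card_inter B1 B2
  have k2 := Finset.card_sdiff_add_card_inter B2 B1
  rw [Finset.inter_comm] at k2
  split_ifs with c0 c1 c2 c3 c4
  · rw [c0, e0, Finset.card_singleton]
  · rw [c1, e1]; omega
  · rw [c2, e2]; omega
  · rw [c3, e3]; omega
  · rw [c4, e4, Finset.card_sdiff_of_subset, Finset.card_insert_of_notMem]
    · omega
    · simp [h1, h2]
    · intro x hx
      rw [Finset.mem_insert, Finset.mem_union] at hx
      rcases hx with rfl | hx | hx
      · exact hv
      · exact hB1.1 hx
      · exact hB2.1 hx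
  · rw [Finset.card_eq_zero, Finset.filter_eq_empty_iff]
    intro x _ h
    unfold lab at h
    split_ifs at h <;> omega

theorem lab_mem1 {v : ℕ} {B1 B2 : Finset ℕ} (h1 : v ∉ B1) (x : ℕ) :
    x ∈ B1 ↔ lab v B1 B2 x = 1 ∨ lab v B1 B2 x = 2 := by
  by_cases hxv : x = v
  · subst hxv; simp [lab, h1]
  · unfold lab; split_ifs <;> simp_all

theorem lab_mem2 {v : ℕ} {B1 B2 : Finset ℕ} (h2 : v ∉ B2) (x : ℕ) :
    x ∈ B2 ↔ lab v B1 B2 x = 2 ∨ lab v B1 B2 x = 3 := by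
  by_cases hxv : x = v
  · subst hxv; simp [lab, h2]
  · unfold lab; split_ifs <;> simp_all

theorem lab_v {v : ℕ} {B1 B2 : Finset ℕ} (x : ℕ) : x = v ↔ lab v B1 B2 x = 0 := by
  unfold lab; split_ifs <;> simp_all

theorem map_family (I : Finset ℕ) (k : ℕ) (v w : ℕ) (B1 B2 C1 C2 : Finset ℕ) (σ : Equiv.Perm ℕ)
    (hσ : ∀ x ∈ I, σ x ∈ I) (hv : ∀ x ∈ I, x = v ↔ σ x = w)
    (hB1 : B1 ∈ powersetCard k I) (hB2 : B2 ∈ powersetCard k I)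
    (hC1 : C1 ∈ powersetCard k I) (hC2 : C2 ∈ powersetCard k I)
    (h1 : ∀ x ∈ I, x ∈ B1 ↔ σ x ∈ C1) (h2 : ∀ x ∈ I, x ∈ B2 ↔ σ x ∈ C2) :
    (({B1, B2} ∪ (powersetCard k I).filter
        (fun A => v ∈ A ∧ (A ∩ B1).Nonempty ∧ (A ∩ B2).Nonempty)).image (fun A => A.image σ)) =
    {C1, C2} ∪ (powersetCard k I).filter
        (fun A => w ∈ A ∧ (A ∩ C1).Nonempty ∧ (A ∩ C2).Nonempty) := by
  rw [mem_powersetCard] at hB1 hB2 hC1 hC2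
  have hII : I.image σ = I := by
    apply Finset.eq_of_subset_of_card_le
    · intro y hy
      obtain ⟨x, hx, rfl⟩ := Finset.mem_image.1 hy
      exact hσ x hx
    · rw [Finset.card_image_of_injective _ σ.injective]
  have hback : ∀ y ∈ I, ∃ x ∈ I, σ x = y := by
    intro y hy
    rw [← hII] at hy
    exact Finset.mem_image.1 hy
  have i1 : B1.image σ = C1 := by
    apply Finset.eq_of_subset_of_card_le
    · intro y hy
      obtain ⟨x, hx, rfl⟩ := Finset.mem_image.1 hy
      exact (h1 x (hB1.1 hx)).1 hx
    · rw [Finset.card_image_of_injective _ σ.injective, hB1.2, hC1.2]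
  have i2 : B2.image σ = C2 := by
    apply Finset.eq_of_subset_of_card_le
    · intro y hy
      obtain ⟨x, hx, rfl⟩ := Finset.mem_image.1 hy
      exact (h2 x (hB2.1 hx)).1 hx
    · rw [Finset.card_image_of_injective _ σ.injective, hB2.2, hC2.2]
  rw [Finset.image_union, Finset.image_insert, Finset.image_singleton, i1, i2]
  congr 1
  have key : ∀ A : Finset ℕ, A ⊆ I → ((v ∈ A ↔ w ∈ A.image σ) ∧
      ((A ∩ B1).Nonempty ↔ (A.image σ ∩ C1).Nonempty) ∧
      ((A ∩ B2).Nonempty ↔ (A.image σ ∩ C2).Nonempty)) := by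
    intro A hA
    refine ⟨?_, ?_, ?_⟩
    · rw [Finset.mem_image]
      constructor
      · intro h; exact ⟨v, h, (hv v (hA h)).1 rfl⟩
      · rintro ⟨x, hx, h⟩
        have := (hv x (hA hx)).2 h
        exact this ▸ hx
    · rw [← i1, ← Finset.image_inter _ _ σ.injective, Finset.image_nonempty]
    · rw [← i2, ← Finset.image_inter _ _ σ.injective, Finset.image_nonempty]
  ext S
  rw [Finset.mem_image, Finset.mem_filter]
  constructor
  · rintro ⟨A, hA, rfl⟩
    rw [Finset.mem_filter, mem_powersetCard] at hA
    obtain ⟨a1, a2, a3⟩ := key A hA.1.1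
    rw [mem_powersetCard]
    refine ⟨⟨?_, ?_⟩, a1.1 hA.2.1, a2.1 hA.2.2.1, a3.1 hA.2.2.2⟩
    · rw [← hII]; exact Finset.image_subset_image hA.1.1
    · rw [Finset.card_image_of_injective _ σ.injective]; exact hA.1.2
  · rintro ⟨hS, hS'⟩
    rw [mem_powersetCard] at hS
    have hSS : (S.image σ.symm).image σ = S := by
      rw [Finset.image_image]; simp
    have hsub : S.image σ.symm ⊆ I := by
      intro x hx
      obtain ⟨y, hy, rfl⟩ := Finset.mem_image.1 hx
      obtain ⟨z, hz, rfl⟩ := hback y (hS.1 hy)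
      simpa using hz
    obtain ⟨a1, a2, a3⟩ := key _ hsub
    rw [hSS] at a1 a2 a3
    refine ⟨S.image σ.symm, ?_, hSS⟩
    rw [Finset.mem_filter, mem_powersetCard]
    refine ⟨⟨hsub, ?_⟩, a1.2 hS'.1, a2.2 hS'.2.1, a3.2 hS'.2.2⟩
    rw [Finset.card_image_of_injective _ σ.symm.injective]; exact hS.2

theorem stmt2_aux (u t : ℕ) (F : Finset (Finset ℕ))
    (hF : F ⊆ powersetCard (t+5) (Icc 1 (u+2*t+11)))
    (hint : Intersecting F)
    (hdiv : ∀ v ∈ Icc 1 (u+2*t+11), 2 ≤ (F.filter (fun A => v ∉ A)).card)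
    (hM : F.card + ((u+t+5).choose (t+4) + (u+t+4).choose (t+3)) = (u+2*t+10).choose (t+4) + 2) :
    Isomorphic (u+2*t+11) F (Jfam (u+2*t+11) (t+5) 2) := by
  by_cases hex : ∃ v ∈ Icc 1 (u+2*t+11), (F.filter (fun A => v ∉ A)).card = 2
  · obtain ⟨v, hv, hb⟩ := hex
    obtain ⟨B1, B2, h1, h2, hB1, hB2, h12, hFeq⟩ := two_struct u t F v hv hF hint hM hb
    have m1 : Iset (t+5) 1 ∈ powersetCard (t+4+1) (Icc 1 (u+2*t+11)) := by
      rw [mem_powersetCard, Iset, Nat.card_Icc]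
      refine ⟨Finset.Icc_subset_Icc (by omega) (by omega), by omega⟩
    have m2 : Iset (t+5) 2 ∈ powersetCard (t+4+1) (Icc 1 (u+2*t+11)) := by
      rw [mem_powersetCard, Iset, Nat.card_Icc]
      refine ⟨Finset.Icc_subset_Icc (by omega) (by omega), by omega⟩
    have m12 : (Iset (t+5) 1 ∩ Iset (t+5) 2).card = t+4 := by
      have : Iset (t+5) 1 ∩ Iset (t+5) 2 = Icc 3 (t+6) := by
        ext x; simp only [Iset, Finset.mem_inter, Finset.mem_Icc]; omega
      rw [this, Nat.card_Icc]; omega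
    have n1 : 1 ∉ Iset (t+5) 1 := by simp [Iset]
    have n2 : 1 ∉ Iset (t+5) 2 := by simp [Iset]
    obtain ⟨σ, hσ⟩ := relabel (Icc 1 (u+2*t+11)) (lab v B1 B2) (lab 1 (Iset (t+5) 1) (Iset (t+5) 2))
      (fun c => by
        rw [lab_count _ (t+4) v B1 B2 hv h1 h2 hB1 hB2 h12 c,
          lab_count _ (t+4) 1 _ _ (by simp) n1 n2 m1 m2 m12 c])
    refine ⟨σ, fun x hx => (hσ x hx).1, ?_⟩
    rw [hFeq]
    unfold Jfam
    apply map_family _ _ _ _ _ _ _ _ σ (fun x hx => (hσ x hx).1) _ hB1 hB2 m1 m2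
    · intro x hx
      rw [lab_mem1 (B2 := B2) h1, lab_mem1 (B2 := Iset (t+5) 2) n1, (hσ x hx).2]
    · intro x hx
      rw [lab_mem2 (B1 := B1) h2, lab_mem2 (B1 := Iset (t+5) 1) n2, (hσ x hx).2]
    · intro x hx
      rw [lab_v (v := v) (B1 := B1) (B2 := B2), lab_v (v := 1) (B1 := Iset (t+5) 1) (B2 := Iset (t+5) 2),
        (hσ x hx).2]
  · push Not at hex
    exfalso
    refine no_low u t F.card F (by omega) hF hint hM ?_
    intro v hv
    apply dichotomy u t F v hv hF hint hM
    have := hdiv v hv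
    have := hex v hv
    omega

end Helpers

theorem stmt2 (n k : ℕ) (hk : 5 ≤ k) (hn : 2 * k < n)
    (F : Finset (Finset ℕ)) (hF : F ⊆ Finset.powersetCard k (Finset.Icc 1 n))
    (hint : Intersecting F) (hdiv : 2 ≤ diversity n F)
    (hcard : (F.card : ℤ) = ((n - 1).choose (k - 1) : ℤ)
      - ((n - k - 1).choose (k - 1) : ℤ) - ((n - k - 2).choose (k - 2) : ℤ) + 2) :
    Isomorphic n F (Jfam n k 2) := by
  have hdiv' : ∀ v ∈ Finset.Icc 1 n, 2 ≤ (F.filter (fun A => v ∉ A)).card := by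
    intro v hv
    refine le_trans hdiv (Nat.sInf_le ⟨v, ?_, rfl⟩)
    exact Finset.mem_Icc.1 hv
  obtain ⟨t, rfl⟩ := Nat.exists_eq_add_of_le' hk
  obtain ⟨u, hu⟩ := Nat.exists_eq_add_of_le' (show 2 * t + 11 ≤ n by omega)
  have hu' : n = u + 2 * t + 11 := by omega
  subst hu'
  have a1 : u + 2 * t + 11 - 1 = u + 2 * t + 10 := by omega
  have a2 : t + 5 - 1 = t + 4 := by omega
  have a3 : t + 5 - 2 = t + 3 := by omega
  have a4 : u + 2 * t + 11 - (t + 5) - 1 = u + t + 5 := by omega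
  have a5 : u + 2 * t + 11 - (t + 5) - 2 = u + t + 4 := by omega
  rw [a1, a2, a3, a4, a5] at hcard
  exact stmt2_aux u t F hF hint hdiv' (by omega)
end
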